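/- Let p be a prime, K a field of characteristic p, and φ(X) = Σ_{i=d}^{D} c_i X^{p^i} ∈ K[X] a Drinfeld module of special characteristic (1 ≤ d ≤ D, c_d ≠ 0, c_D ≠ 0). Assume φ has positive modular transcendence degree and that Φ[t^∞](K^sep) is finite. Let g ≥ 1 and let X be a Zariski-closed subset of affine g-space defined over K such that X(K̄) contains no translate of any infinite Zariski-closed additive subgroup of K̄^g; i.e. there exist no a ∈ K̄^g and no infinite additive subgroup H of K̄^g that is Zariski-closed with a + H ⊆ X(K̄). Then there exist natural numbers ℓ and m such that for every fully separable field extension L/K and every point a ∈ L^g, the set (a + X(L)) ∩ Φ_{t^m}(L^g) has cardinality at most ℓ, where Φ_{t^m}(L^g) denotes the image of L^g under the coordinatewise m-fold iterate of x ↦ φ(x). -/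

import Mathlib

/-- The `𝔽_p`-linear map `T_φ` induced by the additive polynomial
`φ(X) = Σ_{i=d}^{D} c_i X^{p^i}` of a Drinfeld module of special characteristic. -/
noncomputable def specialTphi {L : Type*} [Field L] (p d D : ℕ) (c : ℕ → L) : L → L :=
  fun x => ∑ i ∈ Finset.Icc d D, c i * x ^ (p ^ i)

/-- `x` is algebraic over the prime field `𝔽_p`. -/
def AlgebraicOverPrimeField {K : Type*} [Field K] (p : ℕ) [CharP K p] (x : K) : Prop :=
  ∃ Q : Polynomial (ZMod p), Q ≠ 0 ∧
    Polynomial.eval₂ (ZMod.castHom (dvd_refl p) K) x Q = 0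

/-- `φ = Σ_{i=d}^{D} c_i X^{p^i}` has positive modular transcendence degree: there is no
nonzero `γ` in the algebraic closure of `K` such that every coefficient of `γ⁻¹·φ(γX)`
is algebraic over `𝔽_p`. -/
def PosModularTransc {K : Type*} [Field K] (p : ℕ) [CharP K p] (d D : ℕ) (c : ℕ → K) :
    Prop :=
  ¬ ∃ γ : AlgebraicClosure K, γ ≠ 0 ∧ ∀ j : ℕ,
      AlgebraicOverPrimeField p
        ((Polynomial.C γ⁻¹ *
          ((∑ i ∈ Finset.Icc d D,
            Polynomial.C (algebraMap K (AlgebraicClosure K) (c i)) *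
              Polynomial.X ^ (p ^ i)).comp
            (Polynomial.C γ * Polynomial.X))).coeff j)

/-- `B` is a `p`-basis of `F`: the monomials `∏_{b ∈ S} b^{e_b}` (`S ⊆ B` finite,
`0 ≤ e_b ≤ p − 1`) form a basis of `F` as a vector space over the subfield `F^p` of
`p`-th powers. -/
def IsPBasis (p : ℕ) [Fact p.Prime] (F : Type*) [Field F] [CharP F p] (B : Set F) : Prop :=
  letI Fp : Subfield F := (frobenius F p).fieldRange
  letI fam : {e : ↥B →₀ ℕ // ∀ b, e b < p} → F :=
    fun e => (e : ↥B →₀ ℕ).prod fun b n => (b : F) ^ n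
  LinearIndependent ↥Fp fam ∧ Submodule.span ↥Fp (Set.range fam) = ⊤

/-- `L/K` is fully separable: some `p`-basis of `K` is also a `p`-basis of `L`. -/
def FullySeparable (p : ℕ) [Fact p.Prime] (K L : Type*) [Field K] [Field L] [CharP K p]
    [CharP L p] [Algebra K L] : Prop :=
  ∃ B : Set K, IsPBasis p K B ∧ IsPBasis p L (algebraMap K L '' B)

/-- The zero locus in `M^g` of an ideal of polynomials over `F`, via a ring hom
`F →+* M`. -/
def zeroLocusVia {F M : Type*} [Field F] [CommRing M] {g : ℕ}
    (I : Ideal (MvPolynomial (Fin g) F)) (f : F →+* M) : Set (Fin g → M) :=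
  {x | ∀ q ∈ I, MvPolynomial.eval₂ f x q = 0}


universe u v

namespace SpecialDrinfeld

section FrobComb

variable {p : ℕ} [Fact p.Prime]

/-- The additive map `z ↦ Σ_j z_j ^ p * ε_j`. -/
noncomputable def frobComb (p : ℕ) [Fact p.Prime] {J M : Type*} [Field M] [CharP M p] (ε : J → M) :
    (J →₀ M) →+ M :=
  Finsupp.liftAddHom fun j =>
    (AddMonoidHom.mulRight (ε j)).comp (frobenius M p).toAddMonoidHom

theorem frobComb_apply {J M : Type*} [Field M] [CharP M p] (ε : J → M) (z : J →₀ M) :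
    frobComb p ε z = z.sum fun j x => x ^ p * ε j := by
  simp only [frobComb, Finsupp.liftAddHom_apply]
  rfl

theorem frobComb_single {J M : Type*} [Field M] [CharP M p] (ε : J → M) (j : J) (x : M) :
    frobComb p ε (Finsupp.single j x) = x ^ p * ε j := by
  rw [frobComb_apply, Finsupp.sum_single_index]
  simp [(Fact.out : p.Prime).ne_zero]

theorem frobComb_smul {J M : Type*} [Field M] [CharP M p] (ε : J → M) (c : M) (z : J →₀ M) :
    frobComb p ε (c • z) = c ^ p * frobComb p ε z := by
  induction z using Finsupp.induction_linear with
  | zero => simp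
  | add f g hf hg => rw [smul_add, map_add, map_add, hf, hg, mul_add]
  | single j x => rw [Finsupp.smul_single, frobComb_single, frobComb_single, smul_eq_mul, mul_pow,
      mul_assoc]

theorem frobComb_map {J F M : Type*} [Field F] [CharP F p] [Field M] [CharP M p] (f : F →+* M)
    (ε : J → F) (z : J →₀ F) :
    frobComb p (fun j => f (ε j)) (z.mapRange f (map_zero f)) = f (frobComb p ε z) := by
  induction z using Finsupp.induction_linear with
  | zero => simp
  | add a b ha hb => rw [Finsupp.mapRange_add (hf' := map_add f), map_add, map_add, map_add, ha, hb]
  | single j x => simp [frobComb_single]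

theorem frobComb_equivMapDomain {J J' M : Type*} [Field M] [CharP M p] (e : J ≃ J') (ε : J' → M)
    (z : J →₀ M) : frobComb p ε (z.equivMapDomain e) = frobComb p (fun j => ε (e j)) z := by
  induction z using Finsupp.induction_linear with
  | zero => simp
  | add a b ha hb =>
    simp only [Finsupp.equivMapDomain_eq_mapDomain, Finsupp.mapDomain_add, map_add] at *
    rw [ha, hb]
  | single j x => simp [frobComb_single]

theorem frobComb_eq_linearCombination {J F : Type*} [Field F] [CharP F p] (ε : J → F)
    (z : J →₀ F) :
    frobComb p ε z = Finsupp.linearCombination (frobenius F p).fieldRange ε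
      (z.mapRange (frobenius F p).rangeRestrictField (map_zero _)) := by
  induction z using Finsupp.induction_linear with
  | zero => simp
  | add a b ha hb => rw [Finsupp.mapRange_add (hf' := map_add _), map_add, map_add, ha, hb]
  | single j x => simp [frobComb_single, Subfield.smul_def, frobenius_def]

theorem frobComb_injective {J F : Type*} [Field F] [CharP F p] {ε : J → F}
    (h : LinearIndependent (frobenius F p).fieldRange ε) :
    Function.Injective (frobComb p ε) := by
  rw [injective_iff_map_eq_zero]
  intro z hz
  rw [frobComb_eq_linearCombination] at hz
  have := linearIndependent_iff.1 h _ hz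
  ext j
  have hj := DFunLike.congr_fun this j
  rw [Finsupp.mapRange_apply] at hj
  simpa using hj

theorem frobComb_surjective {J F : Type*} [Field F] [CharP F p] {ε : J → F}
    (h : Submodule.span (frobenius F p).fieldRange (Set.range ε) = ⊤) :
    Function.Surjective (frobComb p ε) := by
  intro x
  obtain ⟨z, rfl⟩ := (Finsupp.mem_span_range_iff_exists_finsupp
    (R := (frobenius F p).fieldRange)).1 (h ▸ Submodule.mem_top (x := x))
  obtain ⟨w, rfl⟩ := Finsupp.mapRange_surjective (frobenius F p).rangeRestrictField
    (map_zero _) ((RingHom.rangeRestrictField_bijective _).2) z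
  exact ⟨w, by rw [frobComb_eq_linearCombination]; rfl⟩

/-- Some basis of `F` over its field of `p`-th powers stays linearly independent over the
`p`-th powers of `M`. -/
def PSep (p : ℕ) [Fact p.Prime] (F M : Type*) [Field F] [CharP F p] [Field M] [CharP M p]
    [Algebra F M] : Prop :=
  ∃ S : Set F, Function.Surjective (frobComb p (fun s : S => (s : F))) ∧
    Function.Injective (frobComb p (fun s : S => algebraMap F M s))

theorem PSep.of_family {F M J : Type*} [Field F] [CharP F p] [Field M] [CharP M p]
    [Algebra F M] (ε : J → F) (h1 : Function.Surjective (frobComb p ε))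
    (h2 : Function.Injective (frobComb p fun j => algebraMap F M (ε j))) : PSep p F M := by
  have hinj : Function.Injective ε := by
    intro i j hij
    have : Finsupp.single i (1 : M) = Finsupp.single j 1 := h2 (by simp [frobComb_single, hij])
    exact Finsupp.single_left_injective one_ne_zero this
  let e : J ≃ Set.range ε := Equiv.ofInjective ε hinj
  refine ⟨Set.range ε, fun x => ?_, fun x y hxy => ?_⟩
  · obtain ⟨z, hz⟩ := h1 x
    exact ⟨z.equivMapDomain e, by rw [frobComb_equivMapDomain]; exact hz⟩
  · obtain ⟨x, rfl⟩ := (Finsupp.equivCongrLeft e).surjective x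
    obtain ⟨y, rfl⟩ := (Finsupp.equivCongrLeft e).surjective y
    simp only [Finsupp.equivCongrLeft_apply] at hxy ⊢
    rw [frobComb_equivMapDomain, frobComb_equivMapDomain] at hxy
    rw [h2 hxy]

theorem PSep.linearIndependent_pow {F M ι : Type*} [Field F] [CharP F p] [Field M] [CharP M p]
    [Algebra F M] (h : PSep p F M) {v : ι → M} (hv : LinearIndependent F v) :
    LinearIndependent F fun i => v i ^ p := by
  obtain ⟨S, h1, h2⟩ := h
  rw [linearIndependent_iff'] at hv ⊢
  intro s c hc
  choose a ha using fun i => h1 (c i)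
  have hz : (∑ i ∈ s, v i • (a i).mapRange (algebraMap F M) (map_zero _)) = 0 := by
    apply h2
    rw [map_sum, map_zero, ← hc]
    refine Finset.sum_congr rfl fun i _ => ?_
    rw [frobComb_smul, frobComb_map (algebraMap F M) (fun s : S => (s : F)), ha, Algebra.smul_def,
      mul_comm]
  have hz' : ∀ t, ∑ i ∈ s, a i t • v i = 0 := by
    intro t
    have := DFunLike.congr_fun hz t
    rw [Finsupp.finsetSum_apply] at this
    simpa [Algebra.smul_def, mul_comm] using this
  intro i hi
  have : a i = 0 := Finsupp.ext fun t => hv s (fun i => a i t) (hz' t) i hi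
  rw [← ha, this, map_zero]

theorem PSep.linearIndependent_pow_pow {F M ι : Type*} [Field F] [CharP F p] [Field M] [CharP M p]
    [Algebra F M] (h : PSep p F M) {v : ι → M} (hv : LinearIndependent F v) (n : ℕ) :
    LinearIndependent F fun i => v i ^ p ^ n := by
  induction n with
  | zero => simpa using hv
  | succ n ih => simpa only [← pow_mul, ← pow_succ] using h.linearIndependent_pow ih

theorem PSep.self (F : Type*) [Field F] [CharP F p] : PSep p F F :=
  PSep.of_family (fun x => Module.Basis.ofVectorSpace (frobenius F p).fieldRange F x)
    (frobComb_surjective (Module.Basis.span_eq _))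
    (frobComb_injective (Module.Basis.linearIndependent _))

end FrobComb

theorem FullySeparable.pSep {p : ℕ} [Fact p.Prime] {K L : Type*} [Field K] [Field L] [CharP K p]
    [CharP L p] [Algebra K L] (h : FullySeparable p K L) : PSep p K L := by
  obtain ⟨B, ⟨-, h1⟩, h2, -⟩ := h
  let f := algebraMap K L
  let e : B ≃ (f '' B) := Equiv.Set.image f B f.injective
  let E : {e : ↥B →₀ ℕ // ∀ b, e b < p} → {e : ↥(f '' B) →₀ ℕ // ∀ b, e b < p} :=
    fun m => ⟨m.1.equivMapDomain e, fun b => m.2 _⟩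
  have hE : Function.Injective E := by
    intro m m' hm
    have := congrArg Subtype.val hm
    exact Subtype.ext ((Finsupp.equivCongrLeft e).injective this)
  have h3 := h2.comp E hE
  refine PSep.of_family _ (frobComb_surjective h1) ?_
  convert frobComb_injective h3 using 2
  refine congrArg (frobComb p) (funext fun m => ?_)
  change f _ = (m.1.equivMapDomain e).prod _
  rw [Finsupp.prod_equivMapDomain, Finsupp.prod, Finsupp.prod, map_prod]
  exact Finset.prod_congr rfl fun b _ => map_pow f _ _

end SpecialDrinfeld

namespace SpecialDrinfeld

open Filter

section PSepMore

variable {p : ℕ} [Fact p.Prime]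

theorem frobComb_algebraMap_injective {J L M : Type*} [Field L] [CharP L p] [Field M] [CharP M p]
    [Algebra L M]
    (h : ∀ s : Set M, LinearIndependent L (fun x : s => (x : M)) →
      LinearIndependent L fun x : s => (x : M) ^ p)
    {ε : J → L} (hε : Function.Injective (frobComb p ε)) :
    Function.Injective (frobComb p fun j => algebraMap L M (ε j)) := by
  classical
  rw [injective_iff_map_eq_zero]
  intro z hz
  let b := Module.Basis.ofVectorSpace L M
  let w : Module.Basis.ofVectorSpaceIndex L M → (J →₀ L) := fun i =>
    z.mapRange (fun x => b.coord i x) (map_zero _)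
  let T := z.support.biUnion fun j => (b.repr (z j)).support
  have hw : z = ∑ i ∈ T, b i • (w i).mapRange (algebraMap L M) (map_zero _) := by
    ext j
    rw [Finsupp.finsetSum_apply]
    by_cases hj : j ∈ z.support
    · conv_lhs => rw [← b.linearCombination_repr (z j)]
      rw [Finsupp.linearCombination_apply, Finsupp.sum_of_support_subset (s := T)]
      · refine Finset.sum_congr rfl fun i _ => ?_
        simp [w, Algebra.smul_def, mul_comm]
      · exact Finset.subset_biUnion_of_mem (fun j => (b.repr (z j)).support) hj
      · simp
    · have : z j = 0 := by simpa using hj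
      simp [w, this]
  have hli := linearIndependent_iff'.1
    (h (Module.Basis.ofVectorSpaceIndex L M) (by
      simpa [b] using b.linearIndependent))
    T (fun i => frobComb p ε (w i)) (by
      rw [← hz]
      conv_rhs => rw [hw]
      rw [map_sum]
      refine Finset.sum_congr rfl fun i _ => ?_
      rw [frobComb_smul, frobComb_map, Algebra.smul_def, mul_comm]
      simp [b])
  rw [hw]
  refine Finset.sum_eq_zero fun i hi => ?_
  have : w i = 0 := (injective_iff_map_eq_zero _).1 hε _ (hli i hi)
  simp [this]

theorem PSep.injective {F M J : Type*} [Field F] [CharP F p] [Field M] [CharP M p]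
    [Algebra F M] (h : PSep p F M) {ε : J → F} (hε : Function.Injective (frobComb p ε)) :
    Function.Injective (frobComb p fun j => algebraMap F M (ε j)) :=
  frobComb_algebraMap_injective (fun _ hs => h.linearIndependent_pow hs) hε

theorem PSep.trans_separable {F L M : Type*} [Field F] [CharP F p] [Field L] [CharP L p] [Field M]
    [CharP M p] [Algebra F L] [Algebra L M] [Algebra F M] [IsScalarTower F L M]
    [Algebra.IsSeparable L M] (h : PSep p F L) : PSep p F M := by
  obtain ⟨S, h1, h2⟩ := h
  refine ⟨S, h1, ?_⟩
  have : ExpChar L p := ExpChar.prime Fact.out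
  have : ExpChar M p := ExpChar.prime Fact.out
  have := frobComb_algebraMap_injective (M := M) (fun s hs => by
    simpa using LinearIndependent.map_pow_expChar_pow_of_isSeparable (q := p) 1 hs) h2
  simpa only [← IsScalarTower.algebraMap_apply] using this

/-- An element algebraic over `F` in an extension `M` with `PSep p F M` is separable over `F`. -/
theorem PSep.isSeparable {F M : Type*} [Field F] [CharP F p] [Field M] [CharP M p]
    [Algebra F M] (h : PSep p F M) {x : M} (hx : IsAlgebraic F x) : IsSeparable F x := by
  have : ExpChar F p := ExpChar.prime Fact.out
  by_contra hs
  have h_int : IsIntegral F x := hx.isIntegral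
  have hirr := minpoly.irreducible h_int
  obtain ⟨q, hq⟩ : ∃ q : Polynomial F, Polynomial.expand F p q = minpoly F x := by
    have h1 : (minpoly F x).derivative = 0 := by
      by_contra h0
      exact hs ((Polynomial.separable_iff_derivative_ne_zero hirr).2 h0)
    exact ⟨_, Polynomial.expand_contract p h1 (Fact.out : p.Prime).ne_zero⟩
  have hq0 : q ≠ 0 := by
    rintro rfl
    exact minpoly.ne_zero h_int (by rw [← hq, map_zero])
  have hdeg : q.natDegree < (minpoly F x).natDegree := by
    rw [← hq, Polynomial.natDegree_expand]
    have : 0 < q.natDegree := by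
      have := minpoly.natDegree_pos h_int
      rw [← hq, Polynomial.natDegree_expand] at this
      exact Nat.pos_of_mul_pos_right this
    nlinarith [(Fact.out : p.Prime).two_le]
  have hli : LinearIndependent F fun i : Fin (minpoly F x).natDegree => x ^ (i : ℕ) :=
    _root_.linearIndependent_pow x
  have := h.linearIndependent_pow hli
  rw [Fintype.linearIndependent_iff] at this
  have h2 := this (fun i => q.coeff i) (by
    have : Polynomial.aeval x (Polynomial.expand F p q) = 0 := by rw [hq, minpoly.aeval]
    rw [Polynomial.expand_aeval, Polynomial.aeval_eq_sum_range' hdeg, ← Fin.sum_univ_eq_sum_range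
      (fun i => q.coeff i • (x ^ p) ^ i)] at this
    rw [← this]
    exact Finset.sum_congr rfl fun i _ => by rw [← pow_mul, ← pow_mul, mul_comm])
  apply hq0
  ext i
  by_cases hi : i < (minpoly F x).natDegree
  · simpa using h2 ⟨i, hi⟩
  · exact Polynomial.coeff_eq_zero_of_natDegree_lt (by omega)

end PSepMore

section Ultraproduct

/-- The ideal of sequences vanishing along the hyperfilter on `ℕ`. -/
def ultraIdeal (L : ℕ → Type v) [∀ n, Field (L n)] : Ideal (∀ n, L n) where
  carrier := {x | ∀ᶠ n in hyperfilter ℕ, x n = 0}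
  zero_mem' := Eventually.of_forall fun _ => rfl
  add_mem' := fun {a b} ha hb => by
    filter_upwards [ha, hb] with n h1 h2
    simp [h1, h2]
  smul_mem' := fun c a ha => by
    filter_upwards [ha] with n h1
    simp [h1]

theorem ultraIdeal_isMaximal (L : ℕ → Type v) [∀ n, Field (L n)] : (ultraIdeal L).IsMaximal := by
  rw [Ideal.isMaximal_iff]
  constructor
  · intro h
    obtain ⟨n, hn⟩ := (show ∀ᶠ n in hyperfilter ℕ, (1 : ∀ n, L n) n = 0 from h).exists
    exact one_ne_zero hn
  · intro J x hJ hx hxJ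
    have h1 : ∀ᶠ n in hyperfilter ℕ, x n ≠ 0 := by
      by_contra h
      simp only [ne_eq, Ultrafilter.eventually_not, not_not] at h
      exact hx h
    have h2 : (1 - (fun n => (x n)⁻¹) * x : ∀ n, L n) ∈ ultraIdeal L := by
      filter_upwards [h1] with n hn
      simp [hn]
    have := J.add_mem (hJ h2) (J.mul_mem_left (fun n => (x n)⁻¹) hxJ)
    simpa using this

theorem exists_ultraproduct (L : ℕ → Type v) [∀ n, Field (L n)] :
    ∃ (M : Type v) (_ : Field M) (mk : (∀ n, L n) →+* M), Function.Surjective mk ∧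
      ∀ x, mk x = 0 ↔ ∀ᶠ n in hyperfilter ℕ, x n = 0 := by
  have := ultraIdeal_isMaximal L
  refine ⟨(∀ n, L n) ⧸ ultraIdeal L, Ideal.Quotient.field _, Ideal.Quotient.mk _,
    Ideal.Quotient.mk_surjective, fun x => ?_⟩
  exact Ideal.Quotient.eq_zero_iff_mem

theorem PSep.ultraproduct {p : ℕ} [Fact p.Prime] {K : Type u} [Field K] [CharP K p]
    {L : ℕ → Type v} [∀ n, Field (L n)] [∀ n, CharP (L n) p] [∀ n, Algebra K (L n)]
    (h : ∀ n, PSep p K (L n)) {M : Type v} [Field M] [CharP M p] [Algebra K M]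
    (mk : (∀ n, L n) →+* M) (hmk : Function.Surjective mk)
    (hmk0 : ∀ x, mk x = 0 ↔ ∀ᶠ n in hyperfilter ℕ, x n = 0)
    (halg : ∀ c, algebraMap K M c = mk fun n => algebraMap K (L n) c) : PSep p K M := by
  classical
  obtain ⟨S, h1, h2⟩ := PSep.self (p := p) K
  simp only [Algebra.algebraMap_self, RingHom.id_apply] at h2
  refine ⟨S, h1, ?_⟩
  rw [injective_iff_map_eq_zero]
  intro z hz
  obtain ⟨r, hr, hr0⟩ : ∃ r : M → ∀ n, L n, (∀ x, mk (r x) = x) ∧ r 0 = 0 := by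
    choose r hr using hmk
    refine ⟨Function.update r 0 0, fun x => ?_, by simp⟩
    by_cases hx : x = 0
    · simp [hx]
    · simp [hx, hr]
  let w : ∀ n, S →₀ L n := fun n => z.mapRange (fun x => r x n) (by simp [hr0])
  have h3 : mk (fun n => frobComb p (fun s : S => algebraMap K (L n) s) (w n)) = 0 := by
    rw [← hz, frobComb_apply, Finsupp.sum]
    have : (fun n => frobComb p (fun s : S => algebraMap K (L n) s) (w n)) =
        ∑ s ∈ z.support, r (z s) ^ p * fun n => algebraMap K (L n) s := by
      funext n
      rw [frobComb_apply, Finsupp.sum_of_support_subset (s := z.support)]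
      · simp [w]
      · exact Finsupp.support_mapRange
      · simp [(Fact.out : p.Prime).ne_zero]
    rw [this, map_sum]
    refine Finset.sum_congr rfl fun s _ => ?_
    rw [map_mul, map_pow, hr, halg]
  rw [hmk0] at h3
  ext s
  rw [Finsupp.zero_apply, ← hr (z s), hmk0]
  filter_upwards [h3] with n hn
  have := (injective_iff_map_eq_zero _).1 ((h n).injective h2) _ hn
  simpa [w] using DFunLike.congr_fun this s

end Ultraproduct

end SpecialDrinfeld

namespace SpecialDrinfeld

open Polynomial

section AdditivePolynomials

variable {p : ℕ} [Fact p.Prime] {K : Type*} [Field K] [CharP K p]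

/-- The space of additive polynomials, spanned by the monomials `X ^ p ^ i`. -/
noncomputable def additivePolys (p : ℕ) (K : Type*) [Field K] : Submodule K K[X] :=
  Submodule.span K (Set.range fun i : ℕ => (X : K[X]) ^ p ^ i)

omit [CharP K p] in
theorem aeval_add_of_mem_additivePolys {f : K[X]} (hf : f ∈ additivePolys p K) {R : Type*}
    [CommRing R] [Algebra K R] [CharP R p] (x y : R) :
    aeval (x + y) f = aeval x f + aeval y f := by
  induction hf using Submodule.span_induction with
  | mem f hf =>
    obtain ⟨i, rfl⟩ := hf
    simp [add_pow_char_pow]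
  | zero => simp
  | add f g _ _ hf hg => simp only [map_add, hf, hg]; ring
  | smul a f _ hf => simp only [map_smul, hf, smul_add]

theorem pow_mem_additivePolys {f : K[X]} (hf : f ∈ additivePolys p K) (n : ℕ) :
    f ^ p ^ n ∈ additivePolys p K := by
  induction hf using Submodule.span_induction with
  | mem f hf =>
    obtain ⟨i, rfl⟩ := hf
    exact Submodule.subset_span ⟨i + n, by simp only [pow_add, pow_mul]⟩
  | zero => simp [(Fact.out : p.Prime).ne_zero]
  | add f g _ _ hf hg => rw [add_pow_char_pow]; exact add_mem hf hg
  | smul a f _ hf => rw [_root_.smul_pow]; exact Submodule.smul_mem _ _ hf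

theorem comp_mem_additivePolys {f g : K[X]} (hf : f ∈ additivePolys p K)
    (hg : g ∈ additivePolys p K) : f.comp g ∈ additivePolys p K := by
  induction hf using Submodule.span_induction with
  | mem f hf =>
    obtain ⟨i, rfl⟩ := hf
    simpa using pow_mem_additivePolys hg i
  | zero => simp
  | add f h _ _ hf hh => rw [add_comp]; exact add_mem hf hh
  | smul a f _ hf => rw [smul_comp]; exact Submodule.smul_mem _ _ hf

omit [Fact p.Prime] [CharP K p] in
theorem map_mem_additivePolys {L : Type*} [Field L] (σ : K →+* L) {f : K[X]}
    (hf : f ∈ additivePolys p K) : f.map σ ∈ additivePolys p L := by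
  induction hf using Submodule.span_induction with
  | mem f hf =>
    obtain ⟨i, rfl⟩ := hf
    exact Submodule.subset_span ⟨i, by simp⟩
  | zero => simp
  | add f h _ _ hf hh => rw [Polynomial.map_add]; exact add_mem hf hh
  | smul a f _ hf => rw [Polynomial.map_smul]; exact Submodule.smul_mem _ _ hf

omit [CharP K p] in
theorem coeff_zero_of_mem_additivePolys {f : K[X]} (hf : f ∈ additivePolys p K) :
    f.coeff 0 = 0 := by
  induction hf using Submodule.span_induction with
  | mem f hf =>
    obtain ⟨i, rfl⟩ := hf
    simp [coeff_X_pow, (pow_pos (Fact.out : p.Prime).pos i).ne]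
  | zero => simp
  | add f h _ _ hf hh => simp [hf, hh]
  | smul a f _ hf => simp [hf]

end AdditivePolynomials

section Tphi

variable {p : ℕ} [Fact p.Prime]

omit [Fact p.Prime] in
theorem specialTphi_map {K L : Type*} [Field K] [Field L] (d D : ℕ) (c : ℕ → K) (σ : K →+* L)
    (x : K) : specialTphi p d D (fun i => σ (c i)) (σ x) = σ (specialTphi p d D c x) := by
  simp [specialTphi]

omit [Fact p.Prime] in
theorem specialTphi_iterate_map {K L : Type*} [Field K] [Field L] (d D : ℕ) (c : ℕ → K)
    (σ : K →+* L) (n : ℕ) (x : K) :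
    (specialTphi p d D fun i => σ (c i))^[n] (σ x) = σ ((specialTphi p d D c)^[n] x) :=
  ((Function.Semiconj.iterate_right (f := σ) (fun y => (specialTphi_map d D c σ y).symm) n) x).symm

theorem specialTphi_zero {K : Type*} [Field K] (d D : ℕ) (c : ℕ → K) :
    specialTphi p d D c 0 = 0 := by
  simp [specialTphi, (Fact.out : p.Prime).ne_zero]

theorem specialTphi_iterate_zero {K : Type*} [Field K] (d D : ℕ) (c : ℕ → K) (n : ℕ) :
    (specialTphi p d D c)^[n] 0 = 0 :=
  Function.iterate_fixed (specialTphi_zero d D c) n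

theorem specialTphi_sub {K : Type*} [Field K] [CharP K p] (d D : ℕ) (c : ℕ → K) (x y : K) :
    specialTphi p d D c (x - y) = specialTphi p d D c x - specialTphi p d D c y := by
  simp [specialTphi, sub_pow_char_pow, mul_sub]

theorem specialTphi_iterate_sub {K : Type*} [Field K] [CharP K p] (d D : ℕ) (c : ℕ → K) (n : ℕ)
    (x y : K) : (specialTphi p d D c)^[n] (x - y) =
      (specialTphi p d D c)^[n] x - (specialTphi p d D c)^[n] y := by
  induction n generalizing x y with
  | zero => rfl
  | succ n ih => simp only [Function.iterate_succ_apply, specialTphi_sub, ih]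

/-- The `m`-th iterate of `φ` is a separable additive polynomial in `x ^ p ^ (d * m)`. -/
theorem exists_separable_part {K : Type*} [Field K] [CharP K p] {d D : ℕ} (hdD : d ≤ D)
    {c : ℕ → K} (hcd : c d ≠ 0) (hcD : c D ≠ 0) (m : ℕ) :
    ∃ ψ : K[X], ψ ∈ additivePolys p K ∧ (∃ e : K, e ≠ 0 ∧ derivative ψ = C e) ∧
      ψ.natDegree = p ^ ((D - d) * m) ∧
      ∀ {L : Type*} [Field L] [Algebra K L] (x : L),
        (specialTphi p d D fun i => algebraMap K L (c i))^[m] x = aeval (x ^ p ^ (d * m)) ψ := by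
  have hp1 := (Fact.out : p.Prime).one_lt
  let ψ₁ : K[X] := ∑ i ∈ Finset.Icc d D, c i • X ^ p ^ (i - d)
  have h1 : ψ₁ ∈ additivePolys p K := Submodule.sum_mem _ fun i _ =>
    Submodule.smul_mem _ _ (Submodule.subset_span ⟨i - d, rfl⟩)
  have h2 : derivative ψ₁ = C (c d) := by
    simp only [ψ₁, derivative_sum, derivative_smul, derivative_X_pow]
    rw [Finset.sum_eq_single_of_mem d (by simp [hdD])]
    · simp [smul_eq_C_mul]
    · intro i hi hid
      have : i - d ≠ 0 := by have := (Finset.mem_Icc.1 hi).1; omega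
      simp [this]
  have h3 : ψ₁.natDegree = p ^ (D - d) := by
    apply natDegree_eq_of_le_of_coeff_ne_zero
    · refine natDegree_sum_le_of_forall_le _ _ fun i hi => ?_
      refine (natDegree_smul_le _ _).trans ?_
      rw [natDegree_X_pow]
      have := (Finset.mem_Icc.1 hi).2
      exact Nat.pow_le_pow_right hp1.le (by omega)
    · simp only [ψ₁, finsetSum_coeff, coeff_smul, coeff_X_pow]
      rw [Finset.sum_eq_single_of_mem D (by simp [hdD])]
      · simpa using hcD
      · intro i hi hiD
        have h := Finset.mem_Icc.1 hi
        rw [if_neg, smul_zero]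
        intro h'
        have := Nat.pow_right_injective hp1 h'
        omega
  have h4 : ∀ {L : Type _} [Field L] [Algebra K L] (x : L),
      (specialTphi p d D fun i => algebraMap K L (c i)) x = aeval (x ^ p ^ d) ψ₁ := by
    intro L _ _ x
    simp only [specialTphi, ψ₁, map_sum, map_smul, map_pow, aeval_X]
    refine Finset.sum_congr rfl fun i hi => ?_
    have h := Finset.mem_Icc.1 hi
    rw [← pow_mul, ← pow_add, Nat.add_sub_of_le h.1, Algebra.smul_def]
  induction m with
  | zero => exact ⟨X, Submodule.subset_span ⟨0, by simp⟩, ⟨1, one_ne_zero, by simp⟩, by simp,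
      by simp⟩
  | succ m ih =>
    obtain ⟨ψ, hψ, ⟨e, he, hd⟩, hdeg, hev⟩ := ih
    let σ : K →+* K := iterateFrobenius K p (d * m)
    refine ⟨ψ.comp (ψ₁.map σ), comp_mem_additivePolys hψ (map_mem_additivePolys σ h1),
      ⟨σ (c d) * e, mul_ne_zero (by simpa using hcd) he, ?_⟩, ?_, ?_⟩
    · rw [derivative_comp, hd, C_comp, derivative_map, h2, map_C, C_mul]
    · rw [natDegree_comp, natDegree_map, hdeg, h3, ← pow_add]
      ring_nf
    · intro L _ _ x
      have : CharP L p := charP_of_injective_algebraMap (algebraMap K L).injective p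
      rw [Function.iterate_succ_apply, hev, h4, aeval_comp]
      have : (aeval (x ^ p ^ d) ψ₁) ^ p ^ (d * m) =
          aeval (x ^ p ^ (d * (m + 1))) (ψ₁.map σ) := by
        rw [aeval_def, aeval_def, eval₂_map, ← iterateFrobenius_def (R := L), hom_eval₂]
        congr 1
        · refine RingHom.ext fun a => ?_
          simp [σ, iterateFrobenius_def]
        · rw [iterateFrobenius_def, ← pow_mul, ← pow_add, mul_add, mul_one, add_comm]
      rw [this]

/-- All torsion separable over `K` is killed by a fixed power of `φ`, also in extensions in which
algebraic elements are separable. -/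
theorem exists_torsion_bound {K : Type*} [Field K] [CharP K p] {d D : ℕ} (hdD : d ≤ D)
    {c : ℕ → K} (hcd : c d ≠ 0) (hcD : c D ≠ 0)
    (htor : {x : AlgebraicClosure K | x ∈ separableClosure K (AlgebraicClosure K) ∧
      ∃ n : ℕ, (specialTphi p d D (fun i => algebraMap K (AlgebraicClosure K) (c i)))^[n] x
        = 0}.Finite) :
    ∃ n₀ : ℕ, ∀ {M : Type*} [Field M] [CharP M p] [Algebra K M], PSep p K M → ∀ (z : M) (n : ℕ),
      (specialTphi p d D fun i => algebraMap K M (c i))^[n] z = 0 →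
      (specialTphi p d D fun i => algebraMap K M (c i))^[n₀] z = 0 := by
  obtain ⟨n₀, hn₀⟩ : ∃ n₀ : ℕ, ∀ z : AlgebraicClosure K, IsSeparable K z → ∀ n : ℕ,
      (specialTphi p d D fun i => algebraMap K (AlgebraicClosure K) (c i))^[n] z = 0 →
      (specialTphi p d D fun i => algebraMap K (AlgebraicClosure K) (c i))^[n₀] z = 0 := by
    choose! N hN using fun (x : AlgebraicClosure K) (hx : ∃ n : ℕ,
      (specialTphi p d D (fun i => algebraMap K (AlgebraicClosure K) (c i)))^[n] x = 0) => hx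
    refine ⟨htor.toFinset.sup N, fun z hz n hn => ?_⟩
    have hle : N z ≤ htor.toFinset.sup N :=
      Finset.le_sup (htor.mem_toFinset.2 ⟨mem_separableClosure_iff.2 hz, n, hn⟩)
    rw [← Nat.sub_add_cancel hle, Function.iterate_add_apply, hN z ⟨n, hn⟩,
      specialTphi_iterate_zero]
  refine ⟨n₀, fun {M} _ _ _ hM z n hz => ?_⟩
  have halg : IsAlgebraic K z := by
    obtain ⟨ψ, -, -, hdeg, hev⟩ := exists_separable_part (p := p) hdD hcd hcD n
    rw [hev] at hz
    have : IsAlgebraic K (z ^ p ^ (d * n)) := ⟨ψ, by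
      rintro rfl
      exact (pow_pos (Fact.out : p.Prime).pos _).ne hdeg, hz⟩
    exact this.of_pow (pow_pos (Fact.out : p.Prime).pos _)
  have hsep := hM.isSeparable halg
  let E := IntermediateField.adjoin K {z}
  have : Algebra.IsAlgebraic K E := IntermediateField.isAlgebraic_adjoin_simple halg.isIntegral
  let σ : E →ₐ[K] AlgebraicClosure K := IsAlgClosed.lift
  let z' : E := IntermediateField.AdjoinSimple.gen K z
  have hz' : algebraMap E M z' = z := IntermediateField.AdjoinSimple.algebraMap_gen K z
  have e1 : ∀ k, algebraMap E M ((specialTphi p d D fun i => algebraMap K E (c i))^[k] z') =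
      (specialTphi p d D fun i => algebraMap K M (c i))^[k] z := fun k => by
    rw [← specialTphi_iterate_map, hz']
    rfl
  have e2 : ∀ k, σ ((specialTphi p d D fun i => algebraMap K E (c i))^[k] z') =
      (specialTphi p d D fun i => algebraMap K (AlgebraicClosure K) (c i))^[k] (σ z') := fun k => by
    have := specialTphi_iterate_map (p := p) d D (fun i => algebraMap K E (c i)) σ.toRingHom k z'
    simpa using this.symm
  have h1 : (specialTphi p d D fun i => algebraMap K E (c i))^[n] z' = 0 :=
    (algebraMap E M).injective (by rw [e1, hz, map_zero])
  have h2 := hn₀ (σ z') (by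
    rw [IsSeparable, minpoly.algHom_eq σ σ.injective, ← minpoly.algebraMap_eq
      (algebraMap E M).injective, hz']
    exact hsep) n (by rw [← e2, h1, map_zero])
  rw [← e2, map_eq_zero] at h2
  rw [← e1, h2, map_zero]

end Tphi

theorem PosModularTransc.ne {p : ℕ} [Fact p.Prime] {K : Type*} [Field K] [CharP K p]
    {d D : ℕ} (hd : 1 ≤ d) {c : ℕ → K} (hcd : c d ≠ 0) (h : PosModularTransc p d D c) :
    d ≠ D := by
  rintro rfl
  have hp1 := (Fact.out : p.Prime).one_lt
  have h1 : 1 < p ^ d := Nat.one_lt_pow (by omega) hp1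
  obtain ⟨γ, hγ⟩ := IsAlgClosed.exists_pow_nat_eq (algebraMap K (AlgebraicClosure K) (c d))⁻¹
    (n := p ^ d - 1) (by omega)
  have hγ0 : γ ≠ 0 := by
    rintro rfl
    rw [zero_pow (by omega)] at hγ
    exact hcd (by simpa using hγ.symm)
  refine h ⟨γ, hγ0, fun j => ?_⟩
  have h2 : (C γ⁻¹ * ((∑ i ∈ Finset.Icc d d, C (algebraMap K (AlgebraicClosure K) (c i)) *
      X ^ (p ^ i)).comp (C γ * X))) = X ^ p ^ d := by
    have h3 : γ⁻¹ * (algebraMap K (AlgebraicClosure K) (c d) * γ ^ p ^ d) = 1 := by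
      rw [← Nat.sub_add_cancel h1.le, pow_succ, hγ]
      field_simp
      simp [hcd]
    simp only [Finset.Icc_self, Finset.sum_singleton, mul_comp, C_comp, pow_comp, X_comp, mul_pow]
    rw [← C_pow, ← mul_assoc, ← mul_assoc, ← C_mul, ← C_mul, mul_assoc, h3, C_1, one_mul]
  rw [h2, coeff_X_pow]
  split_ifs
  · exact ⟨X - 1, X_sub_C_ne_zero 1, by simp⟩
  · exact ⟨X, X_ne_zero, by simp⟩

section AlgOver

variable {k L : Type*} [Field k] [Field L] [Algebra k L]

/-- `a` is algebraic over the field generated by `T` over `k`. -/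
def AlgOver (k : Type*) {L : Type*} [Field k] [Field L] [Algebra k L] (T : Set L) (a : L) : Prop :=
  IsAlgebraic (Algebra.adjoin k T) a

theorem AlgOver.of_mem {T : Set L} {a : L} (h : a ∈ T) : AlgOver k T a :=
  isAlgebraic_algebraMap (⟨a, Algebra.subset_adjoin h⟩ : Algebra.adjoin k T)

theorem AlgOver.trans {S T : Set L} {a : L} (h : ∀ x ∈ S, AlgOver k T x) (ha : AlgOver k S a) :
    AlgOver k T a :=
  IsAlgebraic.adjoin_of_forall_isAlgebraic (fun x hx => h x hx.1) ha

theorem AlgOver.mono {S T : Set L} (h : S ⊆ T) {a : L} (ha : AlgOver k S a) : AlgOver k T a :=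
  ha.trans fun _ hx => .of_mem (h hx)

theorem algOver_iff_mem_closure {T : Set L} {a : L} :
    AlgOver k T a ↔ a ∈ (AlgebraicIndependent.matroid k L).closure T := by
  rw [AlgebraicIndependent.matroid_closure_eq]
  rfl

theorem AlgOver.exchange {T : Set L} {x y : L} (h : AlgOver k (insert x T) y)
    (hy : ¬ AlgOver k T y) : AlgOver k (insert y T) x := by
  rw [algOver_iff_mem_closure] at *
  exact Matroid.mem_closure_insert hy h

theorem algOver_empty {a : L} : AlgOver k (∅ : Set L) a ↔ IsAlgebraic k a := by
  constructor
  · intro h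
    have h1 : Algebra.IsAlgebraic k (Algebra.adjoin k (∅ : Set L)) := by
      rw [← Subalgebra.isAlgebraic_iff, Algebra.isAlgebraic_adjoin_iff]
      simp
    exact IsAlgebraic.restrictScalars k h
  · intro h
    exact h.extendScalars (algebraMap k (Algebra.adjoin k (∅ : Set L))).injective

open IntermediateField.algebraAdjoinAdjoin in
theorem algOver_iff_adjoin {T : Set L} {a : L} :
    AlgOver k T a ↔ IsAlgebraic (IntermediateField.adjoin k T) a :=
  IsFractionRing.isAlgebraic_iff (Algebra.adjoin k T) (IntermediateField.adjoin k T) L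

theorem AlgOver.of_mem_adjoin {T : Set L} {a : L} (h : a ∈ IntermediateField.adjoin k T) :
    AlgOver k T a :=
  algOver_iff_adjoin.2 (isAlgebraic_algebraMap (⟨a, h⟩ : IntermediateField.adjoin k T))

theorem AlgOver.isAlgebraic {T : Set L} {a : L} (h : AlgOver k T a) {N : Type*} [Field N]
    [Algebra N L] (hk : ∀ c : k, algebraMap k L c ∈ (algebraMap N L).range)
    (hT : ∀ x ∈ T, x ∈ (algebraMap N L).range) : IsAlgebraic N a := by
  obtain ⟨q, hq0, hq⟩ := h
  let S : Subalgebra k L := { (algebraMap N L).range with algebraMap_mem' := hk }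
  have hS : Algebra.adjoin k T ≤ S := Algebra.adjoin_le hT
  have hl : q.map (Algebra.adjoin k T).subtype ∈ lifts (algebraMap N L) := by
    rw [lifts_iff_coeff_lifts]
    intro n
    rw [coeff_map]
    exact hS (q.coeff n).2
  obtain ⟨r, hr⟩ := (mem_lifts _).1 hl
  refine ⟨r, ?_, ?_⟩
  · rintro rfl
    rw [Polynomial.map_zero, eq_comm, Polynomial.map_eq_zero_iff Subtype.val_injective] at hr
    exact hq0 hr
  · rw [aeval_def, ← eval_map, hr, eval_map]
    exact hq

end AlgOver

section Span

variable {p : ℕ} [Fact p.Prime] {k L : Type*} [Field k] [CharP k p] [Field L] [CharP L p]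
  [Algebra k L]

theorem PSep.mem_span_of_pow_mem_span (h : PSep p k L) {W : Set L} (n : ℕ) {x : L}
    (hx : x ^ p ^ n ∈ Submodule.span k ((fun w => w ^ p ^ n) '' W)) : x ∈ Submodule.span k W := by
  obtain ⟨b, -, hspan, hli⟩ := exists_linearIndependent k W
  rw [← hspan]
  by_contra hxb
  have h1 : LinearIndepOn k id (insert x b) := LinearIndepOn.id_insert hli hxb
  have h2 : LinearIndepOn k (fun w => w ^ p ^ n) (insert x b) := h.linearIndependent_pow_pow h1 n
  have hxb' : x ∉ b := fun h => hxb (Submodule.subset_span h)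
  have h3 := (linearIndepOn_insert hxb').1 h2
  apply h3.2
  refine (Submodule.span_le.2 ?_ : Submodule.span k ((fun w => w ^ p ^ n) '' W) ≤ _) hx
  rintro _ ⟨w, hw, rfl⟩
  have hw' : w ∈ Submodule.span k b := hspan ▸ Submodule.subset_span hw
  simp only [SetLike.mem_coe]
  clear hw
  induction hw' using Submodule.span_induction with
  | mem w hw => exact Submodule.subset_span ⟨w, hw, rfl⟩
  | zero => simp [(Fact.out : p.Prime).ne_zero]
  | add x y _ _ hx hy => rw [add_pow_char_pow]; exact add_mem hx hy
  | smul a x _ hx => rw [_root_.smul_pow]; exact Submodule.smul_mem _ _ hx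

/-- `F` is generated over `k` by elements that are `p ^ n`-th powers in `L`, for every `n`. -/
def DeepGen (p : ℕ) {k L : Type*} [Field k] [Field L] [Algebra k L] (F : IntermediateField k L) :
    Prop :=
  ∀ n : ℕ, ∃ T : Set L, (∀ x ∈ T, ∃ y, y ^ p ^ n = x) ∧ IntermediateField.adjoin k T = F

omit [Fact p.Prime] [CharP k p] [CharP L p] in
theorem DeepGen.sup {E F : IntermediateField k L} (hE : DeepGen p E) (hF : DeepGen p F) :
    DeepGen p (E ⊔ F) := by
  intro n
  obtain ⟨S, hS, rfl⟩ := hE n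
  obtain ⟨T, hT, rfl⟩ := hF n
  refine ⟨S ∪ T, ?_, IntermediateField.adjoin_union k⟩
  rintro x (hx | hx)
  exacts [hS x hx, hT x hx]

theorem DeepGen.pSep_perfectClosure {F : IntermediateField k L} (hF : DeepGen p F)
    (h : PSep p k L) : PSep p (perfectClosure F L) L := by
  have : ExpChar F p := ExpChar.prime Fact.out
  let P := perfectClosure F L
  have hP : ∀ x : L, x ∈ P ↔ ∃ n : ℕ, x ^ p ^ n ∈ F := fun x => by
    rw [mem_perfectClosure_iff_pow_mem p]
    simp
  have hspanF : ∀ n : ℕ, ∀ x ∈ F, x ∈ Submodule.span k ((fun y => y ^ p ^ n) '' (P : Set L)) := by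
    intro n
    obtain ⟨T, hT, rfl⟩ := hF n
    let S : Submonoid L := P.toSubmonoid.map (powMonoidHom (p ^ n))
    have hS : (S : Set L) = (fun y => y ^ p ^ n) '' (P : Set L) := rfl
    have hTS : T ⊆ S := by
      intro x hx
      obtain ⟨y, rfl⟩ := hT x hx
      exact ⟨y, (hP y).2 ⟨n, IntermediateField.subset_adjoin k T hx⟩, rfl⟩
    have h1 : ∀ x ∈ Algebra.adjoin k T, x ∈ Submodule.span k (S : Set L) := by
      intro x hx
      have hx' : x ∈ Algebra.adjoin k (S : Set L) := Algebra.adjoin_mono hTS hx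
      rw [← Subalgebra.mem_toSubmodule, Algebra.adjoin_eq_span, Submonoid.closure_eq] at hx'
      exact hx'
    intro x hx
    obtain ⟨a, ha, b, hb, rfl⟩ := IntermediateField.mem_adjoin_iff_div.1 hx
    rw [← hS]
    have hbP : b⁻¹ ∈ P := (hP _).2 ⟨0, by
      simpa using IntermediateField.algebra_adjoin_le_adjoin k T hb⟩
    have h2 : a / b = (a * b ^ (p ^ n - 1)) * (b⁻¹) ^ p ^ n := by
      by_cases hb0 : b = 0
      · simp [hb0, (Fact.out : p.Prime).ne_zero]
      have hpn : 0 < p ^ n := pow_pos (Fact.out : p.Prime).pos n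
      have h3 : b ^ (p ^ n - 1) * b = b ^ p ^ n := by
        rw [← pow_succ, Nat.sub_add_cancel hpn]
      rw [inv_pow, ← h3]
      field_simp
    rw [h2]
    have h3 := h1 _ (mul_mem ha (pow_mem hb (p ^ n - 1)))
    have h4 : b⁻¹ ^ p ^ n ∈ S := ⟨_, hbP, rfl⟩
    generalize a * b ^ (p ^ n - 1) = u at h3
    induction h3 using Submodule.span_induction with
    | mem u hu => exact Submodule.subset_span (mul_mem hu h4)
    | zero => simp
    | add x y _ _ hx hy => rw [add_mul]; exact add_mem hx hy
    | smul c x _ hx => rw [smul_mul_assoc]; exact Submodule.smul_mem _ _ hx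
  have hspanP : ∀ x ∈ P, x ∈ Submodule.span k ((fun y => y ^ p) '' (P : Set L)) := by
    intro x hx
    obtain ⟨n, hn⟩ := (hP x).1 hx
    apply h.mem_span_of_pow_mem_span n
    have := hspanF (n + 1) _ hn
    rw [Set.image_image]
    simpa only [← pow_mul, ← pow_succ'] using this
  obtain ⟨S, h1, h2⟩ := h
  have hmem : ∀ c : k, algebraMap k L c ∈ P := fun c => (hP _).2 ⟨0, by simp⟩
  let ι : k →+* P := (algebraMap k L).codRestrict P hmem
  refine PSep.of_family (fun s : S => ι s) ?_ h2
  intro x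
  obtain ⟨n, f, v, hfv⟩ := Submodule.mem_span_set'.1 (hspanP x x.2)
  choose a ha using fun i => h1 (f i)
  choose w hw hwv using fun i => (v i).2
  refine ⟨∑ i, (⟨w i, hw i⟩ : P) • (a i).mapRange ι (map_zero _), Subtype.ext ?_⟩
  rw [← hfv, map_sum, ← IntermediateField.algebraMap_apply, map_sum]
  refine Finset.sum_congr rfl fun i _ => ?_
  rw [frobComb_smul, frobComb_map ι, ha, Algebra.smul_def, mul_comm, ← hwv]
  rfl

end Span

open IntermediateField.algebraAdjoinAdjoin in
/-- If `w` is transcendental over `k`, then `1, w, …, w ^ (N - 1)` are linearly independent over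
`k(ψ(w))`, where `N` is the degree of `ψ`. -/
theorem linearIndependent_pow_of_transcendental {k L : Type*} [Field k] [Field L] [Algebra k L]
    {w : L} (hw : Transcendental k w) (ψ : k[X]) :
    LinearIndependent (IntermediateField.adjoin k {aeval w ψ})
      fun i : Fin ψ.natDegree => w ^ (i : ℕ) := by
  classical
  rw [← LinearIndependent.iff_fractionRing (Algebra.adjoin k {aeval w ψ}),
    Fintype.linearIndependent_iff]
  intro a ha
  have h1 : ∀ i, ∃ A : k[X], aeval (aeval w ψ) A = (a i : L) := fun i => by
    exact (SetLike.ext_iff.1 (Algebra.adjoin_singleton_eq_range_aeval k (aeval w ψ)) _).1 (a i).2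
  choose A hA using h1
  have h2 : ∑ i, (A i).comp ψ * X ^ (i : ℕ) = 0 := by
    apply (transcendental_iff_injective.1 hw)
    rw [map_sum, map_zero, ← ha]
    refine Finset.sum_congr rfl fun i _ => ?_
    rw [map_mul, aeval_comp, hA, map_pow, aeval_X]
    rfl
  have h3 : ∀ i, (A i).comp ψ = 0 := by
    by_contra! h
    obtain ⟨i₀, hi₀⟩ := h
    have h4 := degree_sum_eq_of_disjoint (fun i : Fin ψ.natDegree => (A i).comp ψ * X ^ (i : ℕ))
      Finset.univ (by
        intro i hi j hj hij hd
        have e : ∀ l : Fin ψ.natDegree, (A l).comp ψ * X ^ (l : ℕ) ≠ 0 →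
            ((A l).comp ψ * X ^ (l : ℕ)).natDegree = (A l).natDegree * ψ.natDegree + l := by
          intro l hl
          rw [natDegree_mul (left_ne_zero_of_mul hl) (right_ne_zero_of_mul hl), natDegree_comp,
            natDegree_X_pow]
        have h5 := natDegree_eq_of_degree_eq hd
        rw [e i hi.2, e j hj.2] at h5
        have h6 := congrArg (· % ψ.natDegree) h5
        simp only [Nat.mul_add_mod_self_right, Nat.mod_eq_of_lt i.2, Nat.mod_eq_of_lt j.2] at h6
        exact hij (Fin.ext h6))
    rw [h2, degree_zero, eq_comm, Finset.sup_eq_bot_iff] at h4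
    have := h4 i₀ (Finset.mem_univ _)
    rw [degree_eq_bot] at this
    exact hi₀ ((mul_eq_zero.1 this).resolve_right (pow_ne_zero _ X_ne_zero))
  intro i
  apply Subtype.ext
  rw [← hA, ← aeval_comp, h3, map_zero]
  rfl

theorem natDegree_le_finrank_of_transcendental {k L : Type*} [Field k] [Field L] [Algebra k L]
    {w : L} (hw : Transcendental k w) (ψ : k[X])
    (F : IntermediateField (IntermediateField.adjoin k {aeval w ψ}) L)
    [FiniteDimensional (IntermediateField.adjoin k {aeval w ψ}) F] (hwF : w ∈ F) :
    ψ.natDegree ≤ Module.finrank (IntermediateField.adjoin k {aeval w ψ}) F := by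
  have h : LinearIndependent (IntermediateField.adjoin k {aeval w ψ})
      fun i : Fin ψ.natDegree => (⟨w, hwF⟩ : F) ^ (i : ℕ) :=
    LinearIndependent.of_comp F.val.toLinearMap
      (linearIndependent_pow_of_transcendental hw ψ)
  simpa using h.fintype_card_le_finrank

/-- A separable element fixed by all embeddings of the relative algebraic closure is in the
base field. -/
theorem mem_range_of_forall_algHom {F L Ω : Type*} [Field F] [Field L] [Field Ω] [Algebra F L]
    [Algebra L Ω] [Algebra F Ω] [IsAlgClosed Ω] {w : algebraicClosure F L}
    (hw : IsSeparable F w)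
    (h : ∀ σ : algebraicClosure F L →ₐ[F] Ω, σ w = algebraMap L Ω w) :
    w ∈ (algebraMap F (algebraicClosure F L)).range := by
  have h_int : IsIntegral F w := hw.isIntegral
  have hroots : ∀ y ∈ (minpoly F w).aroots Ω, y = algebraMap L Ω w := by
    intro y hy
    obtain ⟨σ, hσ⟩ := IntermediateField.exists_algHom_of_splits_of_aeval (K := Ω)
      (fun s : algebraicClosure F L => ⟨(Algebra.IsAlgebraic.isAlgebraic s).isIntegral,
        IsAlgClosed.splits _⟩) (x := w) (y := y) ((mem_aroots.1 hy).2)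
    rw [← hσ, h]
  have hnodup : ((minpoly F w).aroots Ω).Nodup := nodup_aroots_iff_of_splits
    (minpoly.ne_zero h_int) (IsAlgClosed.splits _) |>.2 hw
  have hcard : ((minpoly F w).aroots Ω).card = (minpoly F w).natDegree := by
    rw [aroots_def, ← natDegree_map (algebraMap F Ω)]
    exact (IsAlgClosed.splits _).natDegree_eq_card_roots.symm
  have hle : ((minpoly F w).aroots Ω).card ≤ 1 := by
    have := Multiset.le_iff_subset hnodup |>.2
      (show (minpoly F w).aroots Ω ⊆ {algebraMap L Ω w} from fun y hy => by
        rw [Multiset.mem_singleton]; exact hroots y hy)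
    simpa using Multiset.card_le_card this
  have h1 := minpoly.natDegree_pos h_int
  exact minpoly.natDegree_eq_one_iff.1 (by omega)

theorem natDegree_le_finrank_of_aeval_eq {k L : Type*} [Field k] [Field L] [Algebra k L]
    {w θ : L} (hw : Transcendental k w) (ψ : k[X]) (hθ : aeval w ψ = θ)
    (F : IntermediateField (IntermediateField.adjoin k {θ}) L)
    [FiniteDimensional (IntermediateField.adjoin k {θ}) F] (hwF : w ∈ F) :
    ψ.natDegree ≤ Module.finrank (IntermediateField.adjoin k {θ}) F := by
  subst hθ
  exact natDegree_le_finrank_of_transcendental hw ψ F hwF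

theorem isSeparable_of_aeval_eq_zero {F L : Type*} [Field F] [Field L] [Algebra F L] {f : F[X]}
    (hf : f.Separable) {x : L} (hx : aeval x f = 0) : IsSeparable F x :=
  hf.of_dvd (minpoly.dvd F x hx)

theorem separable_sub_C_of_derivative {F : Type*} [Field F] {f : F[X]} {e : F} (he : e ≠ 0)
    (hf : derivative f = C e) (a : F) : (f - C a).Separable := by
  rw [separable_def, derivative_sub, derivative_C, sub_zero, hf]
  exact ⟨0, C e⁻¹, by simp [← C_mul, he]⟩

section

variable {p : ℕ} [Fact p.Prime]

theorem algHom_fixes_of_torsion {K F L Ω : Type*} [Field K] [Field F] [Field L]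
    [CharP L p] [Field Ω] [CharP Ω p] [Algebra K L] [Algebra F L] [Algebra L Ω] [Algebra F Ω]
    [IsScalarTower F L Ω] [Algebra K Ω] [IsScalarTower K L Ω] {d D : ℕ} {c : ℕ → K} {n₀ : ℕ}
    (htor : ∀ z : Ω, IsSeparable L z → ∀ n : ℕ,
      (specialTphi p d D fun i => algebraMap K Ω (c i))^[n] z = 0 →
      (specialTphi p d D fun i => algebraMap K Ω (c i))^[n₀] z = 0)
    {P : Type*} [Field P] [Algebra P L]
    (hP : ∀ x : P, ∃ n : ℕ, algebraMap P L x ^ p ^ n ∈ (algebraMap F L).range)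
    (hc : ∀ i, algebraMap K L (c i) ∈ (algebraMap F L).range) {z y : algebraicClosure F L}
    (hz : IsSeparable P (z : L)) {n : ℕ}
    (hzn : (specialTphi p d D fun i => algebraMap K L (c i))^[n] (z : L) ∈ (algebraMap F L).range)
    (hy : (y : L) = (specialTphi p d D fun i => algebraMap K L (c i))^[n₀] (z : L))
    (σ : algebraicClosure F L →ₐ[F] Ω) : σ y = algebraMap L Ω y := by
  let A := algebraicClosure F L
  have hσF : ∀ x : A, (x : L) ∈ (algebraMap F L).range → σ x = algebraMap L Ω x := by
    rintro x ⟨a, ha⟩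
    have : x = algebraMap F A a := Subtype.ext ha.symm
    rw [this, AlgHom.commutes, IsScalarTower.algebraMap_apply F L Ω]
    rfl
  have hPA : ∀ x : P, algebraMap P L x ∈ A := by
    intro x
    obtain ⟨n, a, ha⟩ := hP x
    rw [mem_algebraicClosure_iff]
    exact IsAlgebraic.of_pow (pow_pos (Fact.out : p.Prime).pos n) (ha ▸ isAlgebraic_algebraMap a)
  let j : P →+* A := (algebraMap P L).codRestrict A.toSubalgebra hPA
  have hj : ∀ x : P, ((j x : A) : L) = algebraMap P L x := fun _ => rfl
  have hσj : ∀ x : P, σ (j x) = algebraMap L Ω (algebraMap P L x) := by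
    intro x
    obtain ⟨n, hn⟩ := hP x
    have h1 := hσF (j x ^ p ^ n) hn
    rw [map_pow] at h1
    have : Function.Injective (iterateFrobenius Ω p n) := (iterateFrobenius Ω p n).injective
    apply this
    rw [iterateFrobenius_def, iterateFrobenius_def, h1, ← map_pow (algebraMap L Ω)]
    rfl
  have hroot : eval₂ j z (minpoly P (z : L)) = 0 := by
    apply Subtype.ext
    have h1 := minpoly.aeval P (z : L)
    rw [aeval_def] at h1
    have h2 := hom_eval₂ (minpoly P (z : L)) j (A.val : A →+* L) z
    exact h2.trans h1
  have hsep : IsSeparable L (σ z) := by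
    apply isSeparable_of_aeval_eq_zero (f := (minpoly P (z : L)).map (algebraMap P L))
      (Separable.map hz)
    have h2 := hom_eval₂ (minpoly P (z : L)) j (σ : A →+* Ω) z
    rw [hroot, map_zero] at h2
    rw [aeval_def, eval₂_map]
    have h3 : (σ : A →+* Ω).comp j = (algebraMap L Ω).comp (algebraMap P L) :=
      RingHom.ext hσj
    rw [← h3]
    exact h2.symm
  have hcA : ∀ i, algebraMap K L (c i) ∈ A := by
    intro i
    obtain ⟨a, ha⟩ := hc i
    rw [← ha]
    exact A.algebraMap_mem a
  let cA : ℕ → A := fun i => ⟨_, hcA i⟩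
  have hσc : (fun i => (σ : A →+* Ω) (cA i)) = fun i => algebraMap K Ω (c i) := by
    funext i
    rw [IsScalarTower.algebraMap_apply K L Ω]
    exact hσF _ (hc i)
  have hLc : (fun i => algebraMap L Ω (algebraMap K L (c i))) = fun i => algebraMap K Ω (c i) := by
    funext i
    rw [IsScalarTower.algebraMap_apply K L Ω]
  have hval : ∀ n, (((specialTphi p d D cA)^[n] z : A) : L) =
      (specialTphi p d D fun i => algebraMap K L (c i))^[n] (z : L) := fun n =>
    (specialTphi_iterate_map d D cA (A.val : A →+* L) n z).symm
  have hσit : ∀ n, (specialTphi p d D fun i => (σ : A →+* Ω) (cA i))^[n] (σ z) =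
      σ ((specialTphi p d D cA)^[n] z) := fun n =>
    specialTphi_iterate_map d D cA (σ : A →+* Ω) n z
  have hLit := fun n => specialTphi_iterate_map (p := p) d D (fun i => algebraMap K L (c i))
    (algebraMap L Ω) n (z : L)
  simp only [hσc] at hσit
  simp only [hLc] at hLit
  have hδ := htor (σ z - algebraMap L Ω z)
    (Field.isSeparable_sub hsep (isSeparable_algebraMap (z : L))) n (by
      rw [specialTphi_iterate_sub, hσit, hLit, ← hval]
      refine sub_eq_zero.2 (hσF _ ?_)
      rw [hval]
      exact hzn)
  rw [specialTphi_iterate_sub, hσit, hLit, ← hval] at hδ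
  have h4 : y = (specialTphi p d D cA)^[n₀] z := Subtype.ext (by rw [hval, hy])
  rw [h4]
  exact sub_eq_zero.1 hδ

end

theorem AlgOver.of_aeval {k L : Type*} [Field k] [Field L] [Algebra k L] {T : Set L} {x : L}
    {f : k[X]} (hf : f.natDegree ≠ 0) (h : AlgOver k T (aeval x f)) : AlgOver k T x := by
  let A := Algebra.adjoin k T
  have hinj : Function.Injective (algebraMap k A) := (algebraMap k A).injective
  refine IsAlgebraic.of_aeval (f.map (algebraMap k A)) ?_ ?_ ?_
  · rwa [natDegree_map_eq_of_injective hinj]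
  · rw [mem_nonZeroDivisors_iff_ne_zero, Ne, leadingCoeff_eq_zero,
      Polynomial.map_eq_zero_iff hinj]
    rintro rfl
    simp at hf
  · rwa [aeval_map_algebraMap]

theorem aeval_mem_adjoin {k L : Type*} [Field k] [Field L] [Algebra k L] {T : Set L} {x : L}
    (f : k[X]) (hx : x ∈ IntermediateField.adjoin k T) :
    aeval x f ∈ IntermediateField.adjoin k T :=
  (aeval (⟨x, hx⟩ : IntermediateField.adjoin k T) f).2 |> fun h => by
    have := aeval_algebraMap_apply L (⟨x, hx⟩ : IntermediateField.adjoin k T) f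
    rw [IntermediateField.algebraMap_apply] at this
    rw [this]
    exact h

section

variable {p : ℕ} [Fact p.Prime] {K : Type*} [Field K] [CharP K p] {k : Type*}
  [Field k] [CharP k p] {L : Type*} [Field L] [CharP L p] [Algebra K k] [Algebra K L]
  [Algebra k L] [IsScalarTower K k L] {d D : ℕ} {c : ℕ → K} {g : ℕ} {ζ : ℕ → Fin g → L}

omit [CharP K p] [CharP L p] [Fact p.Prime] in
theorem tower_iterate (hζ : ∀ m i, specialTphi p d D (fun i => algebraMap K L (c i)) (ζ (m + 1) i) =
    ζ m i) (m n : ℕ) (i : Fin g) :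
    (specialTphi p d D fun i => algebraMap K L (c i))^[n] (ζ (m + n) i) = ζ m i := by
  induction n with
  | zero => rfl
  | succ n ih => rw [Function.iterate_succ_apply, ← add_assoc, hζ, ih]

include k in
omit [CharP k p] [CharP L p] in
theorem tower_algOver (hdD : d ≤ D) (hcd : c d ≠ 0) (hcD : c D ≠ 0)
    (hζ : ∀ m i, specialTphi p d D (fun i => algebraMap K L (c i)) (ζ (m + 1) i) = ζ m i)
    {T : Set L} {m : ℕ} {i : Fin g} (n : ℕ) (h : AlgOver k T (ζ m i)) : AlgOver k T (ζ n i) := by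
  have key : ∀ m, ∃ f : k[X], f.natDegree ≠ 0 ∧ ∀ n, aeval (ζ (n + m) i) f = ζ n i := by
    intro m
    obtain ⟨ψ, -, -, hdeg, hψ⟩ := exists_separable_part (p := p) hdD hcd hcD m
    have hp := (Fact.out : p.Prime).pos
    refine ⟨(ψ.comp (X ^ p ^ (d * m))).map (algebraMap K k), ?_, fun n => ?_⟩
    · rw [natDegree_map, natDegree_comp, hdeg, natDegree_X_pow]
      positivity
    · rw [aeval_map_algebraMap, aeval_comp, map_pow, aeval_X, ← hψ, tower_iterate hζ]
  have h0 : AlgOver k T (ζ 0 i) := by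
    obtain ⟨f, -, hf⟩ := key m
    rw [← hf 0, zero_add]
    refine AlgOver.trans (S := {ζ m i}) (by simpa using h) (.of_mem_adjoin (aeval_mem_adjoin f ?_))
    exact IntermediateField.mem_adjoin_simple_self k _
  obtain ⟨f, hf0, hf⟩ := key n
  apply AlgOver.of_aeval hf0
  have := hf 0
  rw [zero_add] at this
  rwa [this]

omit [CharP k p] [CharP L p] in
theorem tower_deepGen (hd : 1 ≤ d) (hdD : d ≤ D) (hcd : c d ≠ 0) (hcD : c D ≠ 0)
    (hζ : ∀ m i, specialTphi p d D (fun i => algebraMap K L (c i)) (ζ (m + 1) i) = ζ m i)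
    (B : Set (Fin g)) :
    DeepGen p (IntermediateField.adjoin k {x | ∃ m, ∃ b ∈ B, x = ζ m b}) := by
  intro n
  refine ⟨{x | ∃ m, ∃ b ∈ B, x = ζ m b ^ p ^ n}, ?_, le_antisymm ?_ ?_⟩
  · rintro _ ⟨m, b, -, rfl⟩
    exact ⟨_, rfl⟩
  · rw [IntermediateField.adjoin_le_iff]
    rintro _ ⟨m, b, hb, rfl⟩
    refine pow_mem (IntermediateField.subset_adjoin _ _ ?_) _
    exact ⟨m, b, hb, rfl⟩
  · rw [IntermediateField.adjoin_le_iff]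
    rintro _ ⟨m, b, hb, rfl⟩
    obtain ⟨ψ, -, -, -, hψ⟩ := exists_separable_part (p := p) hdD hcd hcD n
    have h1 := tower_iterate hζ m n b
    rw [hψ, ← aeval_map_algebraMap k] at h1
    rw [← h1]
    apply aeval_mem_adjoin
    obtain ⟨j, hj⟩ : ∃ j, d * n = n + j := ⟨d * n - n, by
      have : n ≤ d * n := Nat.le_mul_of_pos_left n hd
      omega⟩
    rw [hj, pow_add, pow_mul]
    refine pow_mem (IntermediateField.subset_adjoin _ _ ?_) _
    exact ⟨_, b, hb, rfl⟩

theorem deepGen_eq_bot {Ω : Type*} [Field Ω] [CharP Ω p] [IsAlgClosed Ω] [Algebra L Ω]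
    [Algebra K Ω] [IsScalarTower K L Ω] (hd : 1 ≤ d) (hdD : d < D) (hcd : c d ≠ 0) (hcD : c D ≠ 0)
    {n₀ : ℕ} (htor : ∀ z : Ω, IsSeparable L z → ∀ n : ℕ,
      (specialTphi p d D fun i => algebraMap K Ω (c i))^[n] z = 0 →
      (specialTphi p d D fun i => algebraMap K Ω (c i))^[n₀] z = 0)
    (hζ : ∀ m i, specialTphi p d D (fun i => algebraMap K L (c i)) (ζ (m + 1) i) = ζ m i)
    (hsep : PSep p k L) (hclosed : ∀ x : L, IsAlgebraic k x → x ∈ (⊥ : IntermediateField k L))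
    {E : IntermediateField k L} (hE : E ≤ IntermediateField.adjoin k (Set.range (ζ 0)))
    (hdeep : DeepGen p E) : E = ⊥ := by
  rw [eq_bot_iff]
  intro h hhE
  by_contra hh
  -- a maximal set of coordinates over which `h` is transcendental
  obtain ⟨B, hB⟩ := (Set.toFinite {B : Set (Fin g) | ¬ AlgOver k (ζ 0 '' B) h}).exists_maximal
    ⟨∅, by
      rw [Set.mem_ofPred_eq, Set.image_empty, algOver_empty]
      exact fun h' => hh (hclosed h h')⟩
  have hBh : ¬ AlgOver k (ζ 0 '' B) h := hB.prop
  obtain ⟨i₀, hi₀⟩ : ∃ i₀, i₀ ∉ B := by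
    by_contra! hall
    apply hBh
    rw [Set.eq_univ_of_forall hall, Set.image_univ]
    exact .of_mem_adjoin (hE hhE)
  have hins : ∀ i ∉ B, AlgOver k (insert (ζ 0 i) (ζ 0 '' B)) h := by
    intro i hi
    rw [← Set.image_insert_eq]
    by_contra h1
    exact hi (hB.le_of_ge (y := insert i B) h1 (Set.subset_insert _ _) (Set.mem_insert _ _))
  set θ := ζ 0 i₀ with hθ
  have hall : ∀ i, AlgOver k (insert h (ζ 0 '' B)) (ζ 0 i) := by
    intro i
    by_cases hi : i ∈ B
    · exact .of_mem (Or.inr ⟨i, hi, rfl⟩)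
    · exact (hins i hi).exchange hBh
  have hallθ : ∀ i, AlgOver k (insert θ (ζ 0 '' B)) (ζ 0 i) := fun i =>
    (hall i).trans (by
      rintro x (rfl | hx)
      · exact hins i₀ hi₀
      · exact .of_mem (Or.inr hx))
  set Z : Set L := {x | ∃ m, ∃ b ∈ B, x = ζ m b} with hZ
  have hZB : ∀ x ∈ Z, AlgOver k (ζ 0 '' B) x := by
    rintro _ ⟨m, b, hb, rfl⟩
    exact tower_algOver hdD.le hcd hcD hζ m (m := 0) (.of_mem ⟨b, hb, rfl⟩)
  have hBZ : ζ 0 '' B ⊆ Z := by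
    rintro _ ⟨b, hb, rfl⟩
    exact ⟨0, b, hb, rfl⟩
  have hθZ : ¬ AlgOver k Z θ := by
    intro h1
    refine hBh (.trans ?_ (hins i₀ hi₀))
    rintro x (rfl | hx)
    · exact h1.trans hZB
    · exact .of_mem hx
  let M := IntermediateField.adjoin k Z
  have hM : DeepGen p M := tower_deepGen hd hdD.le hcd hcD hζ B
  let F₀ := M ⊔ E
  have hP := (hM.sup hdeep).pSep_perfectClosure hsep
  let Mθ := IntermediateField.adjoin M {θ}
  let F := IntermediateField.adjoin Mθ (Set.range (ζ 0))
  have hkMθ : ∀ x : L, x ∈ M → x ∈ Mθ := fun x hx => Mθ.algebraMap_mem (⟨x, hx⟩ : M)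
  have hMF : ∀ x : L, x ∈ M → x ∈ F := fun x hx => F.algebraMap_mem (⟨x, hkMθ x hx⟩ : Mθ)
  have hθF : θ ∈ F := IntermediateField.subset_adjoin _ _ ⟨i₀, rfl⟩
  have hfin : FiniteDimensional Mθ F := by
    apply IntermediateField.finiteDimensional_adjoin
    rintro _ ⟨i, rfl⟩
    rw [← isAlgebraic_iff_isIntegral]
    refine (hallθ i).isAlgebraic (fun a => ⟨⟨_, hkMθ _ (M.algebraMap_mem a)⟩, rfl⟩) ?_
    rintro x (rfl | hx)
    · exact ⟨⟨_, IntermediateField.mem_adjoin_simple_self M θ⟩, rfl⟩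
    · exact ⟨⟨_, hkMθ x (IntermediateField.subset_adjoin _ _ (hBZ hx))⟩, rfl⟩
  set e := Module.finrank Mθ F with he
  obtain ⟨ψ, -, ⟨e', he'0, he'⟩, hdeg, hψ⟩ := exists_separable_part (p := p) hdD.le hcd hcD e
  have hζe : (specialTphi p d D fun i => algebraMap K L (c i))^[e] (ζ e i₀) = θ := by
    simpa using tower_iterate hζ 0 e i₀
  set w := ζ e i₀ ^ p ^ (d * e) with hw
  have hwθ : aeval w ψ = θ := by rw [← hζe, hψ]
  have hkF : ∀ x : k, algebraMap k L x ∈ (algebraMap F L).range := fun x =>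
    ⟨⟨_, hMF _ (M.algebraMap_mem x)⟩, rfl⟩
  have hKF : ∀ x : K, algebraMap K L x ∈ (algebraMap F L).range := fun x => by
    rw [IsScalarTower.algebraMap_apply K k L]
    exact hkF _
  have hwF : w ∈ F := by
    have halg : ∀ m, ζ m i₀ ∈ algebraicClosure F L := fun m =>
      mem_algebraicClosure_iff.2 <| (tower_algOver (k := k) hdD.le hcd hcD hζ m (m := 0)
        (.of_mem (Set.mem_singleton _))).isAlgebraic hkF (by
          rintro x rfl
          exact ⟨⟨_, hθF⟩, rfl⟩)
    have hF₀P : ∀ x ∈ M ⊔ E, x ∈ perfectClosure (M ⊔ E : IntermediateField k L) L := fun x hx =>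
      (perfectClosure (M ⊔ E : IntermediateField k L) L).algebraMap_mem
        (⟨x, hx⟩ : (M ⊔ E : IntermediateField k L))
    have hzP := hP.isSeparable ((tower_algOver (k := k) hdD.le hcd hcD hζ (e + n₀) (m := 0)
      ((hall i₀).mono (Set.insert_subset_insert hBZ))).isAlgebraic
        (fun a => ⟨⟨_, hF₀P _ ((M ⊔ E).algebraMap_mem a)⟩, rfl⟩) (by
          rintro x (rfl | hx)
          · exact ⟨⟨_, hF₀P _ ((le_sup_right : E ≤ M ⊔ E) hhE)⟩, rfl⟩
          · exact ⟨⟨_, hF₀P _ ((le_sup_left : M ≤ M ⊔ E)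
              (IntermediateField.subset_adjoin _ _ hx))⟩, rfl⟩))
    have hF₀F : ∀ x ∈ M ⊔ E, x ∈ (algebraMap F L).range := by
      have hEF : M ⊔ E ≤ IntermediateField.adjoin k (F : Set L) := by
        refine sup_le (fun x hx => IntermediateField.subset_adjoin _ _ (hMF x hx)) (hE.trans ?_)
        apply IntermediateField.adjoin.mono
        rintro _ ⟨i, rfl⟩
        exact IntermediateField.subset_adjoin _ _ ⟨i, rfl⟩
      intro x hx
      have h1 := hEF hx
      have h2 : IntermediateField.adjoin k (F : Set L) ≤
          { F with
            algebraMap_mem' := fun a => hMF _ (M.algebraMap_mem a) } := by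
        rw [IntermediateField.adjoin_le_iff]
        exact fun x hx => hx
      exact ⟨⟨x, h2 h1⟩, rfl⟩
    have hmem := mem_range_of_forall_algHom (F := F) (L := L) (Ω := Ω)
      (w := ⟨w, pow_mem (halg e) _⟩) ?_ ?_
    · obtain ⟨a, ha⟩ := hmem
      have h1 : (a : L) = w := congrArg Subtype.val ha
      exact h1 ▸ a.2
    · let κ : K →+* F := (algebraMap Mθ F).comp
        ((algebraMap M Mθ).comp ((algebraMap k M).comp (algebraMap K k)))
      have hκ : (algebraMap F L).comp κ = algebraMap K L := RingHom.ext fun a =>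
        (IsScalarTower.algebraMap_apply K k L a).symm
      refine isSeparable_of_aeval_eq_zero (separable_sub_C_of_derivative (f := ψ.map κ)
        (e := κ e') (by simpa using he'0) (by rw [derivative_map, he', map_C])
        (⟨θ, hθF⟩ : F)) (Subtype.ext ?_)
      refine ((aeval_algHom_apply (algebraicClosure F L).val _ _).symm).trans ?_
      rw [map_sub, aeval_C, aeval_def, eval₂_map, hκ, ← aeval_def, ZeroMemClass.coe_zero,
        sub_eq_zero]
      exact hwθ
    · intro σ
      have hy := tower_iterate hζ e n₀ i₀
      have := algHom_fixes_of_torsion (z := ⟨_, halg (e + n₀)⟩) (y := ⟨_, halg e⟩) (n := e + n₀)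
        htor (P := perfectClosure (M ⊔ E : IntermediateField k L) L) (fun x => ?_)
        (fun i => hKF _) hzP ?_ hy.symm σ
      · have h2 := congrArg (· ^ p ^ (d * e)) this
        simp only [← map_pow] at h2
        exact h2
      · have : ExpChar (M ⊔ E : IntermediateField k L) p := ExpChar.prime Fact.out
        obtain ⟨n, a, ha⟩ := (mem_perfectClosure_iff_pow_mem p).1 x.2
        refine ⟨n, hF₀F _ ?_⟩
        have h2 := a.2
        rwa [← IntermediateField.algebraMap_apply, ha] at h2
      · have h2 := tower_iterate hζ 0 (e + n₀) i₀
        rw [zero_add] at h2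
        rw [h2]
        exact ⟨⟨_, hθF⟩, rfl⟩
  have htr : Transcendental M w := by
    intro h1
    refine hθZ (AlgOver.trans (S := {w}) ?_ (.of_mem_adjoin ?_))
    · rintro x rfl
      exact algOver_iff_adjoin.2 h1
    · rw [← hwθ, ← aeval_map_algebraMap k]
      exact aeval_mem_adjoin _ (IntermediateField.mem_adjoin_simple_self k w)
  have hle := natDegree_le_finrank_of_aeval_eq htr ((ψ.map (algebraMap K k)).map (algebraMap k M))
    (by rw [aeval_map_algebraMap, aeval_map_algebraMap, hwθ]) F hwF
  rw [natDegree_map, natDegree_map, hdeg, ← he] at hle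
  have h2 : e < p ^ e := Nat.lt_pow_self (Fact.out : p.Prime).one_lt
  have h3 : p ^ e ≤ p ^ ((D - d) * e) := Nat.pow_le_pow_right (Fact.out : p.Prime).pos
    (Nat.le_mul_of_pos_left e (by omega))
  omega

end

end SpecialDrinfeld

namespace SpecialDrinfeld

open MvPolynomial

section CoeffMap

variable {σ A B : Type*} [CommSemiring A] [CommSemiring B]

/-- Apply an additive map to all coefficients of a polynomial. -/
noncomputable def coeffMap (f : A →+ B) : MvPolynomial σ A →+ MvPolynomial σ B where
  toFun P := ∑ a ∈ P.support, monomial a (f (coeff a P))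
  map_zero' := by simp
  map_add' P Q := by
    classical
    have key : ∀ R : MvPolynomial σ A, ∀ b,
        coeff b (∑ a ∈ R.support, monomial a (f (coeff a R))) = f (coeff b R) := by
      intro R b
      rw [coeff_sum]
      simp only [coeff_monomial]
      rw [Finset.sum_ite_eq']
      split_ifs with h
      · rfl
      · rw [notMem_support_iff.1 h, map_zero]
    ext b
    rw [coeff_add, key, key, key, coeff_add, map_add]

@[simp] theorem coeff_coeffMap (f : A →+ B) (P : MvPolynomial σ A) (b : σ →₀ ℕ) :
    coeff b (coeffMap f P) = f (coeff b P) := by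
  classical
  change coeff b (∑ a ∈ P.support, monomial a (f (coeff a P))) = _
  rw [coeff_sum]
  simp only [coeff_monomial]
  rw [Finset.sum_ite_eq']
  split_ifs with h
  · rfl
  · rw [notMem_support_iff.1 h, map_zero]

@[simp] theorem coeffMap_monomial (f : A →+ B) (a : σ →₀ ℕ) (c : A) :
    coeffMap f (monomial a c) = monomial a (f c) := by
  classical
  ext b
  rw [coeff_coeffMap, coeff_monomial, coeff_monomial]
  split_ifs <;> simp

theorem coeffMap_mul_map {F : Type*} [CommSemiring F] [Algebra F A] [Algebra F B] (f : A →ₗ[F] B)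
    (P : MvPolynomial σ A) (Q : MvPolynomial σ F) :
    coeffMap f.toAddMonoidHom (P * map (algebraMap F A) Q) =
      coeffMap f.toAddMonoidHom P * map (algebraMap F B) Q := by
  classical
  ext b
  rw [coeff_coeffMap, coeff_mul, coeff_mul, map_sum]
  refine Finset.sum_congr rfl fun x _ => ?_
  rw [coeff_coeffMap, coeff_map, coeff_map, mul_comm, ← Algebra.smul_def]
  rw [mul_comm, ← Algebra.smul_def]
  exact f.map_smul _ _

end CoeffMap

section Stable

variable {σ L : Type*} [Field L]

/-- An ideal of `L[X]` is stable under `F` if it is stable under coefficientwise application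
of every `F`-linear endomorphism of `L`; in other words, it is defined over `F`. -/
def Stable (F : Type*) {σ L : Type*} [Field F] [Field L] [Algebra F L]
    (J : Ideal (MvPolynomial σ L)) : Prop :=
  ∀ f : L →ₗ[F] L, ∀ P ∈ J, coeffMap f.toAddMonoidHom P ∈ J

variable {F : Type*} [Field F] [Algebra F L]

theorem Stable.sup {I J : Ideal (MvPolynomial σ L)} (hI : Stable F I) (hJ : Stable F J) :
    Stable F (I ⊔ J) := by
  intro f P hP
  obtain ⟨x, hx, y, hy, rfl⟩ := Submodule.mem_sup.1 hP
  rw [map_add]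
  exact Submodule.add_mem_sup (hI f x hx) (hJ f y hy)

theorem Stable.span {S : Set (MvPolynomial σ L)}
    (hS : ∀ s ∈ S, s ∈ (MvPolynomial.map (σ := σ) (algebraMap F L)).range) :
    Stable F (Ideal.span S) := by
  intro f P hP
  induction hP using Submodule.span_induction with
  | mem s hs =>
    obtain ⟨Q, rfl⟩ := hS s hs
    rw [← one_mul (MvPolynomial.map _ Q), coeffMap_mul_map]
    exact Ideal.mul_mem_left _ _ (Ideal.subset_span hs)
  | zero => simp
  | add x y _ _ hx hy => rw [map_add]; exact add_mem hx hy
  | smul a x hx hfx =>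
    clear hfx
    induction hx using Submodule.span_induction generalizing a with
    | mem s hs =>
      obtain ⟨Q, rfl⟩ := hS s hs
      rw [smul_eq_mul, coeffMap_mul_map]
      exact Ideal.mul_mem_left _ _ (Ideal.subset_span hs)
    | zero => simp
    | add x y _ _ hx hy => rw [smul_add, map_add]; exact add_mem (hx a) (hy a)
    | smul b x _ hx => rw [← mul_smul]; exact hx _

theorem Stable.idealMap (I : Ideal (MvPolynomial σ F)) :
    Stable F (I.map (MvPolynomial.map (algebraMap F L))) :=
  Stable.span fun _ ⟨Q, _, hQ⟩ => ⟨Q, hQ⟩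

theorem idealOfVars_map (F : Type*) {σ L : Type*} [Field F] [Field L] [Algebra F L] :
    (idealOfVars σ F).map (MvPolynomial.map (algebraMap F L)) = idealOfVars σ L := by
  rw [idealOfVars, Ideal.map_span, ← Set.range_comp, idealOfVars]
  congr 2
  funext i
  simp

theorem Stable.idealOfVars_pow (n : ℕ) : Stable F (idealOfVars σ L ^ n) := by
  rw [← idealOfVars_map F, ← Ideal.map_pow]
  exact Stable.idealMap _

theorem coeffMap_bind₁ {τ : Type*} (f : L →ₗ[F] L) (Q : σ → MvPolynomial τ F)
    (P : MvPolynomial σ L) :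
    coeffMap f.toAddMonoidHom (bind₁ (fun i => MvPolynomial.map (algebraMap F L) (Q i)) P) =
      bind₁ (fun i => MvPolynomial.map (algebraMap F L) (Q i)) (coeffMap f.toAddMonoidHom P) := by
  induction P using MvPolynomial.induction_on' with
  | monomial a c =>
    have : ∏ i ∈ a.support, MvPolynomial.map (algebraMap F L) (Q i) ^ a i =
        MvPolynomial.map (algebraMap F L) (∏ i ∈ a.support, Q i ^ a i) := by
      simp
    rw [bind₁_monomial, coeffMap_monomial, bind₁_monomial, this, coeffMap_mul_map, ← monomial_zero',
      coeffMap_monomial]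
  | add P Q hP hQ => simp only [map_add, hP, hQ]

variable {R : Type*} [CommRing R] [Algebra L R]

theorem Stable.ker_aeval_of_eq {τ : Type*} {x : τ → R} {y : σ → R}
    (h : Stable F (RingHom.ker (aeval (R := L) x))) {Q : σ → MvPolynomial τ F}
    (hQ : ∀ i, y i = aeval x (MvPolynomial.map (algebraMap F L) (Q i))) :
    Stable F (RingHom.ker (aeval (R := L) y)) := by
  have key : ∀ P : MvPolynomial σ L, aeval y P =
      aeval x (bind₁ (fun i => MvPolynomial.map (algebraMap F L) (Q i)) P) := by
    intro P
    rw [aeval_bind₁]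
    simp only [← hQ]
  intro f P hP
  rw [RingHom.mem_ker, key] at hP ⊢
  rw [← coeffMap_bind₁]
  exact h f _ hP

theorem map_aeval_coeffMap {x : σ → R} (φ : R →ₗ[L] L) {f : L →ₗ[F] L}
    (hφ : ∀ a, φ (aeval x (monomial a (1 : L))) ∈ (algebraMap F L).range) (P : MvPolynomial σ L) :
    φ (aeval x (coeffMap f.toAddMonoidHom P)) = f (φ (aeval x P)) := by
  have key : ∀ (a : σ →₀ ℕ) (c : L), monomial a c = c • monomial a (1 : L) := fun a c => by
    rw [smul_monomial, smul_eq_mul, mul_one]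
  induction P using MvPolynomial.induction_on' with
  | monomial a c =>
    obtain ⟨e, he⟩ := hφ a
    rw [coeffMap_monomial, key, key a c, map_smul, map_smul, map_smul, map_smul, ← he,
      smul_eq_mul, mul_comm, ← Algebra.smul_def, smul_eq_mul, mul_comm c, ← Algebra.smul_def,
      map_smul]
    rfl
  | add P Q hP hQ => simp only [map_add, hP, hQ]

theorem exists_linearMap_retraction (F L : Type*) [Field F] [Field L] [Algebra F L] :
    ∃ f : L →ₗ[F] L, f 1 = 1 ∧ ∀ x, f x ∈ (algebraMap F L).range := by
  obtain ⟨f, hf⟩ := (Algebra.linearMap F L).exists_leftInverse_of_injective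
    (LinearMap.ker_eq_bot.2 (algebraMap F L).injective)
  refine ⟨(Algebra.linearMap F L).comp f, ?_, fun x => ⟨f x, rfl⟩⟩
  have := LinearMap.congr_fun hf 1
  simp only [LinearMap.comp_apply, Algebra.linearMap_apply, map_one, LinearMap.id_apply] at this
  simp [this]

theorem Stable.repr_mem {x : σ → R} (h : Stable F (RingHom.ker (aeval (R := L) x)))
    {ι : Type*} (b : Module.Basis ι L R) {s : ι → σ →₀ ℕ}
    (hs : ∀ i, b i = aeval x (monomial (s i) (1 : L))) (a : σ →₀ ℕ) (i : ι) :
    b.repr (aeval x (monomial a (1 : L))) i ∈ (algebraMap F L).range := by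
  obtain ⟨f, hf1, hf⟩ := exists_linearMap_retraction F L
  set r := b.repr (aeval x (monomial a (1 : L))) with hr
  have key : ∀ (a : σ →₀ ℕ) (c : L), monomial a c = c • monomial a (1 : L) := fun a c => by
    rw [smul_monomial, smul_eq_mul, mul_one]
  have hsum : ∀ r : ι →₀ L, aeval x (∑ i ∈ r.support, monomial (s i) (r i)) =
      Finsupp.linearCombination L b r := by
    intro r
    rw [map_sum, Finsupp.linearCombination_apply, Finsupp.sum]
    refine Finset.sum_congr rfl fun j _ => ?_
    rw [hs, key, map_smul]
  have h1 : monomial a (1 : L) - ∑ i ∈ r.support, monomial (s i) (r i) ∈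
      RingHom.ker (aeval (R := L) x) := by
    rw [RingHom.mem_ker, map_sub, hsum, b.linearCombination_repr, sub_self]
  have h2 := h f _ h1
  rw [RingHom.mem_ker, map_sub, map_sub, sub_eq_zero, coeffMap_monomial, map_sum] at h2
  have h3 : aeval x (monomial a (1 : L)) = Finsupp.linearCombination L b
      (r.mapRange f (map_zero f)) := by
    have h4 : f.toAddMonoidHom 1 = 1 := hf1
    rw [h4] at h2
    rw [h2, map_sum, Finsupp.linearCombination_apply, Finsupp.sum_mapRange_index (by simp),
      Finsupp.sum]
    refine Finset.sum_congr rfl fun j _ => ?_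
    rw [hs, coeffMap_monomial, key, map_smul]
    rfl
  have h5 : r = r.mapRange f (map_zero f) := by
    have := congrArg b.repr h3
    rwa [b.repr_linearCombination] at this
  rw [h5, Finsupp.mapRange_apply]
  exact hf _

/-- The field of definition of the kernel of `L[X] → R`. -/
theorem exists_field_of_definition {k : Type*} [Field k] [Algebra k L] {x : σ → R}
    (hx : Function.Surjective (aeval (R := L) x)) :
    ∃ T : Set L, (∀ F : IntermediateField k L, Stable F (RingHom.ker (aeval (R := L) x)) ↔
        IntermediateField.adjoin k T ≤ F) ∧
      ∀ F : Subfield L, Stable F (RingHom.ker (aeval (R := L) x)) → T ⊆ F := by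
  let m : (σ →₀ ℕ) → R := fun a => aeval x (monomial a (1 : L))
  have key : ∀ (a : σ →₀ ℕ) (c : L), monomial a c = c • monomial a (1 : L) := fun a c => by
    rw [smul_monomial, smul_eq_mul, mul_one]
  have hspan : Submodule.span L (Set.range m) = ⊤ := by
    rw [eq_top_iff]
    rintro y -
    obtain ⟨P, rfl⟩ := hx y
    induction P using MvPolynomial.induction_on' with
    | monomial a c =>
      rw [key, map_smul]
      exact Submodule.smul_mem _ _ (Submodule.subset_span ⟨a, rfl⟩)
    | add P Q hP hQ => rw [map_add]; exact add_mem hP hQ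
  obtain ⟨B, hB, hBspan, hli⟩ := exists_linearIndependent L (Set.range m)
  let b : Module.Basis B L R := Module.Basis.mk hli (by
    rw [Subtype.range_coe, hBspan, hspan])
  choose s hs using fun i : B => hB i.2
  have hb : ∀ i, b i = aeval x (monomial (s i) (1 : L)) := fun i => by
    rw [Module.Basis.mk_apply, ← hs i]
  refine ⟨{c | ∃ a i, c = b.repr (m a) i}, fun F => ⟨fun h => ?_, fun h f P hP => ?_⟩,
    fun F h => ?_⟩
  · rw [IntermediateField.adjoin_le_iff]
    rintro _ ⟨a, i, rfl⟩
    obtain ⟨c, hc⟩ := h.repr_mem b hb a i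
    exact hc ▸ c.2
  · rw [RingHom.mem_ker] at hP ⊢
    apply b.ext_elem
    intro i
    have h1 := map_aeval_coeffMap (x := x) (b.coord i) (f := f) (fun a =>
      ⟨⟨_, h (IntermediateField.subset_adjoin _ _ ⟨a, i, rfl⟩)⟩, rfl⟩) P
    rw [hP, map_zero, map_zero] at h1
    simpa using h1
  · rintro _ ⟨a, i, rfl⟩
    obtain ⟨c, hc⟩ := h.repr_mem b hb a i
    exact hc ▸ c.2

end Stable

section Etale

variable {σ k L B : Type*} [Field k] [Field L] [CommRing B] [Algebra k L] [Algebra L B]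
  [Algebra k B] [IsScalarTower k L B]

theorem isUnit_of_apply_ne_zero {ε : B →ₐ[L] L} (hε : IsNilpotent (RingHom.ker ε)) {b : B}
    (hb : ε b ≠ 0) : IsUnit b := by
  have hs : IsNilpotent (1 - algebraMap L B (ε b)⁻¹ * b) := by
    obtain ⟨n, hn⟩ := hε
    refine ⟨n, ?_⟩
    have : 1 - algebraMap L B (ε b)⁻¹ * b ∈ RingHom.ker ε := by
      rw [RingHom.mem_ker, map_sub, map_one, map_mul, ε.commutes, Algebra.algebraMap_self_apply,
        inv_mul_cancel₀ hb, sub_self]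
    have := Ideal.pow_mem_pow this n
    rw [hn] at this
    exact this
  have h := hs.isUnit_one_sub
  rw [sub_sub_cancel] at h
  exact isUnit_of_mul_isUnit_right h

open scoped IntermediateField.algebraAdjoinAdjoin in
theorem exists_algHom_adjoin {ε : B →ₐ[L] L} (hε : IsNilpotent (RingHom.ker ε)) {η : σ → L}
    {ξ : σ → B} (hξ : ∀ i, ε (ξ i) = 0)
    (hf : ∀ f : MvPolynomial σ k, aeval η f = 0 → aeval (fun i => algebraMap L B (η i) + ξ i) f = 0) :
    ∃ ι : IntermediateField.adjoin k (Set.range η) →+* B, (∀ x, ε (ι x) = x) ∧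
      (∀ c, ι (algebraMap k _ c) = algebraMap k B c) ∧
      ∀ i (h : η i ∈ IntermediateField.adjoin k (Set.range η)),
        ι ⟨η i, h⟩ = algebraMap L B (η i) + ξ i := by
  have hmem : ∀ f : MvPolynomial σ k, aeval η f ∈ Algebra.adjoin k (Set.range η) := fun f => by
    rw [Algebra.adjoin_range_eq_range_aeval]
    exact ⟨f, rfl⟩
  let π : MvPolynomial σ k →ₐ[k] Algebra.adjoin k (Set.range η) := (aeval η).codRestrict _ hmem
  have hπ : Function.Surjective π := by
    rintro ⟨x, hx⟩
    have hx' := hx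
    rw [Algebra.adjoin_range_eq_range_aeval] at hx'
    obtain ⟨f, rfl⟩ := hx'
    exact ⟨f, rfl⟩
  let ι₀ : Algebra.adjoin k (Set.range η) →ₐ[k] B :=
    AlgHom.liftOfSurjective π hπ (aeval fun i => algebraMap L B (η i) + ξ i) (by
      intro f hf'
      exact hf f (congrArg Subtype.val hf'))
  have hι₀ : ∀ f, ι₀ (π f) = aeval (fun i => algebraMap L B (η i) + ξ i) f := fun f =>
    AlgHom.liftOfSurjective_apply _ _ _ _ f
  have hει₀ : ∀ x, ε (ι₀ x) = x := by
    intro x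
    obtain ⟨f, rfl⟩ := hπ x
    rw [hι₀]
    have : (ε.restrictScalars k) (aeval (fun i => algebraMap L B (η i) + ξ i) f) = aeval η f := by
      rw [comp_aeval_apply]
      congr 2
      funext i
      simp [hξ]
    exact this
  have hu : ∀ y : nonZeroDivisors (Algebra.adjoin k (Set.range η)),
      IsUnit ((ι₀ : Algebra.adjoin k (Set.range η) →+* B) (y : Algebra.adjoin k (Set.range η))) := by
    intro y
    apply isUnit_of_apply_ne_zero hε
    change ε (ι₀ y) ≠ 0
    rw [hει₀]
    simp
  refine ⟨IsLocalization.lift (M := nonZeroDivisors (Algebra.adjoin k (Set.range η))) hu,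
    ?_, ?_, ?_⟩
  · have : ((ε : B →+* L).comp (IsLocalization.lift hu)) =
        algebraMap (IntermediateField.adjoin k (Set.range η)) L := by
      apply IsLocalization.ringHom_ext (nonZeroDivisors (Algebra.adjoin k (Set.range η)))
      ext x
      rw [RingHom.comp_apply, RingHom.comp_apply, IsLocalization.lift_eq]
      exact hει₀ x
    exact fun x => RingHom.congr_fun this x
  · intro c
    rw [IsScalarTower.algebraMap_apply k (Algebra.adjoin k (Set.range η)), IsLocalization.lift_eq]
    exact ι₀.commutes c
  · intro i h
    have : (⟨η i, h⟩ : IntermediateField.adjoin k (Set.range η)) =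
        algebraMap (Algebra.adjoin k (Set.range η)) _ (π (X i)) := by
      apply Subtype.ext
      change η i = aeval η (X i)
      rw [aeval_X]
    rw [this, IsLocalization.lift_eq]
    change ι₀ (π (X i)) = _
    rw [hι₀, aeval_X]

theorem exists_lift_of_isSeparable {F₁ : Type*} [Field F₁] [Algebra F₁ L] {ε : B →ₐ[L] L}
    (hε : IsNilpotent (RingHom.ker ε)) (ι : F₁ →+* B) (hι : ∀ x, ε (ι x) = algebraMap F₁ L x)
    {w : σ → L} (hw : ∀ i, IsSeparable F₁ (w i)) :
    ∃ θ : IntermediateField.adjoin F₁ (Set.range w) →+* B, (∀ x, ε (θ x) = x) ∧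
      ∀ x, θ (algebraMap F₁ _ x) = ι x := by
  let _ : Algebra F₁ B := ι.toAlgebra
  have : Algebra.IsSeparable F₁ (IntermediateField.adjoin F₁ (Set.range w)) := by
    rw [IntermediateField.isSeparable_adjoin_iff_isSeparable]
    rintro _ ⟨i, rfl⟩
    exact hw i
  have := Algebra.FormallyEtale.of_isSeparable F₁ (IntermediateField.adjoin F₁ (Set.range w))
  let ε' : B →ₐ[F₁] L := { (ε : B →+* L) with commutes' := fun x => hι x }
  let θ := Algebra.FormallySmooth.liftOfSurjective
    (IntermediateField.adjoin F₁ (Set.range w)).val ε'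
    (fun y => ⟨algebraMap L B y, ε.commutes y⟩) hε
  exact ⟨θ, fun x => Algebra.FormallySmooth.liftOfSurjective_apply
    (IntermediateField.adjoin F₁ (Set.range w)).val ε' _ _ x, fun x => θ.commutes x⟩

/-- Deformations of a point lift along an étale additive polynomial. -/
theorem exists_lift_deformation {p : ℕ} [Fact p.Prime] [CharP B p] {ε : B →ₐ[L] L}
    (hε : IsNilpotent (RingHom.ker ε)) {ψ : Polynomial k} (hψ : ψ ∈ additivePolys p k) {e : k}
    (he : e ≠ 0) (hψe : Polynomial.derivative ψ = Polynomial.C e) {η w : σ → L}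
    (hw : ∀ i, Polynomial.aeval (w i) ψ = η i) {ξ : σ → B} (hξ : ∀ i, ε (ξ i) = 0)
    (hf : ∀ f : MvPolynomial σ k, aeval η f = 0 → aeval (fun i => algebraMap L B (η i) + ξ i) f = 0) :
    ∃ x : σ → B, (∀ i, ε (x i) = 0) ∧ (∀ i, Polynomial.aeval (x i) ψ = ξ i) ∧
      ∀ f : MvPolynomial σ k, aeval w f = 0 →
        aeval (fun i => algebraMap L B (w i) + x i) f = 0 := by
  obtain ⟨ι, hι, hιk, hιη⟩ := exists_algHom_adjoin hε hξ hf
  have hη : ∀ i, η i ∈ IntermediateField.adjoin k (Set.range η) := fun i =>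
    IntermediateField.subset_adjoin _ _ ⟨i, rfl⟩
  let F₁ := IntermediateField.adjoin k (Set.range η)
  have hsep : ∀ i, IsSeparable F₁ (w i) := by
    intro i
    have h1 : Polynomial.derivative (ψ.map (algebraMap k F₁)) = Polynomial.C (algebraMap k F₁ e) := by
      rw [Polynomial.derivative_map, hψe, Polynomial.map_C]
    refine isSeparable_of_aeval_eq_zero (separable_sub_C_of_derivative
      ((map_ne_zero (algebraMap k F₁)).2 he) h1 ⟨η i, hη i⟩) ?_
    rw [map_sub, Polynomial.aeval_C, Polynomial.aeval_map_algebraMap, hw]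
    exact sub_self _
  obtain ⟨θ, hθ, hθι⟩ := exists_lift_of_isSeparable hε ι hι hsep
  have hwA : ∀ i, w i ∈ IntermediateField.adjoin F₁ (Set.range w) := fun i =>
    IntermediateField.subset_adjoin _ _ ⟨i, rfl⟩
  let w' : σ → IntermediateField.adjoin F₁ (Set.range w) := fun i => ⟨w i, hwA i⟩
  let θ' : IntermediateField.adjoin F₁ (Set.range w) →ₐ[k] B :=
    { θ with commutes' := fun c => (hθι (algebraMap k F₁ c)).trans (hιk c) }
  let j : IntermediateField.adjoin F₁ (Set.range w) →ₐ[k] L :=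
    { algebraMap (IntermediateField.adjoin F₁ (Set.range w)) L with commutes' := fun c => rfl }
  have hj : Function.Injective j := (algebraMap (IntermediateField.adjoin F₁ (Set.range w)) L).injective
  refine ⟨fun i => θ' (w' i) - algebraMap L B (w i), fun i => ?_, fun i => ?_, fun f hf' => ?_⟩
  · rw [map_sub, ε.commutes, sub_eq_zero]
    exact hθ _
  · have h1 : Polynomial.aeval (w' i) ψ = algebraMap F₁ _ ⟨η i, hη i⟩ := by
      apply hj
      rw [← Polynomial.aeval_algHom_apply]
      exact hw i
    have h2 : Polynomial.aeval (θ' (w' i)) ψ = algebraMap L B (η i) + ξ i := by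
      rw [Polynomial.aeval_algHom_apply, h1]
      exact (hθι _).trans (hιη i _)
    have h3 : Polynomial.aeval (algebraMap L B (w i)) ψ = algebraMap L B (η i) := by
      rw [Polynomial.aeval_algebraMap_apply, hw]
    have h4 := aeval_add_of_mem_additivePolys hψ (θ' (w' i) - algebraMap L B (w i))
      (algebraMap L B (w i))
    rw [sub_add_cancel, h2, h3, add_comm] at h4
    exact (add_right_cancel h4).symm
  · simp only [add_sub_cancel]
    have : aeval w' f = 0 := by
      apply hj
      rw [comp_aeval_apply, map_zero]
      exact hf'
    have h := comp_aeval_apply w' θ' f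
    rw [this, map_zero] at h
    exact h.symm

end Etale

section Nilpotent

variable {k B : Type*} [Field k] [CommRing B] [Algebra k B] {ψ : Polynomial k} {e : k}

theorem eq_zero_of_isNilpotent_of_aeval_eq_zero (h0 : ψ.coeff 0 = 0) (he : e ≠ 0)
    (hψe : Polynomial.derivative ψ = Polynomial.C e) {x : B} (hx : IsNilpotent x)
    (h : Polynomial.aeval x ψ = 0) : x = 0 := by
  obtain ⟨u, rfl⟩ := Polynomial.X_dvd_iff.2 h0
  obtain ⟨v, hv⟩ : Polynomial.X ∣ u - Polynomial.C e := by
    rw [Polynomial.X_dvd_iff]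
    have := congrArg (Polynomial.coeff · 0) hψe
    simp only [Polynomial.derivative_mul, Polynomial.derivative_X, one_mul, Polynomial.coeff_add,
      Polynomial.coeff_X_mul_zero, add_zero, Polynomial.coeff_C_zero] at this
    simp [this]
  rw [sub_eq_iff_eq_add] at hv
  rw [hv, map_mul, map_add, map_mul, Polynomial.aeval_X, Polynomial.aeval_C] at h
  have hu : IsUnit (x * Polynomial.aeval x v + algebraMap k B e) :=
    IsNilpotent.isUnit_add_right_of_commute
      ((Commute.all x (Polynomial.aeval x v)).isNilpotent_mul_right hx)
      ((Ne.isUnit he).map _) (Commute.all _ _)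
  exact (IsUnit.mul_left_eq_zero hu).1 h

theorem mem_adjoin_aeval_of_isNilpotent (h0 : ψ.coeff 0 = 0) (he : e ≠ 0)
    (hψe : Polynomial.derivative ψ = Polynomial.C e) {x : B} (hx : IsNilpotent x) :
    ∃ q : Polynomial k, x = Polynomial.aeval (Polynomial.aeval x ψ) q := by
  obtain ⟨u, rfl⟩ := Polynomial.X_dvd_iff.2 h0
  have hu0 : u.coeff 0 = e := by
    have := congrArg (Polynomial.coeff · 0) hψe
    simpa only [Polynomial.derivative_mul, Polynomial.derivative_X, one_mul, Polynomial.coeff_add,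
      Polynomial.coeff_X_mul_zero, add_zero, Polynomial.coeff_C_zero] using this
  obtain ⟨N, hN⟩ := hx
  set y := Polynomial.aeval x (Polynomial.X * u) with hy
  have key : ∀ m j, N ≤ j + m → ∀ s : Polynomial k,
      ∃ q : Polynomial k, Polynomial.aeval x (Polynomial.X ^ j * s) = Polynomial.aeval y q := by
    intro m
    induction m with
    | zero =>
      intro j hj s
      refine ⟨0, ?_⟩
      rw [map_zero, map_mul, map_pow, Polynomial.aeval_X, pow_eq_zero_of_le (by omega) hN, zero_mul]
    | succ m ih =>
      intro j hj s
      obtain ⟨t, ht⟩ : Polynomial.X ∣ s - Polynomial.C (s.coeff 0 * (e ^ j)⁻¹) * u ^ j := by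
        rw [Polynomial.X_dvd_iff]
        simp [Polynomial.coeff_zero_eq_eval_zero, Polynomial.eval_pow] at hu0 ⊢
        rw [hu0, mul_assoc, inv_mul_cancel₀ (pow_ne_zero _ he), mul_one, sub_self]
      rw [sub_eq_iff_eq_add] at ht
      obtain ⟨q, hq⟩ := ih (j + 1) (by omega) t
      refine ⟨q + Polynomial.C (s.coeff 0 * (e ^ j)⁻¹) * Polynomial.X ^ j, ?_⟩
      have h2 : Polynomial.X ^ j * s = Polynomial.X ^ (j + 1) * t +
          Polynomial.C (s.coeff 0 * (e ^ j)⁻¹) * (Polynomial.X * u) ^ j := by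
        conv_lhs => rw [ht]
        ring
      rw [h2, map_add, map_add, hq, map_mul _ (Polynomial.C _), map_mul _ (Polynomial.C _),
        map_pow, map_pow, Polynomial.aeval_C, Polynomial.aeval_C, Polynomial.aeval_X]
  obtain ⟨q, hq⟩ := key N 1 (by omega) 1
  exact ⟨q, by rw [← hq]; simp⟩

end Nilpotent

section Deformation

variable {σ k L : Type*} [Field k] [Field L] [Algebra k L]

/-- The ideal of the `n`-th infinitesimal neighbourhood of `u`, translated to the origin, in
the `k`-Zariski closure of `u`. -/
noncomputable def defIdeal (k : Type*) {σ L : Type*} [Field k] [Field L] [Algebra k L] (n : ℕ) (u : σ → L) :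
    Ideal (MvPolynomial σ L) :=
  Ideal.span {P | ∃ f : MvPolynomial σ k, aeval u f = 0 ∧ aeval (fun i => C (u i) + X i) f = P} ⊔
    idealOfVars σ L ^ (n + 1)

theorem aeval_eq_zero_of_mem_defIdeal {B : Type*} [CommRing B] [Algebra L B] [Algebra k B]
    [IsScalarTower k L B] {n : ℕ} {u : σ → L} {J : Ideal B} (hJ : J ^ (n + 1) = ⊥) {ξ : σ → B}
    (hξ : ∀ i, ξ i ∈ J)
    (hf : ∀ f : MvPolynomial σ k, aeval u f = 0 → aeval (fun i => algebraMap L B (u i) + ξ i) f = 0)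
    {P : MvPolynomial σ L} (hP : P ∈ defIdeal k n u) : aeval ξ P = 0 := by
  have : defIdeal k n u ≤ RingHom.ker (aeval (R := L) ξ) := by
    refine sup_le ?_ ?_
    · rw [Ideal.span_le]
      rintro _ ⟨f, hf0, rfl⟩
      have := comp_aeval_apply (fun i => C (u i) + X i)
        ((aeval (R := L) ξ).restrictScalars k) f
      rw [AlgHom.restrictScalars_apply] at this
      rw [SetLike.mem_coe, RingHom.mem_ker, this]
      simpa [algHom_C] using hf f hf0
    · intro P hP
      have h1 : Ideal.map (aeval (R := L) ξ) (idealOfVars σ L) ≤ J := by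
        rw [idealOfVars, Ideal.map_span, Ideal.span_le]
        rintro _ ⟨_, ⟨i, rfl⟩, rfl⟩
        simpa using hξ i
      have h2 := Ideal.mem_map_of_mem (aeval (R := L) ξ) hP
      rw [Ideal.map_pow] at h2
      have h3 := Ideal.pow_right_mono h1 (n + 1) h2
      rw [hJ] at h3
      exact h3
  exact this hP

variable (k) (n : ℕ) (u : σ → L)

theorem defIdeal_le_ker : ∀ P ∈ defIdeal k n u, aeval (fun _ => (0 : L)) P = 0 := fun P hP =>
  aeval_eq_zero_of_mem_defIdeal (k := k) (n := n) (u := u) (J := (⊥ : Ideal L))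
    (by rw [Ideal.bot_pow (by omega)]) (fun i => rfl)
    (fun f hf => by simpa using hf) hP

/-- The augmentation of the deformation ring. -/
noncomputable def defAug : MvPolynomial σ L ⧸ defIdeal k n u →ₐ[L] L :=
  Ideal.Quotient.liftₐ _ (aeval fun _ => 0) (defIdeal_le_ker k n u)

@[simp] theorem defAug_mk (P : MvPolynomial σ L) :
    defAug k n u (Ideal.Quotient.mk _ P) = aeval (fun _ => (0 : L)) P := rfl

theorem mem_idealOfVars_of_aeval_zero {P : MvPolynomial σ L} (hP : aeval (fun _ => (0 : L)) P = 0) :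
    P ∈ idealOfVars σ L := by
  classical
  have : P - C (aeval (fun _ => (0 : L)) P) ∈ idealOfVars σ L := by
    clear hP
    induction P using MvPolynomial.induction_on with
    | C a => simp
    | add P Q hP hQ =>
      have := add_mem hP hQ
      rw [map_add, map_add]
      convert this using 1
      ring
    | mul_X P i hP =>
      have : P * X i ∈ idealOfVars σ L :=
        Ideal.mul_mem_left _ _ (Ideal.subset_span ⟨i, rfl⟩)
      simpa using this
  simpa [hP] using this

theorem ker_defAug_pow : (RingHom.ker (defAug k n u)) ^ (n + 1) = ⊥ := by
  have h1 : RingHom.ker (defAug k n u) ≤ (idealOfVars σ L).map (Ideal.Quotient.mk _) := by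
    intro y hy
    obtain ⟨P, rfl⟩ := Ideal.Quotient.mk_surjective y
    exact Ideal.mem_map_of_mem _ (mem_idealOfVars_of_aeval_zero hy)
  rw [eq_bot_iff]
  refine (Ideal.pow_right_mono h1 _).trans ?_
  rw [← Ideal.map_pow, Ideal.map_le_iff_le_comap]
  intro P hP
  rw [Ideal.mem_comap, Ideal.mem_bot, Ideal.Quotient.eq_zero_iff_mem]
  exact Ideal.mem_sup_right hP

theorem aeval_mk_eq (P : MvPolynomial σ L) :
    aeval (fun i => Ideal.Quotient.mk (defIdeal k n u) (X i)) P = Ideal.Quotient.mk _ P := by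
  have := comp_aeval_apply (R := L) X (Ideal.Quotient.mkₐ L (defIdeal k n u)) P
  rw [aeval_X_left_apply] at this
  exact this.symm

theorem aeval_mk_deformation {f : MvPolynomial σ k} (hf : aeval u f = 0) :
    aeval (fun i => algebraMap L (MvPolynomial σ L ⧸ defIdeal k n u) (u i) +
      Ideal.Quotient.mk _ (X i)) f = 0 := by
  have := comp_aeval_apply (R := k) (fun i => C (u i) + X i)
    ((Ideal.Quotient.mkₐ L (defIdeal k n u)).restrictScalars k) f
  refine this.symm.trans ?_
  rw [AlgHom.restrictScalars_apply, Ideal.Quotient.mkₐ_eq_mk, Ideal.Quotient.eq_zero_iff_mem]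
  exact Ideal.mem_sup_left (Ideal.subset_span ⟨f, hf, rfl⟩)

end Deformation

section EtaleKernel

variable {σ k L : Type*} [Field k] [Field L] [Algebra k L] {p : ℕ} [Fact p.Prime] [CharP k p]
  {ψ : Polynomial k} {e : k}

theorem isNilpotent_of_defAug_eq_zero {n : ℕ} {u : σ → L} {x : MvPolynomial σ L ⧸ defIdeal k n u}
    (hx : defAug k n u x = 0) : IsNilpotent x := by
  refine ⟨n + 1, ?_⟩
  have h : x ∈ RingHom.ker (defAug k n u) := hx
  have := Ideal.pow_mem_pow h (n + 1)
  rwa [ker_defAug_pow] at this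

theorem exists_lift_ker (hψ : ψ ∈ additivePolys p k) (he : e ≠ 0)
    (hψe : Polynomial.derivative ψ = Polynomial.C e) {η w : σ → L}
    (hw : ∀ i, Polynomial.aeval (w i) ψ = η i) (n : ℕ) :
    ∃ x : σ → MvPolynomial σ L ⧸ defIdeal k n η,
      (∀ i, Polynomial.aeval (x i) ψ = Ideal.Quotient.mk _ (X i)) ∧
      (∀ i, ∃ q : Polynomial k, x i = Polynomial.aeval (Ideal.Quotient.mk (defIdeal k n η) (X i)) q) ∧
      RingHom.ker (aeval (R := L) x) = defIdeal k n w := by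
  have h0 := coeff_zero_of_mem_additivePolys hψ
  have hchar : ∀ u : σ → L, CharP (MvPolynomial σ L ⧸ defIdeal k n u) p := fun u => by
    have : Nontrivial (MvPolynomial σ L ⧸ defIdeal k n u) := (defAug k n u).toRingHom.domain_nontrivial
    exact charP_of_injective_algebraMap
      (algebraMap k (MvPolynomial σ L ⧸ defIdeal k n u)).injective p
  have hcharη := hchar η
  have hcharw := hchar w
  have hnil : IsNilpotent (RingHom.ker (defAug k n η)) := ⟨n + 1, ker_defAug_pow k n η⟩
  obtain ⟨x, hx0, hxψ, hxf⟩ := exists_lift_deformation (k := k) (L := L) hnil hψ he hψe hw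
    (ξ := fun i => Ideal.Quotient.mk _ (X i)) (fun i => by simp)
    (fun f hf => aeval_mk_deformation k n η hf)
  refine ⟨x, hxψ, fun i => ?_, le_antisymm ?_ ?_⟩
  · rw [← hxψ i]
    exact mem_adjoin_aeval_of_isNilpotent h0 he hψe (isNilpotent_of_defAug_eq_zero (hx0 i))
  · let ξ : σ → MvPolynomial σ L ⧸ defIdeal k n w := fun i => Ideal.Quotient.mk _ (X i)
    have hξ0 : ∀ i, defAug k n w (ξ i) = 0 := fun i => by simp [ξ]
    let Ψ : MvPolynomial σ L ⧸ defIdeal k n η →ₐ[L] MvPolynomial σ L ⧸ defIdeal k n w :=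
      Ideal.Quotient.liftₐ _ (aeval fun i => Polynomial.aeval (ξ i) ψ) (by
        intro P hP
        refine aeval_eq_zero_of_mem_defIdeal (ker_defAug_pow k n w) (fun i => ?_) (fun f hf => ?_) hP
        · rw [RingHom.mem_ker]
          have := Polynomial.aeval_algHom_apply ((defAug k n w).restrictScalars k) (ξ i) ψ
          refine this.symm.trans ?_
          rw [AlgHom.restrictScalars_apply, hξ0, ← Polynomial.coeff_zero_eq_aeval_zero', h0, map_zero]
        · have h1 : aeval w (aeval (fun i => Polynomial.aeval (X i : MvPolynomial σ k) ψ) f) = 0 := by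
            rw [comp_aeval_apply, ← hf]
            congr 2
            funext i
            rw [← Polynomial.aeval_algHom_apply, aeval_X, hw]
          have h2 := aeval_mk_deformation k n w h1
          rw [comp_aeval_apply] at h2
          rw [← h2]
          congr 2
          funext i
          rw [← Polynomial.aeval_algHom_apply, aeval_X, aeval_add_of_mem_additivePolys hψ,
            Polynomial.aeval_algebraMap_apply, hw])
    have hΨ : ∀ i, Ψ (Ideal.Quotient.mk _ (X i)) = Polynomial.aeval (ξ i) ψ := fun i => by
      change aeval (fun i => Polynomial.aeval (ξ i) ψ) (X i : MvPolynomial σ L) = _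
      rw [aeval_X]
    have hΨx : ∀ i, Ψ (x i) = ξ i := by
      intro i
      rw [← sub_eq_zero]
      refine eq_zero_of_isNilpotent_of_aeval_eq_zero h0 he hψe ?_ (?_ :
        Polynomial.aeval (Ψ (x i) - ξ i) ψ = 0)
      · exact (Commute.all _ _).isNilpotent_sub ((isNilpotent_of_defAug_eq_zero (hx0 i)).map Ψ)
          (isNilpotent_of_defAug_eq_zero (hξ0 i))
      · have h1 := aeval_add_of_mem_additivePolys hψ (Ψ (x i) - ξ i) (ξ i)
        have h2 := Polynomial.aeval_algHom_apply (Ψ.restrictScalars k) (x i) ψ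
        rw [AlgHom.restrictScalars_apply, AlgHom.restrictScalars_apply, hxψ, hΨ] at h2
        rw [sub_add_cancel, h2] at h1
        exact left_eq_add.1 (by rw [add_comm]; exact h1)
    intro P hP
    have h1 := comp_aeval_apply x Ψ P
    rw [RingHom.mem_ker] at hP
    rw [hP, map_zero] at h1
    simp only [hΨx, ξ] at h1
    rw [aeval_mk_eq] at h1
    exact Ideal.Quotient.eq_zero_iff_mem.1 h1.symm
  · intro P hP
    exact aeval_eq_zero_of_mem_defIdeal (ker_defAug_pow k n η) hx0 hxf hP

theorem ker_aeval_mk (k : Type*) [Field k] [Algebra k L] (n : ℕ) (u : σ → L) :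
    RingHom.ker (aeval (R := L) fun i => Ideal.Quotient.mk (defIdeal k n u) (X i)) =
      defIdeal k n u := by
  ext P
  rw [RingHom.mem_ker, aeval_mk_eq, Ideal.Quotient.eq_zero_iff_mem]

theorem stable_defIdeal_iff (hψ : ψ ∈ additivePolys p k) (he : e ≠ 0)
    (hψe : Polynomial.derivative ψ = Polynomial.C e) {η w : σ → L}
    (hw : ∀ i, Polynomial.aeval (w i) ψ = η i) (n : ℕ) (F : IntermediateField k L) :
    Stable F (defIdeal k n η) ↔ Stable F (defIdeal k n w) := by
  obtain ⟨x, hxψ, hxq, hker⟩ := exists_lift_ker hψ he hψe hw n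
  choose q hq using hxq
  have key : ∀ (z : MvPolynomial σ L ⧸ defIdeal k n η) (i : σ) (y : σ → _) (r : Polynomial k),
      y i = z → Polynomial.aeval z r = aeval y (MvPolynomial.map (algebraMap F L)
        (Polynomial.aeval (X i) r)) := by
    rintro _ i y r rfl
    have : MvPolynomial.map (algebraMap F L) (Polynomial.aeval (X i) r) =
        Polynomial.aeval (X i : MvPolynomial σ L) r := by
      have := Polynomial.aeval_algHom_apply (MvPolynomial.mapAlgHom (σ := σ)
        (Algebra.algHom k F L)) (X i) r
      rw [mapAlgHom_apply, mapAlgHom_apply, map_X] at this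
      exact this.symm
    rw [this]
    have := Polynomial.aeval_algHom_apply ((aeval (R := L) y).restrictScalars k) (X i) r
    rw [← AlgHom.restrictScalars_apply k (aeval (R := L) y), ← this, AlgHom.restrictScalars_apply,
      aeval_X]
  have hη := ker_aeval_mk k n η
  rw [← hker]
  refine ⟨fun h => ?_, fun h => ?_⟩
  · rw [← hη] at h
    exact h.ker_aeval_of_eq fun i => (hq i).trans (key _ i _ _ rfl)
  · rw [← hη]
    exact h.ker_aeval_of_eq fun i => (hxψ i).symm.trans (key _ i _ _ rfl)

end EtaleKernel

section FieldOfDefinition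

variable {σ k L : Type*} [Field k] [Field L] [Algebra k L] {p : ℕ} [Fact p.Prime] [CharP k p]
  [CharP L p]

omit [Fact p.Prime] [CharP k p] [CharP L p] in
theorem stable_adjoin_defIdeal (n : ℕ) (u : σ → L) :
    Stable (IntermediateField.adjoin k (Set.range u)) (defIdeal k n u) := by
  refine Stable.sup (Stable.span ?_) (Stable.idealOfVars_pow _)
  rintro _ ⟨f, -, rfl⟩
  let F := IntermediateField.adjoin k (Set.range u)
  refine ⟨aeval (fun i => C (⟨u i, IntermediateField.subset_adjoin _ _ ⟨i, rfl⟩⟩ : F) + X i) f, ?_⟩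
  have := comp_aeval_apply (fun i =>
    C (⟨u i, IntermediateField.subset_adjoin _ _ ⟨i, rfl⟩⟩ : F) + X i)
    ((MvPolynomial.mapAlgHom (σ := σ) (Algebra.ofId F L)).restrictScalars k) f
  refine this.trans ?_
  congr 2
  funext i
  rw [map_add, AlgHom.restrictScalars_apply, AlgHom.restrictScalars_apply, mapAlgHom_apply,
    mapAlgHom_apply, map_C, map_X]
  rfl

theorem aeval_pow_map_iterateFrobenius (N : ℕ) (ζ : σ → L) (Q : MvPolynomial σ k) :
    aeval (fun i => ζ i ^ p ^ N) (MvPolynomial.map (iterateFrobenius k p N) Q) =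
      aeval ζ Q ^ p ^ N := by
  induction Q using MvPolynomial.induction_on with
  | C a => simp [iterateFrobenius_def]
  | add P Q hP hQ => rw [map_add, map_add, map_add, hP, hQ, add_pow_char_pow]
  | mul_X P i hP => rw [map_mul, map_mul, map_mul, hP, map_X, aeval_X, aeval_X, mul_pow]

theorem mem_span_map_iterateFrobenius (h : PSep p k L) (N : ℕ) (ζ : σ → L) {f : MvPolynomial σ k}
    (hf : aeval (fun i => ζ i ^ p ^ N) f = 0) :
    f ∈ Submodule.span k {f' | ∃ q : MvPolynomial σ k, aeval ζ q = 0 ∧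
      f' = MvPolynomial.map (iterateFrobenius k p N) q} := by
  classical
  let m : (σ →₀ ℕ) → L := fun a => aeval ζ (monomial a (1 : k))
  obtain ⟨B, hB, hBspan, hli⟩ := exists_linearIndependent k (Set.range m)
  choose s hs using fun i : B => hB i.2
  have hr : ∀ a, ∃ r : B →₀ k, Finsupp.linearCombination k ((↑) : B → L) r = m a := by
    intro a
    refine Finsupp.mem_span_range_iff_exists_finsupp.1 ?_
    rw [Subtype.range_coe, hBspan]
    exact Submodule.subset_span ⟨a, rfl⟩
  choose r hr using hr
  have hmono : ∀ (a : σ →₀ ℕ) (c : k), monomial a c = c • monomial a (1 : k) := fun a c => by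
    rw [smul_monomial, smul_eq_mul, mul_one]
  have hpow : ∀ a : σ →₀ ℕ, aeval (fun i => ζ i ^ p ^ N) (monomial a (1 : k)) = m a ^ p ^ N := by
    intro a
    simp only [m, aeval_monomial, map_one, one_mul, Finsupp.prod, ← Finset.prod_pow]
    exact Finset.prod_congr rfl fun i _ => by rw [← pow_mul, ← pow_mul, mul_comm]
  let q : (σ →₀ ℕ) → MvPolynomial σ k := fun a =>
    monomial a 1 - (r a).sum fun j x => monomial (s j) x
  have hq : ∀ a, aeval ζ (q a) = 0 := by
    intro a
    have : aeval ζ ((r a).sum fun j x => monomial (s j) x) = m a := by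
      rw [← hr a, Finsupp.sum, map_sum, Finsupp.linearCombination_apply, Finsupp.sum]
      exact Finset.sum_congr rfl fun j _ => by rw [hmono, map_smul, ← hs j]
    simp only [q]
    rw [map_sub, this]
    exact sub_self _
  let φ : (B →₀ k) →ₗ[k] MvPolynomial σ k :=
    Finsupp.lsum k fun j => MvPolynomial.monomial (s j)
  let c : B →₀ k := ∑ a ∈ f.support, coeff a f •
    (r a).mapRange (iterateFrobenius k p N) (map_zero _)
  have h1 : f = ∑ a ∈ f.support, coeff a f • MvPolynomial.map (iterateFrobenius k p N) (q a) + φ c := by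
    have : ∀ a, φ ((r a).mapRange (iterateFrobenius k p N) (map_zero _)) =
        MvPolynomial.map (iterateFrobenius k p N) ((r a).sum fun j x => monomial (s j) x) := by
      intro a
      rw [Finsupp.lsum_apply, Finsupp.sum_mapRange_index (by simp), Finsupp.sum, Finsupp.sum,
        map_sum]
      exact Finset.sum_congr rfl fun j _ => by rw [map_monomial]
    rw [map_sum, ← Finset.sum_add_distrib]
    conv_lhs => rw [f.as_sum]
    refine Finset.sum_congr rfl fun a _ => ?_
    rw [map_smul, this, ← smul_add, ← map_add, sub_add_cancel, map_monomial, map_one, ← hmono]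
  have h2 : c = 0 := by
    have hpw := h.linearIndependent_pow_pow hli N
    rw [linearIndependent_iff] at hpw
    apply hpw
    have h3 := hf
    have hqw : ∀ a, aeval (fun i => ζ i ^ p ^ N) (MvPolynomial.map (iterateFrobenius k p N) (q a)) =
        0 := by
      intro a
      rw [aeval_pow_map_iterateFrobenius, hq, zero_pow (pow_ne_zero _ (Fact.out : p.Prime).ne_zero)]
    rw [h1, map_add, map_sum, Finset.sum_eq_zero fun a _ => by rw [map_smul, hqw, smul_zero],
      zero_add] at h3
    rw [← h3, Finsupp.linearCombination_apply, Finsupp.lsum_apply, Finsupp.sum, Finsupp.sum, map_sum]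
    refine Finset.sum_congr rfl fun j _ => ?_
    rw [hmono, map_smul, hpow, hs]
  rw [h2, map_zero, add_zero] at h1
  rw [h1]
  exact Submodule.sum_mem _ fun a _ => Submodule.smul_mem _ _ (Submodule.subset_span ⟨q a, hq a, rfl⟩)

theorem stable_iterateFrobenius_defIdeal (h : PSep p k L) (n N : ℕ) (ζ : σ → L) :
    Stable (iterateFrobenius L p N).fieldRange (defIdeal k n fun i => ζ i ^ p ^ N) := by
  have h1 : defIdeal k n (fun i => ζ i ^ p ^ N) =
      Ideal.span {P | ∃ q : MvPolynomial σ k, aeval ζ q = 0 ∧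
        aeval (fun i => C (ζ i ^ p ^ N) + X i) (MvPolynomial.map (iterateFrobenius k p N) q) = P} ⊔
      idealOfVars σ L ^ (n + 1) := by
    apply le_antisymm
    · refine sup_le_sup_right ?_ _
      rw [Ideal.span_le]
      rintro _ ⟨f, hf, rfl⟩
      have hf' := mem_span_map_iterateFrobenius h N ζ hf
      clear hf
      induction hf' using Submodule.span_induction with
      | mem f hf =>
        obtain ⟨q, hq, rfl⟩ := hf
        exact Ideal.subset_span ⟨q, hq, rfl⟩
      | zero => rw [map_zero]; exact zero_mem _
      | add x y _ _ hx hy => rw [map_add]; exact add_mem hx hy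
      | smul a x _ hx =>
        rw [map_smul, Algebra.smul_def]
        exact Ideal.mul_mem_left _ _ hx
    · refine sup_le_sup_right (Ideal.span_mono ?_) _
      rintro _ ⟨q, hq, rfl⟩
      refine ⟨_, ?_, rfl⟩
      rw [aeval_pow_map_iterateFrobenius, hq, zero_pow (pow_ne_zero _ (Fact.out : p.Prime).ne_zero)]
  rw [h1]
  refine Stable.sup (Stable.span ?_) (Stable.idealOfVars_pow _)
  rintro _ ⟨q, -, rfl⟩
  let F := (iterateFrobenius L p N).fieldRange
  refine ⟨MvPolynomial.eval₂Hom (C.comp ((iterateFrobenius L p N).rangeRestrictField.comp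
    (algebraMap k L))) (fun i => C (⟨ζ i ^ p ^ N, ζ i, rfl⟩ : F) + X i) q, ?_⟩
  induction q using MvPolynomial.induction_on with
  | C a =>
    simp only [eval₂Hom_C, RingHom.comp_apply, map_C, aeval_C]
    rw [MvPolynomial.algebraMap_apply]
    congr 1
    exact (iterateFrobenius_def p N (algebraMap k L a)).trans (by
      rw [iterateFrobenius_def, map_pow])
  | add P Q hP hQ => rw [map_add, map_add, map_add, map_add, hP, hQ]
  | mul_X P i hP =>
    rw [map_mul, map_mul, map_mul, map_mul, hP, map_X, aeval_X, eval₂Hom_X', map_add, map_C, map_X]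
    rfl

end FieldOfDefinition

section LemmaJ

variable {p : ℕ} [Fact p.Prime] {K : Type*} [Field K] [CharP K p] {k : Type*}
  [Field k] [CharP k p] {L : Type*} [Field L] [CharP L p] [Algebra K k] [Algebra K L]
  [Algebra k L] [IsScalarTower K k L] {d D : ℕ} {c : ℕ → K} {g : ℕ} {ζ : ℕ → Fin g → L}

/-- Infinitesimal neighbourhoods of an infinitely `φ`-divisible point are defined over `k`. -/
theorem stable_defIdeal {Ω : Type*} [Field Ω] [CharP Ω p] [IsAlgClosed Ω] [Algebra L Ω]
    [Algebra K Ω] [IsScalarTower K L Ω] (hd : 1 ≤ d) (hdD : d < D) (hcd : c d ≠ 0) (hcD : c D ≠ 0)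
    {n₀ : ℕ} (htor : ∀ z : Ω, IsSeparable L z → ∀ n : ℕ,
      (specialTphi p d D fun i => algebraMap K Ω (c i))^[n] z = 0 →
      (specialTphi p d D fun i => algebraMap K Ω (c i))^[n₀] z = 0)
    (hζ : ∀ m i, specialTphi p d D (fun i => algebraMap K L (c i)) (ζ (m + 1) i) = ζ m i)
    (hsep : PSep p k L) (hclosed : ∀ x : L, IsAlgebraic k x → x ∈ (⊥ : IntermediateField k L))
    (n : ℕ) : Stable k (defIdeal k n (ζ 0)) := by
  have hsurj : ∀ u : Fin g → L, Function.Surjective (MvPolynomial.aeval (R := L) fun i =>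
      Ideal.Quotient.mk (defIdeal k n u) (MvPolynomial.X i)) := fun u y => by
    obtain ⟨P, rfl⟩ := Ideal.Quotient.mk_surjective y
    exact ⟨P, aeval_mk_eq k n u P⟩
  have hdef := fun u => exists_field_of_definition (k := k) (hsurj u)
  simp only [ker_aeval_mk] at hdef
  obtain ⟨T, hT, -⟩ := hdef (ζ 0)
  have hE : IntermediateField.adjoin k T ≤ IntermediateField.adjoin k (Set.range (ζ 0)) :=
    (hT _).1 (stable_adjoin_defIdeal n (ζ 0))
  have hdeep : DeepGen p (IntermediateField.adjoin k T) := by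
    intro N
    obtain ⟨ψ, hψ, ⟨e, he, hψe⟩, -, hψφ⟩ := exists_separable_part (p := p) hdD.le hcd hcD N
    obtain ⟨T', hT', hT'q⟩ := hdef fun i => ζ N i ^ p ^ (d * N)
    refine ⟨T', fun x hx => ?_, ?_⟩
    · obtain ⟨y, rfl⟩ := hT'q _ (stable_iterateFrobenius_defIdeal hsep n (d * N) (ζ N)) hx
      have : N ≤ d * N := Nat.le_mul_of_pos_left N hd
      refine ⟨y ^ p ^ (d * N - N), ?_⟩
      rw [iterateFrobenius_def, ← pow_mul, ← pow_add, Nat.sub_add_cancel this]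
    · have hw : ∀ i, Polynomial.aeval (ζ N i ^ p ^ (d * N)) (ψ.map (algebraMap K k)) = ζ 0 i := by
        intro i
        rw [Polynomial.aeval_map_algebraMap, ← hψφ]
        simpa using tower_iterate hζ 0 N i
      have hψe' : Polynomial.derivative (ψ.map (algebraMap K k)) =
          Polynomial.C (algebraMap K k e) := by
        rw [Polynomial.derivative_map, hψe, Polynomial.map_C]
      have key := fun F => stable_defIdeal_iff (map_mem_additivePolys (algebraMap K k) hψ)
        ((map_ne_zero (algebraMap K k)).2 he) hψe' hw n F
      exact le_antisymm ((hT' _).1 ((key _).1 ((hT _).2 le_rfl)))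
        ((hT _).1 ((key _).2 ((hT' _).2 le_rfl)))
  have hbot := deepGen_eq_bot hd hdD hcd hcD htor hζ hsep hclosed hE hdeep
  have hst := (hT ⊥).2 hbot.le
  intro f P hP
  refine hst { f.toAddMonoidHom with map_smul' := ?_ } P hP
  rintro ⟨x, hx⟩ y
  obtain ⟨x, rfl⟩ := IntermediateField.mem_bot.1 hx
  change f (algebraMap k L x * y) = algebraMap k L x * f y
  rw [← Algebra.smul_def, map_smul, Algebra.smul_def]

end LemmaJ

end SpecialDrinfeld

namespace SpecialDrinfeld

open MvPolynomial Filter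

section Generic

variable {σ k L : Type*} [Field k] [Field L] [Algebra k L]

theorem eval_coeffMap_eq_zero {M : Type*} [CommRing M] [Algebra k M] {y : σ → M}
    {P : MvPolynomial σ L}
    (h : ∀ l : L →ₗ[k] k, aeval y (coeffMap l.toAddMonoidHom P) = 0) (χ : L →ₗ[k] M) :
    eval y (coeffMap χ.toAddMonoidHom P) = 0 := by
  classical
  let b := Module.Basis.ofVectorSpace k L
  let t := P.support.biUnion fun a => (b.repr (coeff a P)).support
  have h1 : ∀ l : L →ₗ[k] k, aeval y (coeffMap l.toAddMonoidHom P) =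
      ∑ a ∈ P.support, algebraMap k M (l (coeff a P)) * a.prod fun i n => y i ^ n := by
    intro l
    change aeval y (∑ a ∈ P.support, monomial a (l (coeff a P))) = _
    rw [map_sum]
    exact Finset.sum_congr rfl fun a _ => by rw [aeval_monomial]
  have h2 : eval y (coeffMap χ.toAddMonoidHom P) =
      ∑ a ∈ P.support, χ (coeff a P) * a.prod fun i n => y i ^ n := by
    change eval y (∑ a ∈ P.support, monomial a (χ (coeff a P))) = _
    rw [map_sum]
    exact Finset.sum_congr rfl fun a _ => by rw [eval_monomial]
  have h3 : ∀ a ∈ P.support, χ (coeff a P) =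
      ∑ i ∈ t, χ (b i) * algebraMap k M (b.coord i (coeff a P)) := by
    intro a ha
    conv_lhs => rw [← b.linearCombination_repr (coeff a P), Finsupp.linearCombination_apply,
      Finsupp.sum_of_support_subset (s := t) _
        (Finset.subset_biUnion_of_mem (fun a => (b.repr (coeff a P)).support) ha) _ (by simp),
      map_sum]
    refine Finset.sum_congr rfl fun i _ => ?_
    rw [map_smul, Algebra.smul_def, mul_comm, Module.Basis.coord_apply]
  rw [h2, Finset.sum_congr rfl fun a ha => by rw [h3 a ha, Finset.sum_mul], Finset.sum_comm]
  refine Finset.sum_eq_zero fun i _ => ?_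
  simp only [mul_assoc]
  rw [← Finset.mul_sum, ← h1, h, mul_zero]

theorem exists_linearMap_of_aeval_eq_zero {M : Type*} [CommRing M] [Algebra k M] {η : σ → L}
    {x : σ → M} (hx : ∀ f : MvPolynomial σ k, aeval η f = 0 → aeval x f = 0) :
    ∃ χ : L →ₗ[k] M, ∀ f : MvPolynomial σ k, χ (aeval η f) = aeval x f := by
  let φ : MvPolynomial σ k →ₗ[k] L := (aeval η).toLinearMap
  obtain ⟨g₀, hg₀⟩ := φ.rangeRestrict.exists_rightInverse_of_surjective φ.range_rangeRestrict
  obtain ⟨g, hg⟩ := g₀.exists_extend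
  refine ⟨(aeval x).toLinearMap.comp g, fun f => ?_⟩
  have h1 : φ (g (φ f)) = φ f := by
    have h2 : g (φ f) = g₀ ⟨φ f, f, rfl⟩ := LinearMap.congr_fun hg ⟨φ f, f, rfl⟩
    rw [h2]
    exact congrArg Subtype.val (LinearMap.congr_fun hg₀ ⟨φ f, f, rfl⟩)
  have h2 := hx (g (φ f) - f) (by
    rw [map_sub, sub_eq_zero]
    exact h1)
  rw [map_sub, sub_eq_zero] at h2
  exact h2

/-- The equations over `k` of the formal completion at `η` of its Zariski closure. -/
noncomputable def formalIdeal (k : Type*) {σ L : Type*} [Field k] [Field L] [Algebra k L]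
    (η : σ → L) : Ideal (MvPolynomial σ k) :=
  ⨅ n, (defIdeal k n η).comap (MvPolynomial.map (algebraMap k L))

theorem mem_formalIdeal {η : σ → L} {f : MvPolynomial σ k} :
    f ∈ formalIdeal k η ↔ ∀ n, MvPolynomial.map (algebraMap k L) f ∈ defIdeal k n η := by
  simp [formalIdeal]

/-- If the infinitesimal neighbourhoods of `η` are defined over `k`, the formal germ at `η`
translates the Zariski closure into itself. -/
theorem aeval_add_eq_zero_of_stable {M : Type*} [CommRing M] [Algebra k M] {η : σ → L}
    (hst : ∀ n, Stable k (defIdeal k n η)) {f : MvPolynomial σ k} (hf : aeval η f = 0) {x y : σ → M}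
    (hx : ∀ f : MvPolynomial σ k, aeval η f = 0 → aeval x f = 0)
    (hy : ∀ f ∈ formalIdeal k η, aeval y f = 0) : aeval (fun i => x i + y i) f = 0 := by
  obtain ⟨χ, hχ⟩ := exists_linearMap_of_aeval_eq_zero hx
  let F : MvPolynomial σ (MvPolynomial σ k) := aeval (fun i => C (X i) + X i) f
  let P : MvPolynomial σ L := aeval (fun i => C (η i) + X i) f
  have hP : P = MvPolynomial.map (aeval η : MvPolynomial σ k →ₐ[k] L).toRingHom F := by
    have := comp_aeval_apply (fun i => C (X i) + X i)
      ((MvPolynomial.mapAlgHom (σ := σ) (aeval η : MvPolynomial σ k →ₐ[k] L)).restrictScalars k) f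
    refine Eq.trans ?_ this.symm
    simp only [P]
    congr 2
    funext i
    simp
  have h1 : eval y (coeffMap χ.toAddMonoidHom P) = 0 := by
    refine eval_coeffMap_eq_zero (fun l => hy _ (mem_formalIdeal.2 fun n => ?_)) χ
    have h2 := hst n ((Algebra.linearMap k L).comp l) P
      (Ideal.mem_sup_left (Ideal.subset_span ⟨f, hf, rfl⟩))
    convert h2 using 1
    ext a
    rw [coeff_map, coeff_coeffMap, coeff_coeffMap]
    rfl
  have h2 : coeffMap χ.toAddMonoidHom P =
      MvPolynomial.map (aeval x : MvPolynomial σ k →ₐ[k] M).toRingHom F := by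
    ext a
    rw [coeff_coeffMap, hP, coeff_map, coeff_map]
    exact hχ _
  rw [h2] at h1
  rw [← h1]
  let Φ : MvPolynomial σ (MvPolynomial σ k) →ₐ[k] M :=
    { (eval y).comp (MvPolynomial.map (aeval x : MvPolynomial σ k →ₐ[k] M).toRingHom) with
      commutes' := fun c => by
        rw [MvPolynomial.algebraMap_apply]
        simp [MvPolynomial.algebraMap_eq] }
  have := comp_aeval_apply (fun i => C (X i) + X i) Φ f
  refine Eq.trans ?_ this.symm
  congr 2
  funext i
  simp [Φ]

variable {g : ℕ}

theorem eventually_eval_ne_zero {U : Ultrafilter ℕ} {η : Fin g → L} {s : ℕ → Fin g → k}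
    (hs : ∀ f : MvPolynomial (Fin g) k, aeval η f = 0 ↔ ∀ᶠ n in U, aeval (s n) f = 0)
    {u : MvPolynomial (Fin g) L} (hu : eval (fun _ => 0) u ≠ 0) :
    ∀ᶠ n in U, eval (fun i => algebraMap k L (s n i) - η i) u ≠ 0 := by
  rw [Ultrafilter.eventually_not]
  intro hev
  apply hu
  let t : MvPolynomial (Fin g) L := aeval (fun i => X i - C (η i)) u
  have ht : ∀ z : Fin g → L, eval z t = eval (fun i => z i - η i) u := by
    intro z
    have := comp_aeval_apply (fun i => X i - C (η i)) (aeval (R := L) z) u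
    refine this.trans ?_
    rw [aeval_eq_eval]
    simp
  have h1 : eval η (coeffMap (LinearMap.id : L →ₗ[k] L).toAddMonoidHom t) = 0 := by
    refine eval_coeffMap_eq_zero (fun l => (hs _).2 ?_) _
    filter_upwards [hev] with n hn
    rw [← ht] at hn
    have : ∀ t : MvPolynomial (Fin g) L, aeval (s n) (coeffMap l.toAddMonoidHom t) =
        l (eval (fun i => algebraMap k L (s n i)) t) := by
      intro t
      induction t using MvPolynomial.induction_on' with
      | monomial a c =>
        rw [coeffMap_monomial, aeval_monomial, eval_monomial, Algebra.algebraMap_self_apply]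
        have : (a.prod fun i n' => algebraMap k L (s n i) ^ n') =
            algebraMap k L (a.prod fun i n' => s n i ^ n') := by
          simp [Finsupp.prod]
        rw [this, mul_comm c, ← Algebra.smul_def, map_smul, smul_eq_mul, mul_comm]
        rfl
      | add P Q hP hQ => rw [map_add, map_add, map_add, hP, hQ, map_add]
    rw [this, hn, map_zero]
  have h2 : coeffMap (LinearMap.id : L →ₗ[k] L).toAddMonoidHom t = t := by
    ext a
    rw [coeff_coeffMap]
    rfl
  rw [h2, ht] at h1
  simpa using h1

theorem exists_mul_mem_of_mem_formalIdeal {η : Fin g → L} {f : MvPolynomial (Fin g) k}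
    (hf : f ∈ formalIdeal k η) : ∃ u : MvPolynomial (Fin g) L, eval (fun _ => 0) u ≠ 0 ∧
      u * MvPolynomial.map (algebraMap k L) f ∈ Ideal.span {P | ∃ f : MvPolynomial (Fin g) k,
        aeval η f = 0 ∧ aeval (fun i => C (η i) + X i) f = P} := by
  set I' := Ideal.span {P | ∃ f : MvPolynomial (Fin g) k,
        aeval η f = 0 ∧ aeval (fun i => C (η i) + X i) f = P} with hI'
  have h1 : Ideal.Quotient.mk I' (MvPolynomial.map (algebraMap k L) f) ∈
      (⨅ i : ℕ, idealOfVars (Fin g) L ^ i • (⊤ : Submodule (MvPolynomial (Fin g) L)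
        (MvPolynomial (Fin g) L ⧸ I'))) := by
    rw [Submodule.mem_iInf]
    intro n
    obtain ⟨P, hP, Q, hQ, hPQ⟩ := Submodule.mem_sup.1 (mem_formalIdeal.1 hf n)
    rw [← hPQ, map_add, Ideal.Quotient.eq_zero_iff_mem.2 hP, zero_add]
    have : Ideal.Quotient.mk I' Q = Q • (1 : MvPolynomial (Fin g) L ⧸ I') :=
      congrArg (Ideal.Quotient.mk I') (mul_one Q).symm
    rw [this]
    exact Submodule.smul_mem_smul (Ideal.pow_le_pow_right (Nat.le_succ n) hQ) trivial
  obtain ⟨⟨r, hr⟩, hrx⟩ := (Ideal.mem_iInf_smul_pow_eq_bot_iff _ _).1 h1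
  refine ⟨1 - r, ?_, ?_⟩
  · have : idealOfVars (Fin g) L ≤ RingHom.ker (eval fun _ => (0 : L)) := by
      rw [idealOfVars, Ideal.span_le]
      rintro _ ⟨i, rfl⟩
      simp
    have hr0 : eval (fun _ => (0 : L)) r = 0 := this hr
    rw [map_sub, map_one, hr0, sub_zero]
    exact one_ne_zero
  · rw [sub_mul, one_mul, ← Ideal.Quotient.mk_eq_mk_iff_sub_mem, ← hrx]
    simp only [map_mul]
    rfl

theorem eventually_aeval_formalIdeal {U : Ultrafilter ℕ} {η : Fin g → L} {s : ℕ → Fin g → k}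
    (hs : ∀ f : MvPolynomial (Fin g) k, aeval η f = 0 ↔ ∀ᶠ n in U, aeval (s n) f = 0) :
    ∀ᶠ n in U, ∀ f ∈ formalIdeal k η, aeval (fun i => algebraMap k L (s n i) - η i) f = 0 := by
  have fin : ∀ (J : Ideal (MvPolynomial (Fin g) k)) (y : ℕ → Fin g → L),
      (∀ f ∈ J, ∀ᶠ n in U, aeval (y n) f = 0) → ∀ᶠ n in U, ∀ f ∈ J, aeval (y n) f = 0 := by
    intro J y h
    obtain ⟨S, hS⟩ := (isNoetherian_def.1 inferInstance : ∀ J : Ideal (MvPolynomial (Fin g) k), J.FG) J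
    have : ∀ᶠ n in U, ∀ f ∈ S, aeval (y n) f = 0 :=
      (Filter.eventually_all_finset S).2 fun f hf => h f (hS ▸ Submodule.subset_span hf)
    filter_upwards [this] with n hn
    have : J ≤ RingHom.ker (aeval (R := k) (y n)) := by
      rw [← hS]
      exact Submodule.span_le.2 hn
    exact fun f hf => this hf
  have hI : ∀ᶠ n in U, ∀ f ∈ RingHom.ker (aeval (R := k) η),
      aeval (fun i => algebraMap k L (s n i)) f = 0 := by
    refine fin _ _ fun f hf => ?_
    filter_upwards [(hs f).1 hf] with n hn
    have := aeval_algebraMap_apply L (s n) f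
    rw [hn, map_zero] at this
    exact this
  refine fin _ _ fun f hf => ?_
  obtain ⟨u, hu, hmem⟩ := exists_mul_mem_of_mem_formalIdeal hf
  filter_upwards [hI, eventually_eval_ne_zero hs hu] with n hn hun
  have h1 : Ideal.span {P | ∃ f : MvPolynomial (Fin g) k,
      aeval η f = 0 ∧ aeval (fun i => C (η i) + X i) f = P} ≤
      RingHom.ker (eval fun i => algebraMap k L (s n i) - η i) := by
    rw [Ideal.span_le]
    rintro _ ⟨f, hf, rfl⟩
    have h2 := comp_aeval_apply (fun i => C (η i) + X i)
      ((aeval (R := L) fun i => algebraMap k L (s n i) - η i).restrictScalars k) f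
    have h3 := hn f hf
    rw [SetLike.mem_coe, RingHom.mem_ker]
    refine Eq.trans ?_ (h2.trans ?_)
    · rw [AlgHom.restrictScalars_apply, aeval_eq_eval]
    · rw [← h3]
      congr 2
      funext i
      simp
  have h2 := h1 hmem
  rw [RingHom.mem_ker, map_mul] at h2
  have h3 := (mul_eq_zero.1 h2).resolve_left hun
  rw [eval_map] at h3
  exact h3

end Generic

section Subgroup

variable {p : ℕ} [Fact p.Prime] {g : ℕ}

/-- The translations preserving a Zariski-closed set form a Zariski-closed subgroup. -/
theorem exists_translation_subgroup {Ω : Type*} [Field Ω] [CharP Ω p]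
    (J : Ideal (MvPolynomial (Fin g) Ω)) :
    ∃ H : AddSubgroup (Fin g → Ω),
      (∃ J' : Ideal (MvPolynomial (Fin g) Ω), (H : Set (Fin g → Ω)) =
        zeroLocusVia J' (RingHom.id Ω)) ∧
      ∀ h, h ∈ H ↔ ∀ x ∈ zeroLocusVia J (RingHom.id Ω), x + h ∈ zeroLocusVia J (RingHom.id Ω) := by
  let V := zeroLocusVia J (RingHom.id Ω)
  let N : AddSubmonoid (Fin g → Ω) :=
    { carrier := {h | ∀ x ∈ V, x + h ∈ V}
      zero_mem' := fun x hx => by simpa using hx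
      add_mem' := fun {a b} ha hb x hx => by
        rw [← add_assoc]
        exact hb _ (ha x hx) }
  refine ⟨{ N with neg_mem' := fun {h} hh => ?_ }, ⟨Ideal.span {P | ∃ x ∈ V, ∃ q ∈ J,
    P = aeval (fun i => C (x i) + X i) q}, ?_⟩, fun h => Iff.rfl⟩
  · have h1 : -h = (p - 1) • h := by
      rw [neg_eq_iff_add_eq_zero, ← succ_nsmul', Nat.sub_add_cancel (Fact.out : p.Prime).one_le]
      funext i
      simp
    change -h ∈ N
    rw [h1]
    exact N.nsmul_mem hh _
  · ext h
    have key : ∀ (x : Fin g → Ω) (q : MvPolynomial (Fin g) Ω),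
        eval₂ (RingHom.id Ω) h (aeval (fun i => C (x i) + X i) q) =
          eval₂ (RingHom.id Ω) (x + h) q := by
      intro x q
      refine (comp_aeval_apply (fun i => C (x i) + X i) (aeval (R := Ω) h) q).trans ?_
      rw [aeval_def]
      congr 1
      funext i
      simp
    constructor
    · intro hh
      have : Ideal.span {P | ∃ x ∈ V, ∃ q ∈ J, P = aeval (fun i => C (x i) + X i) q} ≤
          RingHom.ker (eval₂Hom (RingHom.id Ω) h) := by
        rw [Ideal.span_le]
        rintro _ ⟨x, hx, q, hq, rfl⟩
        exact (key x q).trans (hh x hx q hq)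
      exact fun q hq => this hq
    · intro hh x hx q hq
      rw [← key]
      exact hh _ (Ideal.subset_span ⟨x, hx, q, hq, rfl⟩)

end Subgroup

section Ultrapower

variable {k L : Type*} [Field k] [Field L] [Algebra k L] {mk : (ℕ → k) →+* L}

theorem aeval_mk_ultrapower (halg : ∀ c, algebraMap k L c = mk fun _ => c) {σ : Type*}
    (s : ℕ → σ → k) (f : MvPolynomial σ k) :
    aeval (fun i => mk fun n => s n i) f = mk fun n => aeval (s n) f := by
  induction f using MvPolynomial.induction_on with
  | C a => simp [halg]
  | add P Q hP hQ =>
    simp only [map_add, hP, hQ]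
    exact (map_add mk _ _).symm
  | mul_X P i hP =>
    simp only [map_mul, hP, aeval_X]
    exact (map_mul mk _ _).symm

theorem mem_bot_of_isAlgebraic_ultrapower (hmk : Function.Surjective mk)
    (hmk0 : ∀ x, mk x = 0 ↔ ∀ᶠ n in hyperfilter ℕ, x n = 0)
    (halg : ∀ c, algebraMap k L c = mk fun _ => c) {x : L} (hx : IsAlgebraic k x) :
    x ∈ (⊥ : IntermediateField k L) := by
  classical
  obtain ⟨r, rfl⟩ := hmk x
  obtain ⟨f, hf, hfx⟩ := hx
  have h1 : Polynomial.aeval (mk r) f = mk fun n => Polynomial.eval (r n) f := by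
    clear hf hfx
    induction f using Polynomial.induction_on' with
    | add P Q hP hQ =>
      simp only [map_add, hP, hQ, Polynomial.eval_add]
      exact (map_add mk _ _).symm
    | monomial m a =>
      rw [Polynomial.aeval_monomial, halg, ← map_pow, ← map_mul]
      simp only [Polynomial.eval_monomial]
      rfl
  rw [h1, hmk0] at hfx
  have h2 : ∀ᶠ n in hyperfilter ℕ, ∃ c ∈ (f.roots.toFinset : Set k), r n = c := by
    filter_upwards [hfx] with n hn
    exact ⟨r n, by simpa [hf] using hn, rfl⟩
  rw [Ultrafilter.eventually_exists_mem_iff (Finset.finite_toSet _)] at h2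
  obtain ⟨c, -, hc⟩ := h2
  rw [IntermediateField.mem_bot]
  refine ⟨c, ?_⟩
  rw [halg, ← sub_eq_zero, ← map_sub, hmk0]
  filter_upwards [hc] with n hn
  simp [hn]

end Ultrapower

section CompatibleSystem

theorem specialTphi_iterate_mk {ι : Type*} {L : ι → Type*} [∀ n, Field (L n)] {M : Type*} [Field M]
    (mk : (∀ n, L n) →+* M) (p d D : ℕ) (c : ∀ n, ℕ → L n) (m : ℕ) (r : ∀ n, L n) :
    (specialTphi p d D fun i => mk fun n => c n i)^[m] (mk r) =
      mk fun n => (specialTphi p d D (c n))^[m] (r n) := by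
  induction m generalizing r with
  | zero => rfl
  | succ m ih =>
    have h : specialTphi p d D (fun i => mk fun n => c n i) (mk r) =
        mk fun n => specialTphi p d D (c n) (r n) := by
      simp only [specialTphi, ← map_pow, ← map_mul, ← map_sum]
      congr 1
      funext n
      simp
    simp only [Function.iterate_succ_apply, h, ih]

theorem exists_compatible_system {p : ℕ} [Fact p.Prime] {L : Type*} [Field L] [CharP L p] {g : ℕ}
    {d D : ℕ} {c : ℕ → L} {n₀ : ℕ}
    (htor : ∀ (z : L) (n : ℕ), (specialTphi p d D c)^[n] z = 0 → (specialTphi p d D c)^[n₀] z = 0)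
    {η : Fin g → L} (hη : ∀ m, ∃ z : Fin g → L, ∀ i, (specialTphi p d D c)^[m] (z i) = η i) :
    ∃ ζ : ℕ → Fin g → L, ζ 0 = η ∧ ∀ m i, specialTphi p d D c (ζ (m + 1) i) = ζ m i := by
  choose z hz using hη
  refine ⟨fun m i => (specialTphi p d D c)^[n₀] (z (m + n₀) i), ?_, fun m i => ?_⟩
  · funext i
    simpa using hz (0 + n₀) i
  · have h := htor (specialTphi p d D c (z (m + 1 + n₀) i) - z (m + n₀) i) (m + n₀) (by
      rw [specialTphi_iterate_sub, hz, ← Function.iterate_succ_apply, sub_eq_zero,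
        show (m + n₀).succ = m + 1 + n₀ by omega, hz])
    rw [specialTphi_iterate_sub, sub_eq_zero] at h
    exact ((Function.iterate_succ_apply' _ _ _).symm.trans
      (Function.iterate_succ_apply _ _ _)).trans h

end CompatibleSystem

section Main

variable {p : ℕ} [Fact p.Prime] {K : Type u} [Field K] [CharP K p] {k : Type v} [Field k]
  [CharP k p] [Algebra K k] {d D : ℕ} {c : ℕ → K} {g : ℕ}

theorem exists_infinite_subgroup (hd : 1 ≤ d) (hdD : d < D) (hcd : c d ≠ 0) (hcD : c D ≠ 0)
    {n₀ : ℕ} (htor : ∀ {M : Type v} [Field M] [CharP M p] [Algebra K M], PSep p K M →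
      ∀ (z : M) (n : ℕ), (specialTphi p d D fun i => algebraMap K M (c i))^[n] z = 0 →
      (specialTphi p d D fun i => algebraMap K M (c i))^[n₀] z = 0)
    (hKk : PSep p K k) (I : Ideal (MvPolynomial (Fin g) K)) (a : Fin g → k) {s : ℕ → Fin g → k}
    (hs : Function.Injective s)
    (hdiv : ∀ n m, ∃ z : Fin g → k, ∀ i,
      (specialTphi p d D fun i => algebraMap K k (c i))^[m] (z i) = s n i)
    (hsI : ∀ n, ∃ x ∈ zeroLocusVia I (algebraMap K k), s n = a + x) :
    ∃ (Ω : Type v) (_ : Field Ω) (_ : CharP Ω p) (_ : IsAlgClosed Ω) (_ : Algebra K Ω)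
      (b : Fin g → Ω) (H : AddSubgroup (Fin g → Ω)), (H : Set (Fin g → Ω)).Infinite ∧
      (∃ J : Ideal (MvPolynomial (Fin g) Ω), (H : Set (Fin g → Ω)) =
        zeroLocusVia J (RingHom.id Ω)) ∧
      ∀ h ∈ H, b + h ∈ zeroLocusVia I (algebraMap K Ω) := by
  obtain ⟨L, _, mk, hmk, hmk0⟩ := exists_ultraproduct fun _ : ℕ => k
  let _ : Algebra k L := (mk.comp (Pi.constRingHom ℕ k)).toAlgebra
  let _ : Algebra K L := ((algebraMap k L).comp (algebraMap K k)).toAlgebra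
  have : IsScalarTower K k L := IsScalarTower.of_algebraMap_eq fun _ => rfl
  have : CharP L p := charP_of_injective_algebraMap (algebraMap k L).injective p
  have halg : ∀ c, algebraMap k L c = mk fun _ => c := fun _ => rfl
  have hKL : PSep p K L := PSep.ultraproduct (fun _ => hKk) mk hmk hmk0 fun _ => rfl
  have hkL : PSep p k L := PSep.ultraproduct (fun _ => PSep.self k) mk hmk hmk0 fun _ => rfl
  let Ω := AlgebraicClosure L
  have : CharP Ω p := charP_of_injective_algebraMap (algebraMap L Ω).injective p
  let η : Fin g → L := fun i => mk fun n => s n i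
  have hη : ∀ f : MvPolynomial (Fin g) k, aeval η f = 0 ↔
      ∀ᶠ n in hyperfilter ℕ, aeval (s n) f = 0 := fun f => by
    rw [aeval_mk_ultrapower halg, hmk0]
  obtain ⟨ζ, hζ0, hζ⟩ := exists_compatible_system (η := η) (fun z n => htor hKL z n) fun m => by
    choose z hz using fun n => hdiv n m
    refine ⟨fun i => mk fun n => z n i, fun i => ?_⟩
    refine (specialTphi_iterate_mk mk p d D (fun _ i => algebraMap K k (c i)) m _).trans ?_
    simp only [hz, η]
  have hst : ∀ n, Stable k (defIdeal k n η) := by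
    rw [← hζ0]
    refine stable_defIdeal (Ω := Ω) hd hdD hcd hcD (n₀ := n₀) (fun z hz n h => ?_) hζ hkL
      fun x hx => mem_bot_of_isAlgebraic_ultrapower hmk hmk0 halg hx
    let E := IntermediateField.adjoin L {z}
    have : CharP E p := charP_of_injective_algebraMap (algebraMap L E).injective p
    have : Algebra.IsSeparable L E :=
      (IntermediateField.isSeparable_adjoin_simple_iff_isSeparable L Ω).2 hz
    have hKE : PSep p K E := hKL.trans_separable
    have hmap : ∀ n, (specialTphi p d D fun i => algebraMap K Ω (c i))^[n] z = algebraMap E Ω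
        ((specialTphi p d D fun i => algebraMap K E (c i))^[n]
          ⟨z, IntermediateField.mem_adjoin_simple_self L z⟩) := fun n =>
      specialTphi_iterate_map (p := p) d D (fun i => algebraMap K E (c i)) (algebraMap E Ω) n
        ⟨z, IntermediateField.mem_adjoin_simple_self L z⟩
    have h1 := htor hKE ⟨z, IntermediateField.mem_adjoin_simple_self L z⟩ n
      ((algebraMap E Ω).injective (by rw [← hmap, map_zero]; exact h))
    exact (hmap n₀).trans (by rw [h1, map_zero])
  let J : Ideal (MvPolynomial (Fin g) Ω) :=
    (RingHom.ker (aeval (R := k) η)).map (MvPolynomial.map (algebraMap k Ω))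
  have hJ : ∀ x, x ∈ zeroLocusVia J (RingHom.id Ω) ↔
      ∀ f : MvPolynomial (Fin g) k, aeval η f = 0 → aeval x f = 0 := by
    intro x
    constructor
    · intro hx f hf
      have := hx _ (Ideal.mem_map_of_mem _ hf)
      rwa [eval₂_map] at this
    · intro hx
      have : J ≤ RingHom.ker (eval₂Hom (RingHom.id Ω) x) := by
        rw [Ideal.map_le_iff_le_comap]
        intro f hf
        have := hx f hf
        rw [Ideal.mem_comap, RingHom.mem_ker, coe_eval₂Hom, eval₂_map]
        exact this
      exact fun q hq => this hq
  obtain ⟨H, hHc, hH⟩ := exists_translation_subgroup (p := p) J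
  refine ⟨Ω, inferInstance, inferInstance, inferInstance, inferInstance,
    fun i => algebraMap L Ω (η i - algebraMap k L (a i)), H, ?_, hHc, fun h hh => ?_⟩
  · have hev := eventually_aeval_formalIdeal hη
    have hinf : {n | ∀ f ∈ formalIdeal k η,
        aeval (fun i => algebraMap k L (s n i) - η i) f = 0}.Infinite := by
      intro hfin
      exact Ultrafilter.compl_notMem_iff.2 hev hfin.compl_mem_hyperfilter
    refine (hinf.image (f := fun n i => algebraMap L Ω (algebraMap k L (s n i) - η i)) ?_).mono ?_
    · intro n _ n' _ hnn
      apply hs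
      funext i
      simpa using congrFun hnn i
    · rintro _ ⟨n, hn, rfl⟩
      refine (hH _).2 fun x hx => (hJ _).2 fun f hf => ?_
      refine aeval_add_eq_zero_of_stable hst hf ((hJ _).1 hx) fun f hf => ?_
      have := aeval_algebraMap_apply Ω (fun i => algebraMap k L (s n i) - η i) f
      rw [hn f hf, map_zero] at this
      exact this
  · have hηV : (fun i => algebraMap L Ω (η i)) ∈ zeroLocusVia J (RingHom.id Ω) :=
      (hJ _).2 fun f hf => by
        have := aeval_algebraMap_apply Ω η f
        rw [hf, map_zero] at this
        exact this
    have h1 := (hJ _).1 ((hH h).1 hh _ hηV)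
    intro q hq
    let f : MvPolynomial (Fin g) k := aeval (fun i => X i - C (a i)) q
    have hf : ∀ {M : Type v} [Field M] [Algebra k M] [Algebra K M] [IsScalarTower K k M]
        (x : Fin g → M), aeval x f = aeval (fun i => x i - algebraMap k M (a i)) q := by
      intro M _ _ _ _ x
      refine (comp_aeval_apply (fun i => X i - C (a i))
        ((aeval (R := k) x).restrictScalars K) q).trans ?_
      congr 2
      funext i
      simp
    have h2 := h1 f ((hη f).2 (Eventually.of_forall fun n => by
      obtain ⟨x, hx, hsx⟩ := hsI n
      rw [hf, hsx]
      refine Eq.trans ?_ (hx q hq)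
      rw [aeval_def]
      congr 1
      funext i
      simp))
    rw [hf] at h2
    rw [← h2, aeval_def]
    congr 1
    funext i
    simp [IsScalarTower.algebraMap_apply k L Ω]
    ring

end Main

end SpecialDrinfeld

namespace SpecialDrinfeld

open MvPolynomial

section Specialization

theorem nonempty_algHom_of_finiteType (F A M : Type*) [Field F] [CommRing A] [Nontrivial A]
    [Algebra F A] [Algebra.FiniteType F A] [Field M] [IsAlgClosed M] [Algebra F M] :
    Nonempty (A →ₐ[F] M) := by
  obtain ⟨m, hm⟩ := Ideal.exists_maximal A
  let _ := Ideal.Quotient.field m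
  have : Module.Finite F (A ⧸ m) := finite_of_finite_type_of_isJacobsonRing F (A ⧸ m)
  exact ⟨(IsAlgClosed.lift (R := F) (S := A ⧸ m) (M := M)).comp (Ideal.Quotient.mkₐ F m)⟩

theorem exists_ringHom_of_isIntegral {R S M : Type*} [CommRing R] [CommRing S] [Algebra R S]
    [Algebra.IsIntegral R S] [Field M] [IsAlgClosed M]
    (hinj : Function.Injective (algebraMap R S)) (ρ : R →+* M) :
    ∃ τ : S →+* M, ∀ r, τ (algebraMap R S r) = ρ r := by
  have : (RingHom.ker ρ).IsPrime := RingHom.ker_isPrime ρ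
  obtain ⟨Q, -, hQ, hQR⟩ := Ideal.exists_ideal_over_prime_of_isIntegral (RingHom.ker ρ)
    (⊥ : Ideal S) (by
      intro x hx
      have : algebraMap R S x = 0 := hx
      rw [(injective_iff_map_eq_zero _).1 hinj x this]
      exact zero_mem _)
  have : Q.LiesOver (RingHom.ker ρ) := ⟨hQR.symm⟩
  let _ : Algebra (R ⧸ RingHom.ker ρ) M := (RingHom.kerLift ρ).toAlgebra
  have : FaithfulSMul (R ⧸ RingHom.ker ρ) M :=
    (faithfulSMul_iff_algebraMap_injective _ _).2 (RingHom.kerLift_injective ρ)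
  have : Module.IsTorsionFree (R ⧸ RingHom.ker ρ) (S ⧸ Q) :=
    Module.isTorsionFree_iff_faithfulSMul.2 inferInstance
  let τ : (S ⧸ Q) →ₐ[R ⧸ RingHom.ker ρ] M := IsAlgClosed.lift
  refine ⟨τ.toRingHom.comp (Ideal.Quotient.mk Q), fun r => ?_⟩
  exact τ.commutes (Ideal.Quotient.mk _ r)

theorem exists_specialization {σ B E M : Type*} [CommRing B] [Field E] [Field M] [IsAlgClosed M]
    {θ : B →+* E} (hθ : Function.Injective θ) {P : σ → E} {G : σ → Polynomial B}
    (hG : ∀ j, Polynomial.eval₂ θ (P j) (G j) = 0) (ρ : B →+* M)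
    (hρ : ∀ j, ρ (G j).leadingCoeff ≠ 0) :
    ∃ x : σ → M, ∀ Q : MvPolynomial σ B, eval₂ θ P Q = 0 → eval₂ ρ x Q = 0 := by
  have : IsDomain B := hθ.isDomain θ
  have hprime : (RingHom.ker ρ).IsPrime := RingHom.ker_isPrime ρ
  let B₁ := Localization.AtPrime (RingHom.ker ρ)
  let θ₁ : B₁ →+* E := IsLocalization.lift (M := (RingHom.ker ρ).primeCompl) (g := θ) fun y =>
    IsUnit.mk0 _ fun h => y.2 (by
      rw [(injective_iff_map_eq_zero _).1 hθ _ h]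
      exact zero_mem _)
  let ρ₁ : B₁ →+* M := IsLocalization.lift (M := (RingHom.ker ρ).primeCompl) (g := ρ) fun y =>
    IsUnit.mk0 _ fun h => y.2 h
  have hθ₁ : ∀ r, θ₁ (algebraMap B B₁ r) = θ r := fun r => IsLocalization.lift_eq _ r
  have hρ₁ : ∀ r, ρ₁ (algebraMap B B₁ r) = ρ r := fun r => IsLocalization.lift_eq _ r
  let _ : Algebra B₁ E := θ₁.toAlgebra
  have hinj : Function.Injective θ₁ := by
    rw [IsLocalization.lift_injective_iff]
    intro x y
    rw [hθ.eq_iff, (IsLocalization.injective B₁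
      (Ideal.primeCompl_le_nonZeroDivisors (RingHom.ker ρ))).eq_iff]
  have h_int : ∀ j, P j ∈ integralClosure B₁ E := by
    intro j
    have hu : IsUnit (algebraMap B B₁ (G j).leadingCoeff) :=
      IsLocalization.map_units B₁ (⟨_, hρ j⟩ : (RingHom.ker ρ).primeCompl)
    obtain ⟨u, hu⟩ := hu
    have hlc : ((G j).map (algebraMap B B₁)).leadingCoeff = u := by
      rw [Polynomial.leadingCoeff_map_of_leadingCoeff_ne_zero, hu]
      rw [← hu]
      exact u.ne_zero
    refine ⟨Polynomial.C (↑u⁻¹ : B₁) * (G j).map (algebraMap B B₁),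
      Polynomial.monic_C_mul_of_mul_leadingCoeff_eq_one (by rw [hlc, Units.inv_mul]), ?_⟩
    rw [Polynomial.eval₂_mul, Polynomial.eval₂_map]
    have : (algebraMap B₁ E).comp (algebraMap B B₁) = θ := RingHom.ext hθ₁
    rw [this, hG, mul_zero]
  have hinj' : Function.Injective (algebraMap B₁ (integralClosure B₁ E)) := fun x y hxy =>
    hinj (congrArg Subtype.val hxy)
  obtain ⟨τ, hτ⟩ := exists_ringHom_of_isIntegral hinj' ρ₁
  refine ⟨fun j => τ ⟨P j, h_int j⟩, fun Q hQ => ?_⟩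
  let ι : B →+* integralClosure B₁ E := (algebraMap B₁ (integralClosure B₁ E)).comp (algebraMap B B₁)
  have h1 : eval₂ ι (fun j => ⟨P j, h_int j⟩) Q = 0 := by
    apply Subtype.val_injective
    refine Eq.trans ?_ hQ
    refine (eval₂_comp_left (integralClosure B₁ E).val.toRingHom ι _ Q).trans ?_
    congr 1
    exact RingHom.ext hθ₁
  have h2 := eval₂_comp_left τ ι (fun j => ⟨P j, h_int j⟩) Q
  rw [h1, map_zero] at h2
  refine Eq.trans ?_ h2.symm
  congr 1
  exact RingHom.ext fun r => ((hτ _).trans (hρ₁ r)).symm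

theorem exists_generic_point {Ω σ : Type*} [Finite σ] [Field Ω] {H : Set (σ → Ω)} {i : σ}
    (hinf : ((fun h => h i) '' H).Infinite) (E : Type*) [Field E] [IsAlgClosed E]
    [Algebra (FractionRing (Polynomial Ω)) E] :
    ∃ P : σ → E, ∀ Q : MvPolynomial σ (Polynomial Ω),
      (∀ x ∈ H, eval₂ (Polynomial.evalRingHom (x i)) x Q = 0) →
      eval₂ ((algebraMap (FractionRing (Polynomial Ω)) E).comp
        (algebraMap (Polynomial Ω) (FractionRing (Polynomial Ω)))) P Q = 0 := by
  let F := FractionRing (Polynomial Ω)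
  let _ : Algebra (MvPolynomial σ (Polynomial Ω)) (MvPolynomial σ F) := algebraMvPolynomial
  let b : Ideal (MvPolynomial σ (Polynomial Ω)) :=
    ⨅ x : H, RingHom.ker (eval₂Hom (Polynomial.evalRingHom (x.1 i)) x.1)
  have hb : b.map (MvPolynomial.map (algebraMap (Polynomial Ω) F)) ≠ ⊤ := by
    intro htop
    have h1 : (1 : MvPolynomial σ F) ∈ b.map (algebraMap (MvPolynomial σ (Polynomial Ω)) _) := by
      rw [show algebraMap (MvPolynomial σ (Polynomial Ω)) (MvPolynomial σ F) =
        MvPolynomial.map (algebraMap (Polynomial Ω) F) from rfl, htop]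
      trivial
    rw [IsLocalization.mem_map_algebraMap_iff
      ((nonZeroDivisors (Polynomial Ω)).map (C : Polynomial Ω →+* MvPolynomial σ (Polynomial Ω)))]
      at h1
    obtain ⟨⟨⟨Q, hQ⟩, ⟨_, f, hf, rfl⟩⟩, h⟩ := h1
    rw [one_mul] at h
    have h2 : C f = Q := MvPolynomial.map_injective (algebraMap (Polynomial Ω) F)
      (IsFractionRing.injective _ _) h
    apply nonZeroDivisors.ne_zero hf
    apply Polynomial.eq_zero_of_infinite_isRoot
    refine hinf.mono ?_
    rintro _ ⟨x, hx, rfl⟩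
    have h3 := (Ideal.mem_iInf.1 hQ) ⟨x, hx⟩
    rw [RingHom.mem_ker, ← h2] at h3
    simpa using h3
  have : Nontrivial (MvPolynomial σ F ⧸ b.map (MvPolynomial.map (algebraMap (Polynomial Ω) F))) :=
    Ideal.Quotient.nontrivial_iff.2 hb
  obtain ⟨χ⟩ := nonempty_algHom_of_finiteType F
    (MvPolynomial σ F ⧸ b.map (MvPolynomial.map (algebraMap (Polynomial Ω) F))) E
  refine ⟨fun j => χ (Ideal.Quotient.mk _ (X j)), fun Q hQ => ?_⟩
  have h1 : Q ∈ b := Ideal.mem_iInf.2 fun x => hQ x.1 x.2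
  have h2 := Ideal.Quotient.eq_zero_iff_mem.2
    (Ideal.mem_map_of_mem (MvPolynomial.map (algebraMap (Polynomial Ω) F)) h1)
  have h3 := congrArg χ h2
  rw [map_zero] at h3
  rw [← h3, ← eval₂_map]
  have h4 := comp_aeval_apply (X : σ → MvPolynomial σ F)
    (χ.comp (Ideal.Quotient.mkₐ F (b.map (MvPolynomial.map (algebraMap (Polynomial Ω) F)))))
    (MvPolynomial.map (algebraMap (Polynomial Ω) F) Q)
  rw [aeval_X_left_apply] at h4
  exact h4.symm

end Specialization

section Transfer

variable {K Ω : Type*} [Field K] [Field Ω] [Algebra K Ω]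

/-- An ideal membership over `Ω` descends to all subalgebras containing finitely many elements. -/
theorem exists_finite_mem_span_of_mem_span {ι σ : Type*} [Fintype ι] {h : ι → MvPolynomial σ Ω}
    {Q : MvPolynomial σ Ω} (hQ : Q ∈ Ideal.span (Set.range h)) :
    ∃ T : Set Ω, T.Finite ∧ ∀ R : Subalgebra K Ω, T ⊆ R → ∀ (h' : ι → MvPolynomial σ R)
      (Q' : MvPolynomial σ R), (∀ l, MvPolynomial.map (algebraMap R Ω) (h' l) = h l) →
      MvPolynomial.map (algebraMap R Ω) Q' = Q → Q' ∈ Ideal.span (Set.range h') := by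
  classical
  obtain ⟨A, hA⟩ := (Ideal.mem_span_range_iff_exists_fun).1 hQ
  refine ⟨⋃ l, ((A l).coeffs : Set Ω), Set.finite_iUnion fun l => Finset.finite_toSet _,
    fun R hR h' Q' hh' hQ' => ?_⟩
  have hA' : ∀ l, ∃ A' : MvPolynomial σ R, MvPolynomial.map (algebraMap R Ω) A' = A l := fun l =>
    mem_range_map_iff_coeffs_subset.2 fun x hx => ⟨⟨x, hR (Set.mem_iUnion.2 ⟨l, hx⟩)⟩, rfl⟩
  choose A' hA' using hA'
  refine (Ideal.mem_span_range_iff_exists_fun).2 ⟨A', ?_⟩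
  apply MvPolynomial.map_injective (algebraMap R Ω) Subtype.val_injective
  rw [hQ', ← hA, map_sum]
  exact Finset.sum_congr rfl fun l _ => by rw [map_mul, hA', hh']

theorem exists_finite_forall_lift {h : Polynomial (Polynomial Ω)} :
    ∃ T : Set Ω, T.Finite ∧ ∀ R : Subalgebra K Ω, T ⊆ R → ∃ h' : Polynomial (Polynomial R),
      h'.map (Polynomial.mapRingHom (algebraMap R Ω)) = h := by
  classical
  refine ⟨⋃ n ∈ h.support, ((h.coeff n).coeffs : Set Ω),
    h.support.finite_toSet.biUnion fun n _ => Finset.finite_toSet _, fun R hR => ?_⟩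
  rw [← Polynomial.mem_lifts, Polynomial.lifts_iff_coeff_lifts]
  intro n
  change ∃ q : Polynomial R, q.map (algebraMap R Ω) = h.coeff n
  rw [← Polynomial.mem_lifts, Polynomial.lifts_iff_coeff_lifts]
  intro m
  by_cases h0 : (h.coeff n).coeff m = 0
  · exact ⟨0, by rw [h0, map_zero]⟩
  · refine ⟨⟨(h.coeff n).coeff m, hR ?_⟩, rfl⟩
    simp only [Set.mem_iUnion]
    refine ⟨n, ?_, Polynomial.coeff_mem_coeffs h0⟩
    rw [Polynomial.mem_support_iff]
    rintro h1
    simp [h1] at h0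

theorem eval₂_eq_zero_of_mem_span {R M σ ι : Type*} [CommRing R] [CommRing M] {h : ι → MvPolynomial σ R}
    {Q : MvPolynomial σ R} (hQ : Q ∈ Ideal.span (Set.range h)) {ρ : R →+* M} {x : σ → M}
    (hx : ∀ l, eval₂ ρ x (h l) = 0) : eval₂ ρ x Q = 0 := by
  have : Ideal.span (Set.range h) ≤ RingHom.ker (eval₂Hom ρ x) := by
    rw [Ideal.span_le]
    rintro _ ⟨l, rfl⟩
    exact hx l
  exact this hQ

theorem exists_infinite_image {X ι : Type*} [Finite ι] {H : Set (ι → X)} (hH : H.Infinite) :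
    ∃ i, ((fun h => h i) '' H).Infinite := by
  by_contra! hcon
  refine hH ((Set.Finite.pi' hcon).subset ?_)
  intro h hh i
  exact ⟨h, hh, rfl⟩

theorem exists_infinite_specialization [IsAlgClosed Ω] {M : Type*} [Field M] [IsAlgClosed M]
    [Algebra K M] {σ ι : Type*} [Finite σ] [Fintype ι] {H : Set (σ → Ω)} (hH : H.Infinite)
    (h : ι → MvPolynomial σ Ω) (hh : ∀ l, ∀ x ∈ H, eval x (h l) = 0) (T : Set Ω) (hT : T.Finite) :
    ∃ (R : Subalgebra K Ω) (ρ : R →ₐ[K] M) (h' : ι → MvPolynomial σ R), T ⊆ R ∧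
      (∀ l, MvPolynomial.map (algebraMap R Ω) (h' l) = h l) ∧
      {x : σ → M | ∀ l, eval₂ (ρ : R →+* M) x (h' l) = 0}.Infinite := by
  classical
  obtain ⟨i, hi⟩ := exists_infinite_image hH
  let E := AlgebraicClosure (FractionRing (Polynomial Ω))
  obtain ⟨P, hP⟩ := exists_generic_point hi E
  let θ : Polynomial Ω →+* E := (algebraMap (FractionRing (Polynomial Ω)) E).comp
        (algebraMap (Polynomial Ω) (FractionRing (Polynomial Ω)))
  have hθ : Function.Injective θ :=
    (algebraMap (FractionRing (Polynomial Ω)) E).injective.comp (IsFractionRing.injective _ _)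
  have hG : ∀ j, ∃ G : Polynomial (Polynomial Ω), G ≠ 0 ∧ Polynomial.eval₂ θ (P j) G = 0 := by
    intro j
    obtain ⟨G, hG, hGP⟩ := (IsFractionRing.isAlgebraic_iff (Polynomial Ω)
      (FractionRing (Polynomial Ω)) E).2 (AlgebraicClosure.isAlgebraic _ |>.isAlgebraic (P j))
    exact ⟨G, hG, hGP⟩
  choose G hG0 hG using hG
  have := Fintype.ofFinite σ
  let f : Polynomial Ω := ∏ j, (G j).leadingCoeff
  have hf : f ≠ 0 := Finset.prod_ne_zero_iff.2 fun j _ => Polynomial.leadingCoeff_ne_zero.2 (hG0 j)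
  choose TG hTG hTG' using fun j => exists_finite_forall_lift (K := K) (h := G j)
  let S : Set Ω := T ∪ (⋃ l, ((h l).coeffs : Set Ω)) ∪ (⋃ j, TG j) ∪ {f.leadingCoeff⁻¹}
  have hS : S.Finite := ((hT.union (Set.finite_iUnion fun l => Finset.finite_toSet _)).union
    (Set.finite_iUnion hTG)).union (Set.finite_singleton _)
  let R : Subalgebra K Ω := Algebra.adjoin K S
  have hSR : S ⊆ R := Algebra.subset_adjoin
  have : Algebra.FiniteType K R := by
    rw [← Subalgebra.fg_iff_finiteType]
    exact Subalgebra.fg_def.2 ⟨S, hS, rfl⟩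
  obtain ⟨ρ⟩ := nonempty_algHom_of_finiteType K R M
  have hlift : ∀ l, ∃ h' : MvPolynomial σ R, MvPolynomial.map (algebraMap R Ω) h' = h l := fun l =>
    mem_range_map_iff_coeffs_subset.2 fun x hx =>
      ⟨⟨x, hSR (Or.inl (Or.inl (Or.inr (Set.mem_iUnion.2 ⟨l, hx⟩))))⟩, rfl⟩
  choose h' hh' using hlift
  choose G' hG' using fun j => hTG' j R fun x hx =>
    hSR (Or.inl (Or.inr (Set.mem_iUnion.2 ⟨j, hx⟩)))
  refine ⟨R, ρ, h', fun x hx => hSR (Or.inl (Or.inl (Or.inl hx))), hh', ?_⟩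
  let ι' : Polynomial R →+* Polynomial Ω := Polynomial.mapRingHom (algebraMap R Ω)
  have hι' : Function.Injective ι' :=
    Polynomial.map_injective (algebraMap R Ω) Subtype.val_injective
  let f' : Polynomial R := ∏ j, (G' j).leadingCoeff
  have hff' : ι' f' = f := by
    rw [map_prod]
    refine Finset.prod_congr rfl fun j _ => ?_
    rw [← hG' j, Polynomial.leadingCoeff_map_of_injective hι']
  have hlc : ((f'.leadingCoeff : R) : Ω) = f.leadingCoeff := by
    rw [← hff']
    exact (Polynomial.leadingCoeff_map_of_injective (f := algebraMap R Ω)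
      Subtype.val_injective f').symm
  have hρlc : ρ f'.leadingCoeff ≠ 0 := by
    intro h0
    have h1 : f'.leadingCoeff * ⟨f.leadingCoeff⁻¹, hSR (Or.inr rfl)⟩ = 1 := by
      apply Subtype.val_injective
      change ((f'.leadingCoeff : R) : Ω) * f.leadingCoeff⁻¹ = 1
      rw [hlc, mul_inv_cancel₀ (Polynomial.leadingCoeff_ne_zero.2 hf)]
    have h2 := congrArg ρ h1
    rw [map_mul, h0, zero_mul, map_one] at h2
    exact zero_ne_one h2
  have hfM : f'.map (ρ : R →+* M) ≠ 0 := fun h0 => hρlc (by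
    have := congrArg (fun q => q.coeff f'.natDegree) h0
    simpa using this)
  have hu : {u : M | Polynomial.eval₂ (ρ : R →+* M) u f' ≠ 0}.Infinite := by
    have := IsAlgClosed.instInfinite (K := M)
    have h1 : {u : M | Polynomial.eval₂ (ρ : R →+* M) u f' = 0}.Finite := by
      refine (f'.map (ρ : R →+* M)).roots.toFinset.finite_toSet.subset fun u hu => ?_
      simpa [hfM, Polynomial.eval_map] using hu
    exact h1.infinite_compl
  refine Set.Infinite.of_image (fun x => x i) (hu.mono fun u hu => ?_)
  have hprod : ∀ j, Polynomial.eval₂RingHom (ρ : R →+* M) u (G' j).leadingCoeff ≠ 0 := by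
    have h1 : Polynomial.eval₂RingHom (ρ : R →+* M) u f' ≠ 0 := hu
    rw [map_prod, Finset.prod_ne_zero_iff] at h1
    exact fun j => h1 j (Finset.mem_univ j)
  obtain ⟨x, hx⟩ := exists_specialization (θ := θ.comp ι') (hθ.comp hι') (P := P) (G := G')
    (fun j => by rw [← Polynomial.eval₂_map]; exact hG' j ▸ hG j) _ hprod
  have hQ : ∀ Q : MvPolynomial σ (Polynomial R),
      (∀ y ∈ H, eval₂ ((Polynomial.evalRingHom (y i)).comp ι') y Q = 0) →
      eval₂ (Polynomial.eval₂RingHom (ρ : R →+* M) u) x Q = 0 := fun Q hQ => hx Q (by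
    rw [← eval₂_map]
    exact hP _ fun y hy => by rw [eval₂_map]; exact hQ y hy)
  refine ⟨x, fun l => ?_, ?_⟩
  · have := hQ (MvPolynomial.map Polynomial.C (h' l)) fun y hy => by
      rw [eval₂_map, ← hh l y hy, ← hh' l, eval_map]
      congr 1
      ext r
      simp [ι']
    rw [eval₂_map] at this
    rw [← this]
    congr 1
    ext r
    simp
  · have := hQ (X i - C Polynomial.X) fun y hy => by simp [ι']
    simpa [sub_eq_zero] using this

end Transfer

section Descent

variable {K Ω : Type*} [Field K] [Field Ω] [Algebra K Ω]

/-- Consequences between polynomial equations over `Ω` persist under specialization. -/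
theorem exists_finite_forall_specialization [IsAlgClosed Ω] {ι σ M : Type*} [Fintype ι] [Finite σ]
    [Field M] [Algebra K M] {h : ι → MvPolynomial σ Ω} {Q : MvPolynomial σ Ω}
    (hQ : ∀ x, (∀ l, eval x (h l) = 0) → eval x Q = 0) :
    ∃ T : Set Ω, T.Finite ∧ ∀ R : Subalgebra K Ω, T ⊆ R → ∀ (h' : ι → MvPolynomial σ R)
      (Q' : MvPolynomial σ R), (∀ l, MvPolynomial.map (algebraMap R Ω) (h' l) = h l) →
      MvPolynomial.map (algebraMap R Ω) Q' = Q → ∀ (ρ : R →+* M) (x : σ → M),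
      (∀ l, eval₂ ρ x (h' l) = 0) → eval₂ ρ x Q' = 0 := by
  have h1 : Q ∈ (Ideal.span (Set.range h)).radical := by
    rw [← vanishingIdeal_zeroLocus_eq_radical (K := Ω)]
    intro x hx
    exact hQ x fun l => hx _ (Ideal.subset_span ⟨l, rfl⟩)
  obtain ⟨N, hN⟩ := h1
  obtain ⟨T, hT, hTR⟩ := exists_finite_mem_span_of_mem_span (K := K) hN
  refine ⟨T, hT, fun R hR h' Q' hh' hQ' ρ x hx => ?_⟩
  have := eval₂_eq_zero_of_mem_span
    (hTR R hR h' (Q' ^ N) hh' (by rw [map_pow, hQ'])) (ρ := ρ) hx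
  rw [eval₂_pow] at this
  exact eq_zero_of_pow_eq_zero this
end Descent

section Polynomials

variable {F R S σ : Type*} [CommRing F] [CommRing R] [CommRing S]

/-- The polynomial `f(b + X)`. -/
noncomputable def translatePoly [Algebra F R] (b : σ → R) (f : MvPolynomial σ F) :
    MvPolynomial σ R :=
  eval₂ (C.comp (algebraMap F R)) (fun i => C (b i) + X i) f

theorem eval₂_translatePoly [Algebra F R] (b : σ → R) (f : MvPolynomial σ F) (ρ : R →+* S)
    (x : σ → S) :
    eval₂ ρ x (translatePoly b f) =
      eval₂ (ρ.comp (algebraMap F R)) ((fun i => ρ (b i)) + x) f := by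
  rw [translatePoly, ← coe_eval₂Hom, eval₂_comp_left]
  congr 1
  · ext r
    simp
  · ext i
    simp

theorem map_translatePoly [Algebra F R] [Algebra F S] (b : σ → R) (f : MvPolynomial σ F)
    (ρ : R →ₐ[F] S) :
    MvPolynomial.map (ρ : R →+* S) (translatePoly b f) = translatePoly (fun i => ρ (b i)) f := by
  rw [translatePoly, eval₂_comp_left, translatePoly]
  congr 1
  · ext r
    simp
  · ext i
    simp

/-- The polynomial `f(X - Y)` in two groups of variables. -/
noncomputable def subPoly (f : MvPolynomial σ R) : MvPolynomial (σ ⊕ σ) R :=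
  eval₂ C (fun i => X (Sum.inl i) - X (Sum.inr i)) f

theorem eval₂_subPoly (f : MvPolynomial σ R) (ρ : R →+* S) (x y : σ → S) :
    eval₂ ρ (Sum.elim x y) (subPoly f) = eval₂ ρ (x - y) f := by
  rw [subPoly, ← coe_eval₂Hom, eval₂_comp_left]
  congr 1
  · ext r
    simp
  · ext i
    simp

theorem map_subPoly (f : MvPolynomial σ R) (ρ : R →+* S) :
    MvPolynomial.map ρ (subPoly f) = subPoly (MvPolynomial.map ρ f) := by
  rw [subPoly, eval₂_comp_left, subPoly, eval₂_map]
  congr 1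
  · ext r
    simp
  · ext i
    simp

end Polynomials

/-- A translate of an infinite closed additive subgroup contained in a closed set over an
algebraically closed extension specializes to one over any algebraically closed extension. -/
theorem exists_infinite_subgroup_of_infinite_subgroup {K Ω M : Type*} [Field K] [Field Ω] [Field M]
    [IsAlgClosed Ω] [IsAlgClosed M] [Algebra K Ω] [Algebra K M] {g : ℕ}
    {I : Ideal (MvPolynomial (Fin g) K)} {b : Fin g → Ω} {H : AddSubgroup (Fin g → Ω)}
    (hH : (H : Set (Fin g → Ω)).Infinite)
    (hHJ : ∃ J : Ideal (MvPolynomial (Fin g) Ω),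
      (H : Set (Fin g → Ω)) = zeroLocusVia J (RingHom.id Ω))
    (hHI : ∀ h ∈ H, b + h ∈ zeroLocusVia I (algebraMap K Ω)) :
    ∃ (a : Fin g → M) (H' : AddSubgroup (Fin g → M)), (H' : Set (Fin g → M)).Infinite ∧
      (∃ J : Ideal (MvPolynomial (Fin g) M),
        (H' : Set (Fin g → M)) = zeroLocusVia J (RingHom.id M)) ∧
      ∀ h ∈ H', a + h ∈ zeroLocusVia I (algebraMap K M) := by
  classical
  obtain ⟨J, hJ⟩ := hHJ
  obtain ⟨s, hs⟩ := IsNoetherian.noetherian J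
  obtain ⟨q, hq⟩ := IsNoetherian.noetherian I
  let h : s → MvPolynomial (Fin g) Ω := Subtype.val
  have hJh : J = Ideal.span (Set.range h) := by
    rw [Subtype.range_coe]
    exact hs.symm
  have hmem : ∀ x, x ∈ H ↔ ∀ l, eval x (h l) = 0 := by
    intro x
    change x ∈ (H : Set (Fin g → Ω)) ↔ _
    rw [hJ]
    constructor
    · intro hx l
      exact hx _ (by rw [hJh]; exact Ideal.subset_span ⟨l, rfl⟩)
    · intro hx r hr
      rw [hJh] at hr
      exact eval₂_eq_zero_of_mem_span hr hx
  have hTq : ∀ r : q, ∀ x, (∀ l, eval x (h l) = 0) → eval x (translatePoly b r.1) = 0 := by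
    intro r x hx
    rw [eval, coe_eval₂Hom, eval₂_translatePoly]
    exact hHI x ((hmem x).2 hx) r.1 (hq ▸ Ideal.subset_span r.2)
  choose T₁ hT₁ hT₁' using fun r : q =>
    exists_finite_forall_specialization (K := K) (M := M) (hTq r)
  let h2 : s ⊕ s → MvPolynomial (Fin g ⊕ Fin g) Ω :=
    Sum.elim (fun l => rename Sum.inl (h l)) fun l => rename Sum.inr (h l)
  have hD : ∀ l : s, ∀ z, (∀ l', eval z (h2 l') = 0) → eval z (subPoly (h l)) = 0 := by
    intro l z hz
    have h1 : (z ∘ Sum.inl) ∈ H := (hmem _).2 fun l => by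
      simpa [h2, eval_rename] using hz (Sum.inl l)
    have h2 : (z ∘ Sum.inr) ∈ H := (hmem _).2 fun l => by
      simpa [h2, eval_rename] using hz (Sum.inr l)
    rw [eval, coe_eval₂Hom, ← Sum.elim_comp_inl_inr z, eval₂_subPoly]
    exact (hmem _).1 (H.sub_mem h1 h2) l
  choose T₂ hT₂ hT₂' using fun l : s =>
    exists_finite_forall_specialization (K := K) (M := M) (hD l)
  obtain ⟨R, ρ, h', hTR, hh', hinf⟩ := exists_infinite_specialization (K := K) (M := M) hH h
    (fun l x hx => (hmem x).1 hx l) ((⋃ r, T₁ r) ∪ (⋃ l, T₂ l) ∪ Set.range b)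
    (((Set.finite_iUnion hT₁).union (Set.finite_iUnion hT₂)).union (Set.finite_range b))
  let b' : Fin g → R := fun i => ⟨b i, hTR (Or.inr ⟨i, rfl⟩)⟩
  have hsub : ∀ x y : Fin g → M, (∀ l, eval₂ (ρ : R →+* M) x (h' l) = 0) →
      (∀ l, eval₂ (ρ : R →+* M) y (h' l) = 0) → ∀ l, eval₂ (ρ : R →+* M) (x - y) (h' l) = 0 := by
    intro x y hx hy l
    rw [← eval₂_subPoly]
    refine hT₂' l R (fun t ht => hTR (Or.inl (Or.inr (Set.mem_iUnion.2 ⟨l, ht⟩))))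
      (Sum.elim (fun l => rename Sum.inl (h' l)) fun l => rename Sum.inr (h' l)) _ ?_ ?_ ρ _ ?_
    · rintro (l | l)
      · simp [h2, map_rename, hh']
      · simp [h2, map_rename, hh']
    · rw [map_subPoly, hh']
    · rintro (l | l)
      · simpa [eval₂_rename] using hx l
      · simpa [eval₂_rename] using hy l
  refine ⟨fun i => ρ (b' i), AddSubgroup.ofSub {x | ∀ l, eval₂ (ρ : R →+* M) x (h' l) = 0}
    hinf.nonempty ?_, hinf, ⟨Ideal.span (Set.range fun l => MvPolynomial.map (ρ : R →+* M) (h' l)),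
      ?_⟩, ?_⟩
  · intro x hx y hy
    rw [← sub_eq_add_neg]
    exact hsub x y hx hy
  · ext x
    constructor
    · intro hx r hr
      exact eval₂_eq_zero_of_mem_span hr fun l => by
        rw [eval₂_map]
        exact hx l
    · intro hx l
      have := hx _ (Ideal.subset_span ⟨l, rfl⟩)
      rwa [eval₂_map] at this
  · intro x hx r hr
    have hq' : I = Ideal.span (Set.range (Subtype.val : q → MvPolynomial (Fin g) K)) := by
      rw [Subtype.range_coe]
      exact hq.symm
    rw [hq'] at hr
    refine eval₂_eq_zero_of_mem_span hr fun r => ?_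
    have := hT₁' r R (fun t ht => hTR (Or.inl (Or.inl (Set.mem_iUnion.2 ⟨r, ht⟩)))) h'
      (translatePoly b' r.1) hh' (map_translatePoly b' r.1 R.val) ρ x hx
    rw [eval₂_translatePoly] at this
    rw [← this]
    congr 1
    ext r
    simp

end SpecialDrinfeld

namespace SpecialDrinfeld

open MvPolynomial Filter

section Uniformity

theorem exists_injOn_Iic {α : Type*} {S : Set α} {n : ℕ} (hS : S.Finite → n < S.ncard) :
    ∃ s : ℕ → α, (∀ j ≤ n, s j ∈ S) ∧ ∀ i ≤ n, ∀ j ≤ n, s i = s j → i = j := by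
  obtain ⟨t, htS, ht⟩ : ∃ t : Finset α, (t : Set α) ⊆ S ∧ t.card = n + 1 := by
    by_cases h : S.Finite
    · obtain ⟨t, ht, htn⟩ := Finset.exists_subset_card_eq (s := h.toFinset) (n := n + 1) (by
        rw [← Set.ncard_eq_toFinset_card S h]
        exact hS h)
      exact ⟨t, fun x hx => h.mem_toFinset.1 (ht hx), htn⟩
    · exact Set.Infinite.exists_subset_card_eq h (n + 1)
  let e := t.equivFinOfCardEq ht
  refine ⟨fun j => e.symm (Fin.ofNat (n + 1) j), fun j _ => htS (e.symm _).2,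
    fun i hi j hj hij => ?_⟩
  have h1 := congrArg Fin.val (e.symm.injective (Subtype.val_injective hij))
  simpa [Fin.ofNat, Nat.mod_eq_of_lt (Nat.lt_succ_of_le hi),
    Nat.mod_eq_of_lt (Nat.lt_succ_of_le hj)] using h1

theorem eval₂_mk {ι K : Type*} {L : ι → Type*} [Field K] [∀ n, Field (L n)] {M : Type*} [Field M]
    (mk : (∀ n, L n) →+* M) (f : ∀ n, K →+* L n) {φ : K →+* M} (hφ : ∀ c, φ c = mk fun n => f n c)
    {σ : Type*} (s : ∀ n, σ → L n) (q : MvPolynomial σ K) :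
    eval₂ φ (fun i => mk fun n => s n i) q = mk fun n => eval₂ (f n) (s n) q := by
  induction q using MvPolynomial.induction_on with
  | C a => simp [hφ]
  | add P Q hP hQ =>
    simp only [eval₂_add, hP, hQ]
    exact (map_add mk _ _).symm
  | mul_X P i hP =>
    simp only [eval₂_mul, hP, eval₂_X]
    exact (map_mul mk _ _).symm

/-- Arbitrarily large finite families of highly divisible points yield, in an ultraproduct,
an infinite family of infinitely divisible points. -/
theorem exists_infinite_family {p : ℕ} [Fact p.Prime] {K : Type u} [Field K] [CharP K p]
    {d D : ℕ} {c : ℕ → K} {g : ℕ} (I : Ideal (MvPolynomial (Fin g) K))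
    (L : ℕ → Type v) [∀ n, Field (L n)] [∀ n, CharP (L n) p] [∀ n, Algebra K (L n)]
    (hKL : ∀ n, PSep p K (L n)) (a : ∀ n, Fin g → L n)
    (hcard : ∀ n, ∃ s : ℕ → Fin g → L n,
      (∀ j ≤ n, (∃ x ∈ zeroLocusVia I (algebraMap K (L n)), s j = a n + x) ∧ ∃ z : Fin g → L n,
        s j = fun i => (specialTphi p d D fun i => algebraMap K (L n) (c i))^[n] (z i)) ∧
      ∀ i ≤ n, ∀ j ≤ n, s i = s j → i = j) :
    ∃ (k : Type v) (_ : Field k) (_ : CharP k p) (_ : Algebra K k) (a : Fin g → k)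
      (s : ℕ → Fin g → k), PSep p K k ∧ Function.Injective s ∧
      (∀ n m, ∃ z : Fin g → k, ∀ i,
        (specialTphi p d D fun i => algebraMap K k (c i))^[m] (z i) = s n i) ∧
      ∀ n, ∃ x ∈ zeroLocusVia I (algebraMap K k), s n = a + x := by
  obtain ⟨k, _, mk, hmk, hmk0⟩ := exists_ultraproduct L
  let _ : Algebra K k := (mk.comp (RingHom.pi fun n => algebraMap K (L n))).toAlgebra
  have halg : ∀ c, algebraMap K k c = mk fun n => algebraMap K (L n) c := fun _ => rfl
  have : CharP k p := charP_of_injective_algebraMap (algebraMap K k).injective p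
  have hmkeq : ∀ x y, mk x = mk y ↔ ∀ᶠ n in hyperfilter ℕ, x n = y n := fun x y => by
    rw [← sub_eq_zero, ← map_sub, hmk0]
    simp only [Pi.sub_apply, sub_eq_zero]
  have hge : ∀ m, ∀ᶠ n in (hyperfilter ℕ : Filter ℕ), m ≤ n := fun m =>
    Nat.hyperfilter_le_atTop (eventually_ge_atTop m)
  choose s hs hinj using hcard
  refine ⟨k, inferInstance, inferInstance, inferInstance, fun i => mk fun n => a n i,
    fun j i => mk fun n => s n j i, PSep.ultraproduct hKL mk hmk hmk0 halg, ?_, ?_, ?_⟩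
  · intro j j' hjj
    have h1 : ∀ᶠ n in hyperfilter ℕ, ∀ i, s n j i = s n j' i :=
      eventually_all.2 fun i => (hmkeq _ _).1 (congrFun hjj i)
    obtain ⟨n, hn, hnj, hnj'⟩ := (h1.and ((hge j).and (hge j'))).exists
    exact hinj n j hnj j' hnj' (funext hn)
  · intro j m
    have h1 : ∀ n, ∃ z : Fin g → L n, max j m ≤ n → ∀ i,
        (specialTphi p d D fun i => algebraMap K (L n) (c i))^[m] (z i) = s n j i := by
      intro n
      by_cases hn : max j m ≤ n
      · obtain ⟨-, z, hz⟩ := hs n j ((le_max_left _ _).trans hn)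
        refine ⟨fun i => (specialTphi p d D fun i => algebraMap K (L n) (c i))^[n - m] (z i),
          fun _ i => ?_⟩
        rw [← Function.iterate_add_apply, Nat.add_sub_cancel' ((le_max_right _ _).trans hn), hz]
      · exact ⟨0, fun h => absurd h hn⟩
    choose z hz using h1
    refine ⟨fun i => mk fun n => z n i, fun i => ?_⟩
    refine (specialTphi_iterate_mk mk p d D (fun n i => algebraMap K (L n) (c i)) m _).trans ?_
    rw [hmkeq]
    filter_upwards [hge (max j m)] with n hn
    exact hz n hn i
  · intro j
    refine ⟨fun i => mk fun n => s n j i - a n i, fun q hq => ?_, ?_⟩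
    · refine (eval₂_mk mk (fun n => algebraMap K (L n)) halg (fun n i => s n j i - a n i) q).trans ?_
      rw [hmk0]
      filter_upwards [hge j] with n hn
      obtain ⟨⟨x, hx, hxs⟩, -⟩ := hs n j hn
      have : (fun i => s n j i - a n i) = x := by
        rw [hxs]
        ext i
        simp
      rw [this]
      exact hx q hq
    · ext i
      simp only [Pi.add_apply]
      rw [← map_add]
      congr 1
      ext n
      simp

end Uniformity

end SpecialDrinfeld

/-- Let `φ` be a Drinfeld module of special characteristic over `K` with
positive modular transcendence degree and `Φ[t^∞](K^sep)` finite.  Let `X` be a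
Zariski-closed subset of affine `g`-space defined over `K` such that `X(K̄)` contains no
translate of an infinite Zariski-closed additive subgroup of `K̄^g`.  Then there are
`ℓ, m ∈ ℕ` such that for every fully separable extension `L/K` and every `a ∈ L^g`, the
set `(a + X(L)) ∩ Φ_{t^m}(L^g)` has at most `ℓ` elements. -/
theorem stmt11 {K : Type u} [Field K] (p : ℕ) [Fact p.Prime] [CharP K p]
    (d D : ℕ) (hd : 1 ≤ d) (hdD : d ≤ D) (c : ℕ → K)
    (hcd : c d ≠ 0) (hcD : c D ≠ 0)
    (hmod : PosModularTransc p d D c)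
    -- `Φ[t^∞](K^sep)` is finite:
    (htor : {x : AlgebraicClosure K | x ∈ separableClosure K (AlgebraicClosure K) ∧
      ∃ n : ℕ, (specialTphi p d D (fun i => algebraMap K (AlgebraicClosure K) (c i)))^[n] x
        = 0}.Finite)
    (g : ℕ) (hg : 1 ≤ g) (I : Ideal (MvPolynomial (Fin g) K))
    -- `X(K̄)` contains no translate of an infinite Zariski-closed additive subgroup:
    (hX : ¬ ∃ (a : Fin g → AlgebraicClosure K)
        (H : AddSubgroup (Fin g → AlgebraicClosure K)),
      (H : Set (Fin g → AlgebraicClosure K)).Infinite ∧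
      (∃ J : Ideal (MvPolynomial (Fin g) (AlgebraicClosure K)),
        (H : Set (Fin g → AlgebraicClosure K)) =
          zeroLocusVia J (RingHom.id (AlgebraicClosure K))) ∧
      (fun h => a + h) '' (H : Set (Fin g → AlgebraicClosure K)) ⊆
        zeroLocusVia I (algebraMap K (AlgebraicClosure K))) :
    ∃ ℓ m : ℕ, ∀ (L : Type v) [Field L] [Algebra K L],
      (haveI : CharP L p := charP_of_injective_ringHom (algebraMap K L).injective p;
        FullySeparable p K L) →
      ∀ a : Fin g → L,
        {y : Fin g → L | (∃ x ∈ zeroLocusVia I (algebraMap K L), y = a + x) ∧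
          ∃ z : Fin g → L,
            y = fun i => (specialTphi p d D (fun i => algebraMap K L (c i)))^[m] (z i)}.Finite
        ∧
        {y : Fin g → L | (∃ x ∈ zeroLocusVia I (algebraMap K L), y = a + x) ∧
          ∃ z : Fin g → L,
            y = fun i => (specialTphi p d D (fun i => algebraMap K L (c i)))^[m] (z i)}.ncard
          ≤ ℓ := by
  have hdD' : d < D := lt_of_le_of_ne hdD (SpecialDrinfeld.PosModularTransc.ne hd hcd hmod)
  obtain ⟨n₀, hn₀⟩ := SpecialDrinfeld.exists_torsion_bound hdD hcd hcD htor
  by_contra! hcon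
  choose L iF iA hL a ha using fun n => hcon n n
  have hchar : ∀ n, CharP (L n) p := fun n =>
    charP_of_injective_ringHom (algebraMap K (L n)).injective p
  obtain ⟨k, _, _, _, b, s, hKk, hs, hdiv, hsI⟩ := SpecialDrinfeld.exists_infinite_family
    (d := d) (D := D) (c := c) I L (fun n => SpecialDrinfeld.FullySeparable.pSep (hL n)) a fun n =>
      SpecialDrinfeld.exists_injOn_Iic (ha n)
  obtain ⟨Ω, _, _, _, _, b', H, hH, hHJ, hHI⟩ :=
    SpecialDrinfeld.exists_infinite_subgroup hd hdD' hcd hcD hn₀ hKk I b hs hdiv hsI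
  obtain ⟨a', H', hH', hHJ', hHI'⟩ :=
    SpecialDrinfeld.exists_infinite_subgroup_of_infinite_subgroup (M := AlgebraicClosure K)
      hH hHJ hHI
  refine hX ⟨a', H', hH', hHJ', ?_⟩
  rintro _ ⟨h, hh, rfl⟩
  exact hHI' h hh
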